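/- arXiv:1404.0654 — 3 statements merged into one kernel-verified Lean document; each statement's English description precedes it below -/
import Mathlib

section
/- There exists a constant C > 0 such that the following holds for every prime p and every δ ∈ (0,1). Let f : F_p^n → F_p be a polynomial of total degree at most 3 that is an affine disperser for dimension k. Then f is an affine extractor for dimension k + ⌈C · (log(1/δ))²⌉ with bias δ. -/
open MvPolynomial
open scoped Classical

/-- The coset `u₀ + U` of a linear subspace `U`, as a finset. -/
noncomputable def cosetFinset {F : Type} [Field F] [Fintype F] {n : ℕ}
    (u₀ : Fin n → F) (U : Submodule F (Fin n → F)) : Finset (Fin n → F) :=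
  (Set.toFinite {x : Fin n → F | ∃ u ∈ U, x = u₀ + u}).toFinset

/-- The distribution of `f x`, for `x` uniform on `S`, is within statistical distance `ε`
of the uniform distribution on `F`. -/
def CloseToUniform {F : Type} [Fintype F] {D : Type} (f : D → F) (S : Finset D)
    (ε : ℝ) : Prop :=
  ∀ A : Finset F,
    |((S.filter fun x => f x ∈ A).card : ℝ) / (S.card : ℝ) -
        (A.card : ℝ) / (Fintype.card F : ℝ)| ≤ ε

/-- `f` is an affine extractor for dimension `k` with bias `ε`. -/
def AffineExtractor {F : Type} [Field F] [Fintype F] {n : ℕ}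
    (f : (Fin n → F) → F) (k : ℕ) (ε : ℝ) : Prop :=
  ∀ (u₀ : Fin n → F) (U : Submodule F (Fin n → F)),
    Module.finrank F ↥U = k → CloseToUniform f (cosetFinset u₀ U) ε

/-- `f` is an affine disperser for dimension `k`: `f` is non-constant on every affine
subspace `u₀ + U` with `dim U = k`. -/
def AffineDisperser {F : Type} [Field F] {n : ℕ} (f : (Fin n → F) → F) (k : ℕ) : Prop :=
  ∀ (u₀ : Fin n → F) (U : Submodule F (Fin n → F)), Module.finrank F ↥U = k →
    ∃ u ∈ U, ∃ v ∈ U, f (u₀ + u) ≠ f (u₀ + v)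

open Module

theorem exists_linearMap_fwdDiff {p : ℕ} {V : Type} [AddCommGroup V] [Module (ZMod p) V]
    (g : V → ZMod p) (hg : ∀ a b x, fwdDiff a (fwdDiff b g) x = 0) :
    ∃ l : V →ₗ[ZMod p] ZMod p, ∀ a x, fwdDiff a g x = l a := by
  have key : ∀ x y, g (x + y) = g x + g y - g 0 := by
    intro x y
    have := hg x y 0
    simp only [fwdDiff, zero_add] at this
    linear_combination this
  refine ⟨(AddMonoidHom.mk' (fun a => g a - g 0) ?_).toZModLinearMap p, ?_⟩
  · intro a b
    simp only [key a b]; ring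
  · intro a x
    simp only [fwdDiff, key x a, AddMonoidHom.coe_toZModLinearMap, AddMonoidHom.mk'_apply]
    ring

theorem fwdDiff_swap {V F : Type} [AddCommGroup V] [AddCommGroup F] (a b : V) (q : V → F) :
    fwdDiff a (fwdDiff b q) = fwdDiff b (fwdDiff a q) := by
  funext x
  simp only [fwdDiff, add_right_comm x a b]
  abel

theorem exists_bilinear_fwdDiff {p : ℕ} {V : Type} [AddCommGroup V] [Module (ZMod p) V]
    (q : V → ZMod p) (hq : ∀ a b c x, fwdDiff a (fwdDiff b (fwdDiff c q)) x = 0) :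
    ∃ B : V →ₗ[ZMod p] V →ₗ[ZMod p] ZMod p, ∀ a b x, fwdDiff a (fwdDiff b q) x = B a b := by
  choose l hl using fun a => exists_linearMap_fwdDiff (fwdDiff a q) (fun b c x => hq b c a x)
  refine ⟨(AddMonoidHom.mk' l ?_).toZModLinearMap p, ?_⟩
  · intro a b
    ext c
    rw [LinearMap.add_apply, ← hl _ c 0, ← hl _ c 0, ← hl _ c 0, fwdDiff_swap, fwdDiff_swap c a,
      fwdDiff_swap c b, hl, hl, hl, map_add]
  · intro a b x
    rw [fwdDiff_swap, hl]
    rfl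

theorem exists_trilinear_fwdDiff {p : ℕ} {V : Type} [AddCommGroup V] [Module (ZMod p) V]
    (f : V → ZMod p)
    (hf : ∀ a b c d x, fwdDiff a (fwdDiff b (fwdDiff c (fwdDiff d f))) x = 0) :
    ∃ T : V →ₗ[ZMod p] V →ₗ[ZMod p] V →ₗ[ZMod p] ZMod p,
      ∀ a b c x, fwdDiff a (fwdDiff b (fwdDiff c f)) x = T c a b := by
  choose B hB using fun a => exists_bilinear_fwdDiff (fwdDiff a f) (fun b c d x => hf b c d a x)
  have hrot : ∀ a b c : V, fwdDiff a (fwdDiff b (fwdDiff c f)) =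
      fwdDiff c (fwdDiff b (fwdDiff a f)) := by
    intro a b c
    rw [fwdDiff_swap b c, fwdDiff_swap a c, fwdDiff_swap a b]
  refine ⟨(AddMonoidHom.mk' B ?_).toZModLinearMap p, ?_⟩
  · intro a b
    ext c d
    rw [LinearMap.add_apply, LinearMap.add_apply, ← hB _ c d 0, ← hB _ c d 0, ← hB _ c d 0,
      hrot, hrot c d a, hrot c d b, hB, hB, hB, map_add, LinearMap.add_apply]
  · intro a b c x
    rw [hB]
    rfl

/-- If `A`, `B` and `A + B` have rank at most `ρ = rank A` on `K`, then `B` has rank at most `ρ / 2`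
on the radical of `A`. -/
theorem two_mul_finrank_orthogonal_le {F V : Type} [Field F] [AddCommGroup V] [Module F V]
    [FiniteDimensional F V] (A B : V →ₗ[F] V →ₗ[F] F) (hA : ∀ x y, A x y = A y x)
    (K : Submodule F V) (ρ : ℕ)
    (h1 : finrank F K = finrank F ↥(K ⊓ K.orthogonalBilin A) + ρ)
    (h2 : finrank F K ≤ finrank F ↥(K ⊓ K.orthogonalBilin B) + ρ)
    (h3 : finrank F K ≤ finrank F ↥(K ⊓ K.orthogonalBilin (A + B)) + ρ) :
    2 * finrank F ↥(K ⊓ K.orthogonalBilin A) ≤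
      2 * finrank F ↥((K ⊓ K.orthogonalBilin A) ⊓ (K ⊓ K.orthogonalBilin A).orthogonalBilin B)
        + ρ := by
  set N := K ⊓ K.orthogonalBilin A with hN
  set P := K ⊓ K.orthogonalBilin B with hP
  set Q := K ⊓ K.orthogonalBilin (A + B) with hQ
  set M := K ⊓ N.orthogonalBilin B with hM
  have hNK : N ≤ K := inf_le_left
  have hML : M ⊓ N = N ⊓ N.orthogonalBilin B := by
    rw [hM]
    ext x
    simp only [Submodule.mem_inf]
    exact ⟨fun h => ⟨h.2, h.1.2⟩, fun h => ⟨⟨hNK h.1, h.2⟩, h.1⟩⟩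
  have hMN : M ⊔ N ≤ K := sup_le inf_le_left hNK
  have hPQM : P ⊔ Q ≤ M := by
    refine sup_le ?_ ?_
    · intro x hx
      exact ⟨hx.1, fun n hn => hx.2 n (hNK hn)⟩
    · intro x hx
      refine ⟨hx.1, fun n hn => ?_⟩
      have h := hx.2 n (hNK hn)
      have h' := hn.2 x hx.1
      simp only [LinearMap.add_apply] at h h' ⊢
      rw [hA, h', zero_add] at h
      exact h
  have hPQL : P ⊓ Q ≤ N ⊓ N.orthogonalBilin B := by
    rintro x ⟨hx, hx'⟩
    refine ⟨⟨hx.1, fun n hn => ?_⟩, fun n hn => hx.2 n (hNK hn)⟩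
    have h := hx.2 n hn
    have h' := hx'.2 n hn
    simp only [LinearMap.add_apply] at h h' ⊢
    rwa [h, add_zero] at h'
  have e1 := Submodule.finrank_sup_add_finrank_inf_eq P Q
  have e2 := Submodule.finrank_sup_add_finrank_inf_eq M N
  have l1 := Submodule.finrank_mono hPQM
  have l2 := Submodule.finrank_mono hPQL
  have l3 := Submodule.finrank_mono hMN
  rw [hML] at e2
  omega

/-- A linear family of symmetric forms all of rank at most `R` on `K` vanishes on a common subspace
of codimension at most `2 * R` in `K`. -/
theorem exists_isotropic_submodule {F V : Type} [Field F] [AddCommGroup V] [Module F V]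
    [FiniteDimensional F V] (T : V →ₗ[F] V →ₗ[F] V →ₗ[F] F)
    (hT : ∀ v x y, T v x y = T v y x) (H : Submodule F V) (R : ℕ) :
    ∀ K : Submodule F V,
      (∀ v ∈ H, finrank F K ≤ finrank F ↥(K ⊓ K.orthogonalBilin (T v)) + R) →
      ∃ K' ≤ K, finrank F K ≤ finrank F K' + 2 * R ∧
        ∀ v ∈ H, ∀ x ∈ K', ∀ y ∈ K', T v x y = 0 := by
  induction R using Nat.strong_induction_on with
  | _ R ih =>
  intro K hK
  classical
  have hex : ∃ ρ, ∀ v ∈ H, finrank F K ≤ finrank F ↥(K ⊓ K.orthogonalBilin (T v)) + ρ := ⟨R, hK⟩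
  obtain ⟨ρ, hρ, hmin⟩ : ∃ ρ, (∀ v ∈ H,
      finrank F K ≤ finrank F ↥(K ⊓ K.orthogonalBilin (T v)) + ρ) ∧ ∀ m < ρ, ¬ ∀ v ∈ H,
      finrank F K ≤ finrank F ↥(K ⊓ K.orthogonalBilin (T v)) + m :=
    ⟨Nat.find hex, Nat.find_spec hex, fun m hm => Nat.find_min hex hm⟩
  have hρR : ρ ≤ R := by
    by_contra! h
    exact hmin R h hK
  rcases Nat.eq_zero_or_pos ρ with h0 | h0
  · refine ⟨K, le_rfl, by omega, fun v hv x hx y hy => ?_⟩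
    have h : K ⊓ K.orthogonalBilin (T v) = K :=
      Submodule.eq_of_le_of_finrank_le inf_le_left (by simpa [h0] using hρ v hv)
    rw [← h] at hy
    exact hy.2 x hx
  · have := hmin (ρ - 1) (by omega)
    push Not at this
    obtain ⟨v, hv, hlt⟩ := this
    have hle := hρ v hv
    obtain ⟨K', hK', hfin, hzero⟩ := ih (ρ / 2) (by omega) (K ⊓ K.orthogonalBilin (T v)) (by
      intro w hw
      have := two_mul_finrank_orthogonal_le (T v) (T w) (hT v) K ρ (by omega) (hρ w hw)
        (by rw [← map_add]; exact hρ _ (H.add_mem hv hw))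
      omega)
    exact ⟨K', hK'.trans inf_le_left, by omega, hzero⟩

/-- A scalar-invariant set `{φ ≤ r}` of density at least `p⁻ᵗ`, with `φ` subadditive, generates a
subspace of codimension at most `t` on which `φ` is still controlled. -/
theorem exists_submodule_of_dense {F V : Type} [Field F] [Fintype F] [AddCommGroup V] [Module F V]
    [Finite V] (φ : V → ℕ) (h0 : φ 0 = 0) (hadd : ∀ x y, φ (x + y) ≤ φ x + φ y)
    (hsmul : ∀ (c : F) x, φ (c • x) ≤ φ x) (r t : ℕ)
    (hX : Nat.card F ^ finrank F V ≤ Nat.card F ^ t * Nat.card {x // φ x ≤ r}) :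
    ∃ H : Submodule F V, finrank F V ≤ finrank F H + t ∧ ∀ v ∈ H, φ v ≤ (2 + 3 * t) * r := by
  have hF : 1 < Nat.card F := Finite.one_lt_card
  have hneg : ∀ x, φ (-x) ≤ φ x := fun x => by simpa using hsmul (-1) x
  let S : Set (Submodule F V) := {Y | (∀ y ∈ Y, φ y ≤ 3 * finrank F Y * r) ∧
    ∀ x x', φ x ≤ r → φ x' ≤ r → x - x' ∈ Y → x = x'}
  have hS : S.Nonempty := by
    refine ⟨⊥, ?_, ?_⟩
    · intro y hy
      rw [Submodule.mem_bot] at hy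
      simp [hy, h0]
    · intro x x' _ _ h
      rw [Submodule.mem_bot] at h
      exact sub_eq_zero.mp h
  obtain ⟨Y, ⟨hY1, hY2⟩, hYmax⟩ := (Set.toFinite S).exists_maximal hS
  have hYt : finrank F Y ≤ t := by
    have hinj : Function.Injective (fun x : {x // φ x ≤ r} => Y.mkQ x.1) := by
      intro x x' h
      refine Subtype.ext (hY2 _ _ x.2 x'.2 ?_)
      simpa [Submodule.Quotient.eq] using h
    have : Finite (V ⧸ Y) := Module.finite_of_finite F
    have h1 := Nat.card_le_card_of_injective _ hinj
    rw [Module.natCard_eq_pow_finrank (K := F) (V := V ⧸ Y)] at h1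
    have h2 := hX.trans (Nat.mul_le_mul_left _ h1)
    rw [← pow_add, Nat.pow_le_pow_iff_right hF] at h2
    have := Submodule.finrank_quotient_add_finrank Y
    omega
  have hclosed : ∀ x₁ x₂ x₃, φ x₁ ≤ r → φ x₂ ≤ r → φ x₃ ≤ r →
      ∃ z₁ z₂, φ z₁ ≤ r ∧ φ z₂ ≤ r ∧ x₁ + x₂ + x₃ - (z₁ + z₂) ∈ Y := by
    intro x₁ x₂ x₃ hx₁ hx₂ hx₃
    by_contra! hcon
    set v := x₁ + x₂ + x₃ with hv
    have hφv : φ v ≤ 3 * r := by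
      have h₁ := hadd (x₁ + x₂) x₃
      have h₂ := hadd x₁ x₂
      rw [← hv] at h₁
      omega
    have hvY : v ∉ Y := fun h => hcon 0 0 (by simp [h0]) (by simp [h0]) (by simpa using h)
    have hlt : Y < Y ⊔ Submodule.span F {v} := by
      refine lt_of_le_of_ne le_sup_left fun h => hvY ?_
      rw [h]
      exact Submodule.mem_sup_right (Submodule.mem_span_singleton_self v)
    have hmem : Y ⊔ Submodule.span F {v} ∈ S := by
      have hfr := Submodule.finrank_lt_finrank_of_lt hlt
      refine ⟨fun y hy => ?_, fun x x' hx hx' h => ?_⟩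
      · obtain ⟨y, hyY, z, hz, rfl⟩ := Submodule.mem_sup.mp hy
        obtain ⟨c, rfl⟩ := Submodule.mem_span_singleton.mp hz
        calc φ (y + c • v) ≤ φ y + φ (c • v) := hadd _ _
          _ ≤ 3 * finrank F Y * r + 3 * r := add_le_add (hY1 y hyY) ((hsmul c v).trans hφv)
          _ = 3 * (finrank F Y + 1) * r := by ring
          _ ≤ _ := by gcongr; exact hfr
      · obtain ⟨y, hy, z, hz, hyz⟩ := Submodule.mem_sup.mp h
        obtain ⟨c, rfl⟩ := Submodule.mem_span_singleton.mp hz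
        by_cases hc : c = 0
        · refine hY2 x x' hx hx' ?_
          rw [← hyz, hc]
          simpa using hy
        · refine absurd ?_ (hcon (c⁻¹ • x) (-(c⁻¹ • x')) ((hsmul _ _).trans hx)
            ((hneg _).trans ((hsmul _ _).trans hx')))
          have : v - (c⁻¹ • x + -(c⁻¹ • x')) = -(c⁻¹ • y) := by
            rw [← sub_eq_add_neg, ← smul_sub, ← hyz, smul_add, smul_smul, inv_mul_cancel₀ hc]
            simp
          rw [this]
          exact Y.neg_mem (Y.smul_mem _ hy)
    exact absurd (hYmax hmem hlt.le) (not_le_of_gt hlt)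
  let H : Submodule F V :=
    { carrier := {v | ∃ z₁ z₂, φ z₁ ≤ r ∧ φ z₂ ≤ r ∧ v - (z₁ + z₂) ∈ Y}
      zero_mem' := ⟨0, 0, by simp [h0], by simp [h0], by simp⟩
      add_mem' := by
        rintro a b ⟨a₁, a₂, ha₁, ha₂, ha⟩ ⟨b₁, b₂, hb₁, hb₂, hb⟩
        obtain ⟨c₁, c₂, hc₁, hc₂, hc⟩ := hclosed a₁ a₂ b₁ ha₁ ha₂ hb₁
        obtain ⟨d₁, d₂, hd₁, hd₂, hd⟩ := hclosed c₁ c₂ b₂ hc₁ hc₂ hb₂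
        refine ⟨d₁, d₂, hd₁, hd₂, ?_⟩
        have := Y.add_mem (Y.add_mem ha hb) (Y.add_mem hc hd)
        convert this using 1
        abel
      smul_mem' := by
        rintro c a ⟨a₁, a₂, ha₁, ha₂, ha⟩
        refine ⟨c • a₁, c • a₂, (hsmul _ _).trans ha₁, (hsmul _ _).trans ha₂, ?_⟩
        rw [← smul_add, ← smul_sub]
        exact Y.smul_mem _ ha }
  refine ⟨H, ?_, ?_⟩
  · have hinj : Function.Injective (fun x : {x // φ x ≤ r} =>
        (⟨x.1, x.1, 0, x.2, by simp [h0], by simp⟩ : H)) := by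
      intro x x' h
      exact Subtype.ext (congrArg (fun z : H => (z : V)) h)
    have h1 := Nat.card_le_card_of_injective _ hinj
    rw [Module.natCard_eq_pow_finrank (K := F) (V := H)] at h1
    have h2 := hX.trans (Nat.mul_le_mul_left _ h1)
    rw [← pow_add, Nat.pow_le_pow_iff_right hF] at h2
    omega
  · rintro v ⟨z₁, z₂, h₁, h₂, hv⟩
    have e : v = (z₁ + z₂) + (v - (z₁ + z₂)) := by abel
    have l1 := hadd (z₁ + z₂) (v - (z₁ + z₂))
    have l2 := hadd z₁ z₂
    have l3 := hY1 _ hv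
    have l4 : 3 * finrank F Y * r ≤ 3 * t * r := by gcongr
    rw [← e] at l1
    calc φ v ≤ r + r + 3 * t * r := by omega
      _ = _ := by ring

theorem sum_stdAddChar_eq_zero {p : ℕ} [Fact p.Prime] {V : Type} [AddCommGroup V] [Fintype V]
    (g : V → ZMod p) (h : V) (c : ZMod p) (hc : c ≠ 0) (hg : ∀ x, g (x + h) = g x + c) :
    ∑ x, ZMod.stdAddChar (g x) = 0 := by
  have h1 : ∑ x, ZMod.stdAddChar (g x) = (∑ x, ZMod.stdAddChar (g x)) * ZMod.stdAddChar c := by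
    rw [Finset.sum_mul]
    conv_lhs => rw [← Equiv.sum_comp (Equiv.addRight h)]
    simp [hg, AddChar.map_add_eq_mul]
  have h2 : (ZMod.stdAddChar c : ℂ) ≠ 1 := fun h =>
    hc (ZMod.injective_stdAddChar (by rw [h, AddChar.map_zero_eq_one]))
  have h3 : (∑ x, ZMod.stdAddChar (g x)) * ((ZMod.stdAddChar c : ℂ) - 1) = 0 := by
    linear_combination -h1
  exact (mul_eq_zero.mp h3).resolve_right (sub_ne_zero.mpr h2)

theorem norm_sum_stdAddChar_le {p : ℕ} [Fact p.Prime] {V : Type} [Fintype V] (g : V → ZMod p) :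
    ‖∑ x, ZMod.stdAddChar (g x)‖ ≤ Fintype.card V := by
  refine (norm_sum_le _ _).trans ?_
  simp [AddChar.norm_apply]

theorem norm_sum_stdAddChar_sq_le {p : ℕ} [Fact p.Prime] {V : Type} [AddCommGroup V] [Fintype V]
    (f : V → ZMod p) :
    ‖∑ x, ZMod.stdAddChar (f x)‖ ^ 2 ≤ ∑ h, ‖∑ x, ZMod.stdAddChar (fwdDiff h f x)‖ := by
  have key : (starRingEnd ℂ) (∑ x, ZMod.stdAddChar (f x)) * ∑ x, ZMod.stdAddChar (f x) =
      ∑ h, ∑ x, ZMod.stdAddChar (fwdDiff h f x) := by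
    rw [Finset.sum_comm, map_sum, Finset.sum_mul]
    refine Finset.sum_congr rfl fun x _ => ?_
    rw [← Equiv.sum_comp (Equiv.addLeft x), Finset.mul_sum]
    refine Finset.sum_congr rfl fun y _ => ?_
    simp only [fwdDiff, Equiv.coe_addLeft, sub_eq_add_neg, AddChar.map_add_eq_mul,
      AddChar.map_neg_eq_conj]
    ring
  calc _ = ‖(starRingEnd ℂ) (∑ x, ZMod.stdAddChar (f x)) * ∑ x, ZMod.stdAddChar (f x)‖ := by
        rw [norm_mul, RCLike.norm_conj, sq]
    _ ≤ _ := by rw [key]; exact norm_sum_le _ _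

theorem norm_sum_stdAddChar_sq_le_of_quadratic {p : ℕ} [Fact p.Prime] {V : Type} [AddCommGroup V]
    [Module (ZMod p) V] [Fintype V] (q : V → ZMod p)
    (B : V →ₗ[ZMod p] V →ₗ[ZMod p] ZMod p) (hB : ∀ a b x, fwdDiff a (fwdDiff b q) x = B a b) :
    ‖∑ x, ZMod.stdAddChar (q x)‖ ^ 2 ≤ Nat.card (LinearMap.ker B) * Fintype.card V := by
  classical
  refine (norm_sum_stdAddChar_sq_le q).trans ?_
  have hterm : ∀ h, ‖∑ x, ZMod.stdAddChar (fwdDiff h q x)‖ ≤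
      if h ∈ LinearMap.ker B then (Fintype.card V : ℝ) else 0 := by
    intro h
    split_ifs with hh
    · exact norm_sum_stdAddChar_le _
    · obtain ⟨k, hk⟩ : ∃ k, B h k ≠ 0 := by
        by_contra! hcon
        exact hh (LinearMap.mem_ker.mpr (LinearMap.ext hcon))
      have hsymm : B k h = B h k := by rw [← hB k h 0, ← hB h k 0, fwdDiff_swap]
      rw [sum_stdAddChar_eq_zero (fwdDiff h q) k (B h k) hk, norm_zero]
      intro x
      rw [← hsymm, ← hB k h x]
      simp only [fwdDiff]
      ring
  refine (Finset.sum_le_sum fun h _ => hterm h).trans ?_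
  rw [← Finset.sum_filter, Finset.sum_const, nsmul_eq_mul, Nat.card_eq_fintype_card,
    Fintype.card_subtype]

theorem exists_coset_norm_sum_le {p : ℕ} [Fact p.Prime] {V : Type} [AddCommGroup V]
    [Module (ZMod p) V] [Fintype V] (f : V → ZMod p) (K : Submodule (ZMod p) V) [Fintype K] :
    ∃ v : V, ‖∑ x, ZMod.stdAddChar (f x)‖ * Fintype.card K ≤
      Fintype.card V * ‖∑ k : K, ZMod.stdAddChar (f (v + k))‖ := by
  by_contra! hcon
  have h1 : ∑ v, ∑ k : K, ZMod.stdAddChar (f (v + k)) =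
      (∑ x, ZMod.stdAddChar (f x)) * Fintype.card K := by
    rw [Finset.sum_comm]
    have : ∀ k : K, ∑ v, (ZMod.stdAddChar (f (v + k)) : ℂ) = ∑ x, ZMod.stdAddChar (f x) :=
      fun k => Equiv.sum_comp (Equiv.addRight (k : V)) fun x => ZMod.stdAddChar (f x)
    simp [this, mul_comm]
  have h2 : ‖∑ x, ZMod.stdAddChar (f x)‖ * Fintype.card K ≤
      ∑ v, ‖∑ k : K, ZMod.stdAddChar (f (v + k))‖ := by
    have h3 := norm_sum_le Finset.univ fun v => ∑ k : K, (ZMod.stdAddChar (f (v + k)) : ℂ)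
    rw [h1, norm_mul, Complex.norm_natCast] at h3
    exact h3
  have h3 : ∑ v : V, (Fintype.card V : ℝ) * ‖∑ k : K, ZMod.stdAddChar (f (v + k))‖ <
      ∑ v : V, ‖∑ x, ZMod.stdAddChar (f x)‖ * Fintype.card K :=
    Finset.sum_lt_sum_of_nonempty ⟨0, Finset.mem_univ _⟩ fun v _ => hcon v
  rw [← Finset.mul_sum, Finset.sum_const, nsmul_eq_mul, Finset.card_univ] at h3
  have h4 : (0 : ℝ) < Fintype.card V := by exact_mod_cast Fintype.card_pos
  exact absurd h2 (not_le_of_gt (lt_of_mul_lt_mul_left h3 h4.le))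

theorem exists_constant_of_quadratic {p : ℕ} [Fact p.Prime] {V : Type} [AddCommGroup V]
    [Module (ZMod p) V] [Fintype V] (q : V → ZMod p) (s : ℕ)
    (hq : ∀ a b c x, fwdDiff a (fwdDiff b (fwdDiff c q)) x = 0)
    (hS : (Fintype.card V : ℝ) ≤ p ^ s * ‖∑ x, ZMod.stdAddChar (q x)‖) :
    ∃ (u : V) (W : Submodule (ZMod p) V), finrank (ZMod p) V ≤ finrank (ZMod p) W + 2 * s ∧
      ∀ w ∈ W, q (u + w) = q u := by
  classical
  obtain ⟨B, hB⟩ := exists_bilinear_fwdDiff q hq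
  have hV : (0 : ℝ) < Fintype.card V := by exact_mod_cast Fintype.card_pos
  obtain ⟨u, hu⟩ := exists_coset_norm_sum_le q (LinearMap.ker B)
  refine ⟨u, LinearMap.ker B, ?_, ?_⟩
  · have h1 := norm_sum_stdAddChar_sq_le_of_quadratic q B hB
    have h2 : (Fintype.card V : ℝ) ^ 2 ≤
        p ^ (2 * s) * (Nat.card (LinearMap.ker B) * Fintype.card V) :=
      calc _ ≤ (p ^ s * ‖∑ x, ZMod.stdAddChar (q x)‖) ^ 2 := by gcongr
        _ = p ^ (2 * s) * ‖∑ x, ZMod.stdAddChar (q x)‖ ^ 2 := by ring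
        _ ≤ _ := by gcongr
    have h3 : (Fintype.card V : ℝ) ≤ p ^ (2 * s) * Nat.card (LinearMap.ker B) := by
      refine le_of_mul_le_mul_right ?_ hV
      linarith
    have h4 : Nat.card V ≤ p ^ (2 * s) * Nat.card (LinearMap.ker B) := by
      rw [← Nat.card_eq_fintype_card] at h3
      exact_mod_cast h3
    rw [Module.natCard_eq_pow_finrank (K := ZMod p) (V := V),
      Module.natCard_eq_pow_finrank (K := ZMod p) (V := LinearMap.ker B), Nat.card_zmod, ← pow_add,
      Nat.pow_le_pow_iff_right (Fact.out : p.Prime).one_lt] at h4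
    omega
  · by_contra! hcon
    obtain ⟨w, hw, hne⟩ := hcon
    have hzero : ∑ k : LinearMap.ker B, (ZMod.stdAddChar (q (u + k)) : ℂ) = 0 := by
      refine sum_stdAddChar_eq_zero (fun k : LinearMap.ker B => q (u + k)) ⟨w, hw⟩
        (q (u + w) - q u) (sub_ne_zero.mpr hne) fun x => ?_
      have h := hB x w u
      rw [LinearMap.mem_ker.mp x.2, LinearMap.zero_apply] at h
      simp only [fwdDiff] at h
      simp only [Submodule.coe_add, ← add_assoc]
      linear_combination h
    rw [hzero, norm_zero, mul_zero] at hu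
    have hK : (0 : ℝ) < Fintype.card (LinearMap.ker B) := by exact_mod_cast Fintype.card_pos
    have hpos : 0 < ‖∑ x, ZMod.stdAddChar (q x)‖ := by
      refine (norm_nonneg _).lt_of_ne fun h => ?_
      rw [← h, mul_zero] at hS
      linarith
    have := mul_pos hpos hK
    linarith

/-- A function of degree at most three whose exponential sum has density at least `p⁻ˢ` is constant
on an affine subspace of codimension `O(s²)`. -/
theorem exists_constant_of_cubic {p : ℕ} [Fact p.Prime] {V : Type} [AddCommGroup V]
    [Module (ZMod p) V] [Fintype V] (f : V → ZMod p) (s t : ℕ) (ht : t = 2 * s + 1)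
    (hf : ∀ a b c d x, fwdDiff a (fwdDiff b (fwdDiff c (fwdDiff d f))) x = 0)
    (hS : (Fintype.card V : ℝ) ≤ p ^ s * ‖∑ x, ZMod.stdAddChar (f x)‖) :
    ∃ (u : V) (W : Submodule (ZMod p) V),
      finrank (ZMod p) V ≤ finrank (ZMod p) W + (t + 2 * ((2 + 3 * t) * (2 * t)) + 2 * s) ∧
      ∀ w ∈ W, f (u + w) = f u := by
  classical
  have hp : p.Prime := Fact.out
  have hp1 : (2 : ℝ) ≤ p := by exact_mod_cast hp.two_le
  obtain ⟨T, hT⟩ := exists_trilinear_fwdDiff f hf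
  have hTsymm : ∀ v x y, T v x y = T v y x := fun v x y => by
    rw [← hT x y v 0, ← hT y x v 0, fwdDiff_swap]
  have hV : (0 : ℝ) < Fintype.card V := by exact_mod_cast Fintype.card_pos
  have hcard : ∀ K : Submodule (ZMod p) V, Nat.card K = p ^ finrank (ZMod p) K := fun K => by
    rw [Module.natCard_eq_pow_finrank (K := ZMod p) (V := K), Nat.card_zmod]
  have hcardV : Fintype.card V = p ^ finrank (ZMod p) V := by
    rw [Module.card_eq_pow_finrank (K := ZMod p) (V := V), ZMod.card]
  set φ : V → ℕ := fun v => finrank (ZMod p) V - finrank (ZMod p) (LinearMap.ker (T v)) with hφ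
  have hker : ∀ v, finrank (ZMod p) (LinearMap.ker (T v)) + φ v = finrank (ZMod p) V := fun v =>
    Nat.add_sub_cancel' (Submodule.finrank_le _)
  have hφ0 : φ 0 = 0 := by
    simp only [hφ]
    rw [map_zero, LinearMap.ker_zero, finrank_top, Nat.sub_self]
  have hφadd : ∀ x y, φ (x + y) ≤ φ x + φ y := by
    intro x y
    have h1 := Submodule.finrank_sup_add_finrank_inf_eq (LinearMap.ker (T x)) (LinearMap.ker (T y))
    have h2 := Submodule.finrank_le (LinearMap.ker (T x) ⊔ LinearMap.ker (T y))
    have h3 : LinearMap.ker (T x) ⊓ LinearMap.ker (T y) ≤ LinearMap.ker (T (x + y)) := by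
      rintro z ⟨hz, hz'⟩
      have e1 : T x z = 0 := hz
      have e2 : T y z = 0 := hz'
      simp [e1, e2]
    have h4 := Submodule.finrank_mono h3
    have := hker x
    have := hker y
    have := hker (x + y)
    omega
  have hφsmul : ∀ (c : ZMod p) x, φ (c • x) ≤ φ x := by
    intro c x
    have h3 : LinearMap.ker (T x) ≤ LinearMap.ker (T (c • x)) := by
      intro z hz
      have e1 : T x z = 0 := hz
      simp [e1]
    have h4 := Submodule.finrank_mono h3
    have := hker x
    have := hker (c • x)
    omega
  have hterm : ∀ h, ‖∑ x, ZMod.stdAddChar (fwdDiff h f x)‖ ≤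
      (if φ h ≤ 2 * t then (Fintype.card V : ℝ) else 0) + Fintype.card V / p ^ t := by
    intro h
    split_ifs with hh
    · exact (norm_sum_stdAddChar_le _).trans (le_add_of_nonneg_right (by positivity))
    · rw [zero_add, le_div_iff₀ (by positivity)]
      refine (pow_le_pow_iff_left₀ (by positivity) hV.le two_ne_zero).mp ?_
      have h1 := norm_sum_stdAddChar_sq_le_of_quadratic (fwdDiff h f) (T h)
        fun a b x => hT a b h x
      have h2 : (Nat.card (LinearMap.ker (T h)) : ℝ) * p ^ (2 * t) ≤ Fintype.card V := by
        rw [hcard, hcardV]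
        have h3 : finrank (ZMod p) (LinearMap.ker (T h)) + 2 * t ≤ finrank (ZMod p) V := by
          have := hker h
          omega
        push_cast
        rw [← pow_add]
        exact pow_le_pow_right₀ (by linarith) h3
      calc (‖∑ x, ZMod.stdAddChar (fwdDiff h f x)‖ * (p : ℝ) ^ t) ^ (2 : ℕ)
          = ‖∑ x, ZMod.stdAddChar (fwdDiff h f x)‖ ^ 2 * (p : ℝ) ^ (2 * t) := by ring
        _ ≤ (Nat.card (LinearMap.ker (T h)) : ℝ) * Fintype.card V * p ^ (2 * t) := by gcongr
        _ = (Nat.card (LinearMap.ker (T h)) : ℝ) * p ^ (2 * t) * Fintype.card V := by ring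
        _ ≤ (Fintype.card V : ℝ) * Fintype.card V := by gcongr
        _ = _ := by ring
  have hdense : Nat.card (ZMod p) ^ finrank (ZMod p) V ≤
      Nat.card (ZMod p) ^ t * Nat.card {x // φ x ≤ 2 * t} := by
    rw [Nat.card_zmod, ← hcardV]
    have h1 := (norm_sum_stdAddChar_sq_le f).trans (Finset.sum_le_sum fun h _ => hterm h)
    rw [Finset.sum_add_distrib, ← Finset.sum_filter, Finset.sum_const, nsmul_eq_mul,
      Finset.sum_const, nsmul_eq_mul, ← Fintype.card_subtype, ← Nat.card_eq_fintype_card,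
      Finset.card_univ] at h1
    have h2 : (Fintype.card V : ℝ) ^ 2 ≤ p ^ (2 * s) * ‖∑ x, ZMod.stdAddChar (f x)‖ ^ 2 :=
      calc _ ≤ (p ^ s * ‖∑ x, ZMod.stdAddChar (f x)‖) ^ 2 := by gcongr
        _ = _ := by ring
    have hpt : (p : ℝ) ^ t = p * p ^ (2 * s) := by rw [ht]; ring
    have h3 : (p : ℝ) * Fintype.card V ^ 2 ≤
        p ^ t * (Nat.card {x // φ x ≤ 2 * t} * Fintype.card V) + Fintype.card V ^ 2 :=
      calc (p : ℝ) * Fintype.card V ^ 2 ≤ p * (p ^ (2 * s) *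
            (Nat.card {x // φ x ≤ 2 * t} * Fintype.card V +
              Fintype.card V * (Fintype.card V / p ^ t))) := by
            gcongr
            exact h2.trans (by gcongr)
        _ = p ^ t * (Nat.card {x // φ x ≤ 2 * t} * Fintype.card V +
              Fintype.card V * (Fintype.card V / p ^ t)) := by rw [hpt]; ring
        _ = _ := by field_simp
    have h4 : (Fintype.card V : ℝ) ≤ p ^ t * Nat.card {x // φ x ≤ 2 * t} := by
      refine le_of_mul_le_mul_right ?_ hV
      nlinarith [mul_pos hV hV]
    exact_mod_cast h4
  obtain ⟨H, hHfin, hH⟩ := exists_submodule_of_dense φ hφ0 hφadd hφsmul (2 * t) t hdense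
  set R := (2 + 3 * t) * (2 * t) with hR
  obtain ⟨K, hKH, hKfin, hK⟩ := exists_isotropic_submodule T hTsymm H R H (by
    intro v hv
    have h1 := Submodule.finrank_sup_add_finrank_inf_eq H (LinearMap.ker (T v))
    have h2 := Submodule.finrank_le (H ⊔ LinearMap.ker (T v))
    have h3 : H ⊓ LinearMap.ker (T v) ≤ H ⊓ H.orthogonalBilin (T v) := by
      rintro z ⟨hz, hz'⟩
      refine ⟨hz, fun n _ => ?_⟩
      have e1 : T v z = 0 := hz'
      rw [hTsymm, e1, LinearMap.zero_apply]
    have h4 := Submodule.finrank_mono h3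
    have := hker v
    have := hH v hv
    omega)
  obtain ⟨v, hv⟩ := exists_coset_norm_sum_le f K
  obtain ⟨u, W, hW, hconst⟩ := exists_constant_of_quadratic (fun k : K => f (v + k)) s (by
    intro a b c x
    have h := hT a b c (v + x)
    rw [hK c (hKH c.2) a a.2 b b.2] at h
    simp only [fwdDiff, Submodule.coe_add, ← add_assoc] at h ⊢
    exact h) (by
    have hKpos : (0 : ℝ) < Fintype.card K := by exact_mod_cast Fintype.card_pos
    refine le_of_mul_le_mul_left ?_ hV
    calc (Fintype.card V : ℝ) * Fintype.card K
        ≤ p ^ s * ‖∑ x, ZMod.stdAddChar (f x)‖ * Fintype.card K := by gcongr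
      _ = p ^ s * (‖∑ x, ZMod.stdAddChar (f x)‖ * Fintype.card K) := by ring
      _ ≤ p ^ s * (Fintype.card V * ‖∑ k : K, ZMod.stdAddChar (f (v + k))‖) := by gcongr
      _ = _ := by ring)
  refine ⟨v + u, W.map K.subtype, ?_, ?_⟩
  · rw [Submodule.finrank_map_subtype_eq]
    omega
  · rintro _ ⟨w, hw, rfl⟩
    have := hconst w hw
    simpa [add_assoc] using this

theorem fwdDiff_four_prod_eq_zero {R ι V : Type} [CommRing R] [AddCommGroup V] [Module R V]
    (m : Multiset ι) (hm : m.card ≤ 3) (a : ι → R) (l : ι → V →ₗ[R] R) (h₁ h₂ h₃ h₄ x : V) :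
    fwdDiff h₁ (fwdDiff h₂ (fwdDiff h₃ (fwdDiff h₄
      fun x => (m.map fun i => a i + l i x).prod))) x = 0 := by
  have hcases : m.card = 0 ∨ m.card = 1 ∨ m.card = 2 ∨ m.card = 3 := by omega
  rcases hcases with h | h | h | h
  · rw [Multiset.card_eq_zero] at h
    subst h
    simp [fwdDiff]
  · obtain ⟨i, rfl⟩ := Multiset.card_eq_one.mp h
    simp only [fwdDiff, Multiset.map_singleton, Multiset.prod_singleton, map_add]
    ring
  · obtain ⟨i, j, rfl⟩ := Multiset.card_eq_two.mp h
    simp only [fwdDiff, Multiset.insert_eq_cons, Multiset.map_cons, Multiset.prod_cons,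
      Multiset.map_singleton, Multiset.prod_singleton, map_add]
    ring
  · obtain ⟨i, j, k, rfl⟩ := Multiset.card_eq_three.mp h
    simp only [fwdDiff, Multiset.insert_eq_cons, Multiset.map_cons, Multiset.prod_cons,
      Multiset.map_singleton, Multiset.prod_singleton, map_add]
    ring

theorem fwdDiff_four_eval_eq_zero {R : Type} [CommRing R] {n : ℕ} (f : MvPolynomial (Fin n) R)
    (hf : f.totalDegree ≤ 3) (u₀ : Fin n → R) (U : Submodule R (Fin n → R)) (h₁ h₂ h₃ h₄ x : U) :
    fwdDiff h₁ (fwdDiff h₂ (fwdDiff h₃ (fwdDiff h₄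
      fun x : U => eval (u₀ + (x : Fin n → R)) f))) x = 0 := by
  have hfun : (fun x : U => eval (u₀ + (x : Fin n → R)) f) =
      ∑ d ∈ f.support, f.coeff d • fun x : U => ((Finsupp.toMultiset d).map fun i =>
        u₀ i + ((LinearMap.proj i).comp U.subtype : U →ₗ[R] R) x).prod := by
    funext x
    rw [MvPolynomial.eval_eq, Finset.sum_apply]
    refine Finset.sum_congr rfl fun d _ => ?_
    simp only [Pi.smul_apply, smul_eq_mul]
    congr 1
    rw [Finsupp.toMultiset_map, Finsupp.prod_toMultiset,
      Finsupp.prod_mapDomain_index (by simp) (by intros; rw [pow_add])]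
    rfl
  rw [hfun]
  simp only [fwdDiff_finsetSum, fwdDiff_const_smul, Finset.sum_apply, Pi.smul_apply]
  refine Finset.sum_eq_zero fun d hd => ?_
  rw [fwdDiff_four_prod_eq_zero, smul_zero]
  rw [Finsupp.card_toMultiset]
  exact (MvPolynomial.le_totalDegree hd).trans hf

theorem totalDegree_aeval_le_of_le_one {R : Type} [CommRing R] {n m : ℕ}
    (f : MvPolynomial (Fin n) R) (g : Fin n → MvPolynomial (Fin m) R)
    (hg : ∀ i, (g i).totalDegree ≤ 1) :
    (MvPolynomial.aeval g f).totalDegree ≤ f.totalDegree := by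
  rw [MvPolynomial.aeval_def, MvPolynomial.eval₂_eq]
  refine MvPolynomial.totalDegree_finsetSum_le fun d hd => ?_
  refine (MvPolynomial.totalDegree_mul _ _).trans ?_
  rw [MvPolynomial.algebraMap_eq, MvPolynomial.totalDegree_C, zero_add]
  refine (MvPolynomial.totalDegree_finsetProd _ _).trans ?_
  refine le_trans ?_ (MvPolynomial.le_totalDegree hd)
  refine Finset.sum_le_sum fun i _ => ?_
  refine (MvPolynomial.totalDegree_pow _ _).trans ?_
  simpa using Nat.mul_le_mul_left (d i) (hg i)

theorem card_filter_eval_eq_le {p : ℕ} [Fact p.Prime] {n : ℕ}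
    (f : MvPolynomial (Fin n) (ZMod p)) (hf : f.totalDegree ≤ 3) (u₀ : Fin n → ZMod p)
    (U : Submodule (ZMod p) (Fin n → ZMod p)) [Fintype U]
    (hne : ∃ u v : U, eval (u₀ + (u : Fin n → ZMod p)) f ≠
      eval (u₀ + (v : Fin n → ZMod p)) f) (y : ZMod p) :
    (Finset.univ.filter fun u : U => eval (u₀ + (u : Fin n → ZMod p)) f = y).card * p ≤
      3 * Fintype.card U := by
  classical
  set m := finrank (ZMod p) U with hm
  let b := Module.finBasis (ZMod p) U
  let g : Fin n → MvPolynomial (Fin m) (ZMod p) := fun i =>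
    MvPolynomial.C (u₀ i) + ∑ j, MvPolynomial.C ((b j : Fin n → ZMod p) i) * MvPolynomial.X j
  have hg : ∀ i, (g i).totalDegree ≤ 1 := by
    intro i
    refine (MvPolynomial.totalDegree_add _ _).trans (max_le (by simp) ?_)
    refine MvPolynomial.totalDegree_finsetSum_le fun j _ => ?_
    refine (MvPolynomial.totalDegree_mul _ _).trans ?_
    simp
  let e : U ≃ (Fin m → ZMod p) := b.equivFun.toEquiv
  set P := MvPolynomial.aeval g f - MvPolynomial.C y with hP
  have heval : ∀ u : U, MvPolynomial.eval (e u) P = eval (u₀ + (u : Fin n → ZMod p)) f - y := by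
    intro u
    have hcomp : (MvPolynomial.aeval (e u)).comp (MvPolynomial.aeval g) =
        (MvPolynomial.aeval (u₀ + (u : Fin n → ZMod p)) :
          MvPolynomial (Fin n) (ZMod p) →ₐ[ZMod p] ZMod p) := by
      refine MvPolynomial.algHom_ext fun i => ?_
      have h := congrArg (fun w : U => (w : Fin n → ZMod p) i) (b.sum_equivFun u)
      simp only [Submodule.coe_sum, Submodule.coe_smul, Finset.sum_apply, Pi.smul_apply,
        smul_eq_mul] at h
      simp only [AlgHom.comp_apply, MvPolynomial.aeval_X, g, map_add, map_sum, map_mul,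
        MvPolynomial.algHom_C, Pi.add_apply]
      rw [← h]
      simp [e, mul_comm]
    have h := DFunLike.congr_fun hcomp f
    simp only [AlgHom.comp_apply, MvPolynomial.aeval_eq_eval] at h
    rw [hP, map_sub, MvPolynomial.eval_C]
    exact congrArg (fun z => z - y) h
  have hP0 : P ≠ 0 := by
    intro h0
    obtain ⟨u, v, huv⟩ := hne
    have hu := heval u
    have hv := heval v
    rw [h0, map_zero] at hu hv
    exact huv (by linear_combination hv - hu)
  have hPdeg : P.totalDegree ≤ 3 := by
    refine (MvPolynomial.totalDegree_sub _ _).trans (max_le ?_ (by simp))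
    exact (totalDegree_aeval_le_of_le_one f g hg).trans hf
  have hSZ := MvPolynomial.schwartz_zippel_totalDegree hP0 Finset.univ
  have hcard : (Finset.univ.filter fun u : U => eval (u₀ + (u : Fin n → ZMod p)) f = y).card =
      (Finset.filter (fun z => MvPolynomial.eval z P = 0)
        (Fintype.piFinset fun _ : Fin m => (Finset.univ : Finset (ZMod p)))).card := by
    rw [Fintype.piFinset_univ]
    refine Finset.card_equiv e fun u => ?_
    simp [heval, sub_eq_zero]
  have hU : Fintype.card U = p ^ m := by
    rw [Module.card_eq_pow_finrank (K := ZMod p) (V := U), ZMod.card]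
  have hp : (0 : ℚ≥0) < p := by exact_mod_cast (Fact.out : p.Prime).pos
  rw [← hcard, Finset.card_univ, ZMod.card, div_le_div_iff₀ (by positivity) hp] at hSZ
  rw [hU]
  have h1 : (Finset.univ.filter fun u : U => eval (u₀ + (u : Fin n → ZMod p)) f = y).card * p ≤
      P.totalDegree * p ^ m := by exact_mod_cast hSZ
  exact h1.trans (Nat.mul_le_mul_right _ hPdeg)

theorem abs_card_filter_sub_le_of_fibers {V : Type} [Fintype V] [Nonempty V] {p : ℕ}
    [Fact p.Prime] (g : V → ZMod p)
    (hg : ∀ y, (Finset.univ.filter fun x => g x = y).card * p ≤ 3 * Fintype.card V)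
    (A : Finset (ZMod p)) :
    |((Finset.univ.filter fun x => g x ∈ A).card : ℝ) / Fintype.card V - A.card / p| ≤ 3 / 4 := by
  have hp : (0 : ℝ) < p := by exact_mod_cast (Fact.out : p.Prime).pos
  have hV : (0 : ℝ) < Fintype.card V := by exact_mod_cast Fintype.card_pos
  have key : ∀ A : Finset (ZMod p),
      ((Finset.univ.filter fun x => g x ∈ A).card : ℝ) / Fintype.card V - A.card / p ≤ 3 / 4 := by
    intro A
    have h1 : (Finset.univ.filter fun x => g x ∈ A).card * p ≤ A.card * (3 * Fintype.card V) := by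
      rw [Finset.card_eq_sum_card_fiberwise (f := g) (t := A) (by intro x hx; simpa using hx),
        Finset.sum_mul, ← smul_eq_mul (A.card)]
      refine Finset.sum_le_card_nsmul _ _ _ fun y hy => ?_
      refine le_trans (Nat.mul_le_mul_right _ (Finset.card_le_card ?_)) (hg y)
      intro x
      simp
    have h2 : (Finset.univ.filter fun x => g x ∈ A).card ≤ Fintype.card V :=
      Finset.card_le_univ _
    have h1' : ((Finset.univ.filter fun x => g x ∈ A).card : ℝ) / Fintype.card V ≤
        3 * (A.card / p) := by
      rw [div_le_iff₀ hV, mul_div_assoc', div_mul_eq_mul_div, le_div_iff₀ hp]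
      have : ((Finset.univ.filter fun x => g x ∈ A).card : ℝ) * p ≤
        A.card * (3 * Fintype.card V) := by exact_mod_cast h1
      linarith
    have h2' : ((Finset.univ.filter fun x => g x ∈ A).card : ℝ) / Fintype.card V ≤ 1 := by
      rw [div_le_one hV]
      exact_mod_cast h2
    linarith
  rw [abs_le]
  refine ⟨?_, key A⟩
  have h := key Aᶜ
  have h1 : ((Finset.univ.filter fun x => g x ∈ Aᶜ).card : ℝ) =
      Fintype.card V - (Finset.univ.filter fun x => g x ∈ A).card := by
    have := Finset.card_filter_add_card_filter_not (s := (Finset.univ : Finset V)) (fun x => g x ∈ A)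
    rw [Finset.card_univ] at this
    simp only [Finset.mem_compl]
    rw [← this]
    push_cast
    ring
  have h2 : ((Aᶜ).card : ℝ) = p - A.card := by
    rw [Finset.card_compl, ZMod.card, Nat.cast_sub]
    simpa using Finset.card_le_univ A
  rw [h1, h2, sub_div, sub_div, div_self hV.ne', div_self hp.ne'] at h
  linarith

theorem exists_large_stdAddChar_sum {V : Type} [Fintype V] [Nonempty V] {p : ℕ} [Fact p.Prime]
    (g : V → ZMod p) (δ : ℝ) (A : Finset (ZMod p))
    (hA : δ < |((Finset.univ.filter fun x => g x ∈ A).card : ℝ) / Fintype.card V - A.card / p|) :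
    ∃ c : ZMod p, c ≠ 0 ∧ δ * Fintype.card V ≤ p * ‖∑ x, ZMod.stdAddChar (c * g x)‖ := by
  by_contra! hcon
  have hp : (0 : ℝ) < p := by exact_mod_cast (Fact.out : p.Prime).pos
  have hV : (0 : ℝ) < Fintype.card V := by exact_mod_cast Fintype.card_pos
  have hind : ∀ y : ZMod p, (p : ℂ) * (if y ∈ A then 1 else 0) =
      ∑ c : ZMod p, ∑ a ∈ A, ZMod.stdAddChar (c * (y - a)) := by
    intro y
    rw [Finset.sum_comm]
    simp_rw [AddChar.sum_mulShift _ (ZMod.isPrimitive_stdAddChar p), sub_eq_zero, ZMod.card]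
    simp
  have hexp : (p : ℂ) * (Finset.univ.filter fun x => g x ∈ A).card =
      ∑ c : ZMod p, ∑ a ∈ A, ZMod.stdAddChar (-(c * a)) * ∑ x, ZMod.stdAddChar (c * g x) := by
    rw [Finset.natCast_card_filter, Finset.mul_sum]
    simp_rw [hind]
    rw [Finset.sum_comm]
    refine Finset.sum_congr rfl fun c _ => ?_
    rw [Finset.sum_comm]
    refine Finset.sum_congr rfl fun a _ => ?_
    rw [Finset.mul_sum]
    refine Finset.sum_congr rfl fun x _ => ?_
    rw [← AddChar.map_add_eq_mul]
    congr 1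
    ring
  rw [← Finset.add_sum_erase _ _ (Finset.mem_univ (0 : ZMod p))] at hexp
  have hzero : ∑ a ∈ A, (ZMod.stdAddChar (-((0 : ZMod p) * a)) : ℂ) *
      ∑ x, ZMod.stdAddChar ((0 : ZMod p) * g x) = A.card * Fintype.card V := by
    simp
  rw [hzero] at hexp
  have hbound : ‖∑ c ∈ Finset.univ.erase (0 : ZMod p), ∑ a ∈ A,
      (ZMod.stdAddChar (-(c * a)) : ℂ) * ∑ x, ZMod.stdAddChar (c * g x)‖ ≤
      p * (δ * Fintype.card V) := by
    refine (norm_sum_le _ _).trans ?_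
    have hc : ∀ c ∈ Finset.univ.erase (0 : ZMod p), ‖∑ a ∈ A,
        (ZMod.stdAddChar (-(c * a)) : ℂ) * ∑ x, ZMod.stdAddChar (c * g x)‖ ≤
        δ * Fintype.card V := by
      intro c hc
      refine (norm_sum_le _ _).trans ?_
      have h1 := hcon c (Finset.ne_of_mem_erase hc)
      simp only [norm_mul, AddChar.norm_apply, one_mul, Finset.sum_const, nsmul_eq_mul]
      refine le_trans ?_ h1.le
      gcongr
      simpa using Finset.card_le_univ A
    refine (Finset.sum_le_card_nsmul _ _ _ hc).trans ?_
    rw [nsmul_eq_mul]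
    have hnn : 0 ≤ δ * Fintype.card V := by
      have := hcon 1 one_ne_zero
      exact le_trans (by positivity) this.le
    gcongr
    have := Finset.card_le_univ (Finset.univ.erase (0 : ZMod p))
    rwa [ZMod.card] at this
  have heq : ((p : ℝ) * (Finset.univ.filter fun x => g x ∈ A).card - A.card * Fintype.card V : ℂ) =
      ∑ c ∈ Finset.univ.erase (0 : ZMod p), ∑ a ∈ A,
      (ZMod.stdAddChar (-(c * a)) : ℂ) * ∑ x, ZMod.stdAddChar (c * g x) := by
    push_cast
    linear_combination hexp
  rw [← heq] at hbound
  have hnorm : ‖((p : ℝ) * (Finset.univ.filter fun x => g x ∈ A).card -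
      A.card * Fintype.card V : ℂ)‖ =
      p * Fintype.card V *
        |((Finset.univ.filter fun x => g x ∈ A).card : ℝ) / Fintype.card V - A.card / p| := by
    rw [show ((p : ℝ) * (Finset.univ.filter fun x => g x ∈ A).card -
      A.card * Fintype.card V : ℂ) = (((p : ℝ) * (Finset.univ.filter fun x => g x ∈ A).card -
      A.card * Fintype.card V : ℝ) : ℂ) by push_cast; rfl, Complex.norm_real, Real.norm_eq_abs]
    conv_rhs => rw [← abs_of_pos (mul_pos hp hV), ← abs_mul]
    congr 1
    field_simp
  rw [hnorm] at hbound
  have := mul_lt_mul_of_pos_left hA (mul_pos hp hV)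
  linarith

theorem exists_submodule_finrank_eq {F V : Type} [Field F] [AddCommGroup V] [Module F V]
    [FiniteDimensional F V] (W : Submodule F V) (k : ℕ) (hk : k ≤ finrank F W) :
    ∃ W' ≤ W, finrank F W' = k := by
  let b := Module.finBasis F W
  let c : Fin k → V := fun i => b (Fin.castLE hk i)
  have hc : LinearIndependent F c :=
    (b.linearIndependent.map' W.subtype W.ker_subtype).comp _ (Fin.castLE_injective hk)
  refine ⟨Submodule.span F (Set.range c), ?_, ?_⟩
  · rw [Submodule.span_le]
    rintro _ ⟨i, rfl⟩
    exact (b (Fin.castLE hk i)).2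
  · rw [finrank_span_eq_card hc, Fintype.card_fin]

theorem card_filter_cosetFinset {F : Type} [Field F] [Fintype F] {n : ℕ} (u₀ : Fin n → F)
    (U : Submodule F (Fin n → F)) [Fintype U] (P : (Fin n → F) → Prop)
    [DecidablePred P] :
    ((cosetFinset u₀ U).filter P).card =
      (Finset.univ.filter fun u : U => P (u₀ + (u : Fin n → F))).card := by
  symm
  refine Finset.card_nbij (fun u : U => u₀ + (u : Fin n → F)) ?_ ?_ ?_
  · intro u hu
    simpa [cosetFinset] using hu
  · intro u _ v _ h
    exact Subtype.ext (add_left_cancel h)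
  · intro x hx
    simp only [cosetFinset, Finset.coe_filter, Set.Finite.mem_toFinset, Set.mem_ofPred_eq] at hx
    obtain ⟨⟨u, hu, rfl⟩, hP⟩ := hx
    exact ⟨⟨u, hu⟩, by simpa using hP, rfl⟩

theorem closeToUniform_cosetFinset {p : ℕ} [Fact p.Prime] {n : ℕ} (f : (Fin n → ZMod p) → ZMod p)
    (u₀ : Fin n → ZMod p) (U : Submodule (ZMod p) (Fin n → ZMod p)) [Fintype U] (δ : ℝ)
    (h : ∀ A : Finset (ZMod p), |((Finset.univ.filter fun u : U =>
      f (u₀ + (u : Fin n → ZMod p)) ∈ A).card : ℝ) /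
      Fintype.card U - A.card / p| ≤ δ) : CloseToUniform f (cosetFinset u₀ U) δ := by
  intro A
  have h1 : (cosetFinset u₀ U).card = Fintype.card U := by
    have := card_filter_cosetFinset u₀ U fun _ => True
    simpa using this
  have h2 := h A
  rw [← card_filter_cosetFinset u₀ U fun x => f x ∈ A, ← h1] at h2
  rw [ZMod.card]
  convert h2

theorem stmt_15 : ∃ C : ℝ, 0 < C ∧
    ∀ (p : ℕ) [Fact p.Prime], ∀ (δ : ℝ), δ ∈ Set.Ioo (0 : ℝ) 1 →
    ∀ (n k : ℕ) (f : MvPolynomial (Fin n) (ZMod p)),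
      f.totalDegree ≤ 3 →
      AffineDisperser (fun x => eval x f) k →
      AffineExtractor (fun x => eval x f) (k + ⌈C * (Real.log (1 / δ)) ^ 2⌉₊) δ := by
  refine ⟨18500, by norm_num, ?_⟩
  rintro p hp δ ⟨hδ0, hδ1⟩ n k f hf hdisp u₀ U hU
  have : Fintype U := Fintype.ofFinite U
  refine closeToUniform_cosetFinset _ u₀ U δ fun A => ?_
  by_cases hδ : 3 / 4 ≤ δ
  · refine le_trans (abs_card_filter_sub_le_of_fibers
      (fun u : U => eval (u₀ + (u : Fin n → ZMod p)) f) ?_ A) hδ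
    obtain ⟨W, hWU, hW⟩ := exists_submodule_finrank_eq U k (by omega)
    obtain ⟨u, hu, v, hv, huv⟩ := hdisp u₀ W hW
    exact card_filter_eval_eq_le f hf u₀ U ⟨⟨u, hWU hu⟩, ⟨v, hWU hv⟩, huv⟩
  · by_contra! hcon
    push Not at hδ
    obtain ⟨c, hc, hS⟩ := exists_large_stdAddChar_sum
      (fun u : U => eval (u₀ + (u : Fin n → ZMod p)) f) δ A hcon
    set L := Real.log (1 / δ) with hL
    have hL1 : 1 / 4 ≤ L := by
      have h1 := Real.one_sub_inv_le_log_of_pos (x := 1 / δ) (by positivity)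
      rw [one_div, inv_inv, ← one_div, ← hL] at h1
      linarith
    set s := 1 + ⌈2 * L⌉₊ with hs
    have hsL : (s : ℝ) ≤ 10 * L := by
      have := Nat.ceil_lt_add_one (a := 2 * L) (by linarith)
      rw [hs]
      push_cast
      linarith
    have hp2 : (2 : ℝ) ≤ p := by exact_mod_cast hp.out.two_le
    have hpow : 1 / δ ≤ (p : ℝ) ^ ⌈2 * L⌉₊ := by
      rw [← Real.exp_log (show 0 < 1 / δ by positivity), ← hL]
      refine le_trans ?_ (pow_le_pow_left₀ (by norm_num) hp2 _)
      rw [← Real.exp_log (show (0 : ℝ) < 2 by norm_num), ← Real.exp_nat_mul]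
      refine Real.exp_le_exp.mpr ?_
      rw [Real.exp_log (by norm_num)]
      have h1 := Nat.le_ceil (2 * L)
      have h2 := Real.log_two_gt_d9
      nlinarith
    obtain ⟨u, W, hW, hconst⟩ := exists_constant_of_cubic
      (fun x : U => c * eval (u₀ + (x : Fin n → ZMod p)) f) s (2 * s + 1) rfl (by
        intro h₁ h₂ h₃ h₄ x
        have h := fwdDiff_four_eval_eq_zero f hf u₀ U h₁ h₂ h₃ h₄ x
        simp only [fwdDiff] at h ⊢
        linear_combination c * h) (by
        have h1 : 1 ≤ δ * (p : ℝ) ^ ⌈2 * L⌉₊ := by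
          rw [div_le_iff₀ hδ0] at hpow
          linarith
        calc (Fintype.card U : ℝ) ≤ δ * (p : ℝ) ^ ⌈2 * L⌉₊ * Fintype.card U :=
              le_mul_of_one_le_left (by positivity) h1
          _ = (p : ℝ) ^ ⌈2 * L⌉₊ * (δ * Fintype.card U) := by ring
          _ ≤ (p : ℝ) ^ ⌈2 * L⌉₊ *
              (p * ‖∑ x : U, ZMod.stdAddChar (c * eval (u₀ + (x : Fin n → ZMod p)) f)‖) := by gcongr
          _ = _ := by rw [hs]; ring)
    have hcodim : 2 * s + 1 + 2 * ((2 + 3 * (2 * s + 1)) * (2 * (2 * s + 1))) + 2 * s ≤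
        ⌈18500 * L ^ 2⌉₊ := by
      have h1 : (1 : ℝ) ≤ s := by rw [hs]; push_cast; linarith [Nat.cast_nonneg (α := ℝ) ⌈2 * L⌉₊]
      have h2 : ((2 * s + 1 + 2 * ((2 + 3 * (2 * s + 1)) * (2 * (2 * s + 1))) + 2 * s : ℕ) : ℝ) ≤
          18500 * L ^ 2 := by
        push_cast
        nlinarith
      exact_mod_cast h2.trans (Nat.le_ceil _)
    obtain ⟨W', hW', hfin⟩ := exists_submodule_finrank_eq W k (by omega)
    obtain ⟨v, hv, w, hw, hvw⟩ := hdisp (u₀ + u) (W'.map U.subtype)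
      (by rw [Submodule.finrank_map_subtype_eq, hfin])
    have hall : ∀ v ∈ W'.map U.subtype, eval (u₀ + (u : Fin n → ZMod p) + v) f =
        eval (u₀ + (u : Fin n → ZMod p)) f := by
      rintro _ ⟨v, hv, rfl⟩
      have := mul_left_cancel₀ hc (hconst v (hW' hv))
      simpa [add_assoc] using this
    exact hvw ((hall v hv).trans (hall w hw).symm)
end

section
/- There exist constants C > 0 and c > 0 such that the following holds for every prime p and every δ ∈ (0,1). Let f : F_p^n → F_p be a polynomial of total degree at most 4 that is an affine disperser for dimension k. Then f is an affine extractor for dimension ⌈k · C · δ^{-c}⌉ with bias δ. -/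
open MvPolynomial
open scoped Classical

/-- Take precedence over the module structure induced on additive subgroups. -/
instance (priority := high) submoduleZModModule {n : ℕ} {M : Type*} [AddCommGroup M]
    [Module (ZMod n) M] (N : Submodule (ZMod n) M) : Module (ZMod n) N :=
  N.module

section Conic

open Module Finset

variable {p : ℕ} [Fact p.Prime] {V : Type*} [AddCommGroup V] [Module (ZMod p) V]

lemma card_le_of_avoiding [Fintype V] (K : Finset V) (h0 : (0 : V) ∈ K)
    (hK : ∀ (c : ZMod p), ∀ v ∈ K, c • v ∈ K) (ρ : ℕ)
    (h : ∀ Z : Submodule (ZMod p) V, (∀ z ∈ Z, z ∈ K → z = 0) → finrank (ZMod p) Z ≤ ρ) :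
    Fintype.card V ≤ p ^ ρ * #K := by
  obtain ⟨Z, hZ⟩ := (Set.toFinite {Z : Submodule (ZMod p) V | ∀ z ∈ Z, z ∈ K → z = 0}).exists_maximal
    ⟨⊥, by intro z hz _; simpa using hz⟩
  have hsurj : ∀ v : V, ∃ q : Z × K, (q.1 : V) + q.2 = v := by
    intro v
    by_cases hv : v ∈ Z
    · exact ⟨(⟨v, hv⟩, ⟨0, h0⟩), by simp⟩
    · have hlt : ¬ (Z ⊔ Submodule.span (ZMod p) {v}) ∈
          {Z : Submodule (ZMod p) V | ∀ z ∈ Z, z ∈ K → z = 0} := by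
        intro hmem
        exact hv (hZ.2 hmem le_sup_left
          (Submodule.mem_sup_right (Submodule.mem_span_singleton_self v)))
      simp only [Set.mem_ofPred_eq, not_forall] at hlt
      obtain ⟨w, hw, hwK, hw0⟩ := hlt
      obtain ⟨z, hz, y, hy, rfl⟩ := Submodule.mem_sup.1 hw
      obtain ⟨c, rfl⟩ := Submodule.mem_span_singleton.1 hy
      have hc : c ≠ 0 := by
        rintro rfl
        simp only [zero_smul, add_zero] at hwK hw0
        exact hw0 (hZ.1 z hz hwK)
      refine ⟨(⟨-(c⁻¹ • z), Z.neg_mem (Z.smul_mem _ hz)⟩, ⟨c⁻¹ • (z + c • v), hK _ _ hwK⟩), ?_⟩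
      simp [smul_add, smul_smul, inv_mul_cancel₀ hc]
  have h1 := Fintype.card_le_of_surjective (fun q : Z × K => (q.1 : V) + q.2) hsurj
  rw [Fintype.card_prod, Fintype.card_coe] at h1
  refine h1.trans (Nat.mul_le_mul_right _ ?_)
  rw [Module.card_eq_pow_finrank (K := ZMod p), ZMod.card]
  exact Nat.pow_le_pow_right (Fact.out : p.Prime).pos (h Z hZ.1)

lemma finrank_le_of_card_le [Fintype V] (H : Submodule (ZMod p) V) (s : ℕ)
    (h : Fintype.card V ≤ p ^ s * Fintype.card H) :
    finrank (ZMod p) V ≤ s + finrank (ZMod p) H := by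
  rw [Module.card_eq_pow_finrank (K := ZMod p), Module.card_eq_pow_finrank (K := ZMod p) (V := H),
    ZMod.card, ← pow_add] at h
  exact (Nat.pow_le_pow_iff_right (Fact.out : p.Prime).one_lt).1 h

/-- The number of pairs in `X` whose difference lies in `H`. -/
noncomputable def pairCount (X : Finset V) (H : Submodule (ZMod p) V) : ℕ :=
  ∑ x ∈ X, ∑ y ∈ X, if x - y ∈ H then 1 else 0

/-- The Fourier transform of the function counting representations as a difference of
elements of `X`, restricted to `H`. -/
noncomputable def diffSum (X : Finset V) (H : Submodule (ZMod p) V) (ξ : Dual (ZMod p) V) : ℂ :=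
  ∑ x ∈ X, ∑ y ∈ X, if x - y ∈ H then ZMod.stdAddChar (ξ (x - y)) else 0

lemma sum_dual_stdAddChar [Finite V] [Fintype (Dual (ZMod p) V)] (v : V) :
    ∑ ξ : Dual (ZMod p) V, ZMod.stdAddChar (ξ v) =
      if v = 0 then (Fintype.card (Dual (ZMod p) V) : ℂ) else 0 := by
  split_ifs with hv
  · simp [hv]
  · let ψ : AddChar (Dual (ZMod p) V) ℂ :=
      ZMod.stdAddChar.compAddMonoidHom (LinearMap.applyₗ v).toAddMonoidHom
    have hψ : ψ ≠ 1 := by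
      obtain ⟨ξ, hξ⟩ := not_forall.1 (fun h => hv ((forall_dual_apply_eq_zero_iff (ZMod p) v).1 h))
      intro h1
      apply hξ
      have : ψ ξ = 1 := by rw [h1]; rfl
      apply ZMod.injective_stdAddChar
      rw [AddChar.map_zero_eq_one]
      exact this
    exact AddChar.sum_eq_zero_of_ne_one hψ

lemma diffSum_zero (X : Finset V) (H : Submodule (ZMod p) V) :
    diffSum X H 0 = pairCount X H := by
  simp [diffSum, pairCount]

lemma sum_smul_diffSum (X : Finset V) (H : Submodule (ZMod p) V) (ξ : Dual (ZMod p) V) :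
    ∑ c : ZMod p, diffSum X H (c • ξ) = p * pairCount X (H ⊓ LinearMap.ker ξ) := by
  simp only [diffSum, pairCount]
  push_cast
  rw [Finset.sum_comm, Finset.mul_sum]
  refine Finset.sum_congr rfl fun x _ => ?_
  rw [Finset.sum_comm, Finset.mul_sum]
  refine Finset.sum_congr rfl fun y _ => ?_
  by_cases h : x - y ∈ H
  · simp only [h, if_true, LinearMap.smul_apply, smul_eq_mul, Submodule.mem_inf, true_and,
      LinearMap.mem_ker]
    rw [AddChar.sum_mulShift _ (ZMod.isPrimitive_stdAddChar p), ZMod.card]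
    split_ifs <;> simp
  · simp [h]

lemma diffSum_smul (X : Finset V) (hX : ∀ (c : ZMod p), ∀ v ∈ X, c • v ∈ X)
    (H : Submodule (ZMod p) V) (ξ : Dual (ZMod p) V) {c : ZMod p} (hc : c ≠ 0) :
    diffSum X H (c • ξ) = diffSum X H ξ := by
  have key : ∀ f : V → ℂ, ∑ x ∈ X, f (c • x) = ∑ x ∈ X, f x := by
    intro f
    refine Finset.sum_bij' (fun x _ => c • x) (fun x _ => c⁻¹ • x) (fun x hx => hX _ _ hx)
      (fun x hx => hX _ _ hx) ?_ ?_ ?_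
    · intro x _; simp [smul_smul, inv_mul_cancel₀ hc]
    · intro x _; simp [smul_smul, mul_inv_cancel₀ hc]
    · intro x _; rfl
  unfold diffSum
  symm
  rw [← key]
  refine Finset.sum_congr rfl fun x _ => ?_
  rw [← key]
  refine Finset.sum_congr rfl fun y _ => ?_
  rw [← smul_sub, H.smul_mem_iff hc]
  simp

lemma diffSum_eq_normSq [Fintype V] (X : Finset V) (H : Submodule (ZMod p) V)
    (ξ : Dual (ZMod p) V) :
    diffSum X H ξ = ((∑ C : V ⧸ H, Complex.normSq
      (∑ x ∈ X, if H.mkQ x = C then ZMod.stdAddChar (ξ x) else 0) : ℝ) : ℂ) := by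
  push_cast
  simp only [Complex.normSq_eq_conj_mul_self, map_sum, Finset.sum_mul_sum]
  rw [Finset.sum_comm, diffSum, Finset.sum_comm]
  refine Finset.sum_congr rfl fun x _ => ?_
  rw [Finset.sum_comm]
  refine Finset.sum_congr rfl fun y _ => ?_
  have : ∀ C : V ⧸ H, (starRingEnd ℂ) (if H.mkQ x = C then ZMod.stdAddChar (ξ x) else 0) *
      (if H.mkQ y = C then ZMod.stdAddChar (ξ y) else 0) =
      if H.mkQ x = C then (if y - x ∈ H then ZMod.stdAddChar (ξ (y - x)) else 0) else 0 := by
    intro C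
    by_cases hx : H.mkQ x = C
    · subst hx
      have : H.mkQ y = H.mkQ x ↔ y - x ∈ H := by
        simp [Submodule.Quotient.eq]
      simp only [if_true, this]
      split_ifs with h
      · rw [← AddChar.map_neg_eq_conj, ← AddChar.map_add_eq_mul, map_sub]
        congr 1; ring
      · simp
    · rw [if_neg hx, if_neg hx, map_zero, zero_mul]
  rw [Finset.sum_congr rfl fun C _ => this C, Finset.sum_ite_eq]
  simp

lemma diffSum_real [Fintype V] (X : Finset V) (hX : ∀ (c : ZMod p), ∀ v ∈ X, c • v ∈ X)
    (H : Submodule (ZMod p) V) (ξ : Dual (ZMod p) V) :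
    ∃ r : ℝ, diffSum X H ξ = r ∧ 0 ≤ r ∧ r ≤ pairCount X (H ⊓ LinearMap.ker ξ) := by
  refine ⟨_, diffSum_eq_normSq X H ξ, Finset.sum_nonneg fun _ _ => Complex.normSq_nonneg _, ?_⟩
  set r := (∑ C : V ⧸ H, Complex.normSq
      (∑ x ∈ X, if H.mkQ x = C then ZMod.stdAddChar (ξ x) else 0) : ℝ) with hr
  have hrd : diffSum X H ξ = r := diffSum_eq_normSq X H ξ
  have h1 := sum_smul_diffSum X H ξ
  have h0 : ∀ c : ZMod p, diffSum X H (c • ξ) =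
      (r : ℂ) + if c = 0 then (pairCount X H : ℂ) - r else 0 := by
    intro c
    split_ifs with hc
    · rw [hc, zero_smul, diffSum_zero]; ring
    · rw [diffSum_smul X hX H ξ hc, hrd, add_zero]
  simp only [h0, Finset.sum_add_distrib, Finset.sum_const, Finset.card_univ, ZMod.card,
    Finset.sum_ite_eq', Finset.mem_univ, if_true, nsmul_eq_mul] at h1
  have hp : 1 < p := (Fact.out : p.Prime).one_lt
  have h2 : (p : ℝ) * r + (pairCount X H - r) = p * pairCount X (H ⊓ LinearMap.ker ξ) := by
    exact_mod_cast h1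
  have h3 : (pairCount X (H ⊓ LinearMap.ker ξ) : ℝ) ≤ pairCount X H := by
    have : pairCount X (H ⊓ LinearMap.ker ξ) ≤ pairCount X H := by
      unfold pairCount
      refine Finset.sum_le_sum fun x _ => Finset.sum_le_sum fun y _ => ?_
      by_cases h : x - y ∈ H <;> simp [h]
      split_ifs <;> simp
    exact_mod_cast this
  have h4 : (1 : ℝ) < p := by exact_mod_cast hp
  nlinarith

lemma sum_diffSum [Finite V] [Fintype (Dual (ZMod p) V)] (X : Finset V)
    (H : Submodule (ZMod p) V) :
    ∑ ξ : Dual (ZMod p) V, diffSum X H ξ = Fintype.card (Dual (ZMod p) V) * #X := by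
  unfold diffSum
  rw [Finset.sum_comm]
  have : ∀ x ∈ X, ∑ ξ : Dual (ZMod p) V, ∑ y ∈ X,
      (if x - y ∈ H then ZMod.stdAddChar (ξ (x - y)) else 0) =
      (Fintype.card (Dual (ZMod p) V) : ℂ) := by
    intro x hx
    rw [Finset.sum_comm]
    have : ∀ y ∈ X, ∑ ξ : Dual (ZMod p) V,
        (if x - y ∈ H then ZMod.stdAddChar (ξ (x - y)) else 0) =
        if x = y then (Fintype.card (Dual (ZMod p) V) : ℂ) else 0 := by
      intro y _
      by_cases h : x - y ∈ H
      · simp only [h, if_true, sum_dual_stdAddChar, sub_eq_zero]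
      · have : x ≠ y := by rintro rfl; simp at h
        simp [h, this]
    rw [Finset.sum_congr rfl this]
    simp [hx]
  rw [Finset.sum_congr rfl this]
  simp [mul_comm]

end Conic

section ConicSums

open Module Finset

variable {p : ℕ} [Fact p.Prime] {V : Type*} [AddCommGroup V] [Module (ZMod p) V]

lemma stdAddChar_sum {ι : Type*} (t : Finset ι) (g : ι → ZMod p) :
    ZMod.stdAddChar (∑ i ∈ t, g i) = ∏ i ∈ t, ZMod.stdAddChar (g i) := by
  induction t using Finset.induction_on with
  | empty => simp
  | insert a t ha ih =>
    rw [Finset.sum_insert ha, Finset.prod_insert ha, AddChar.map_add_eq_mul, ih]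

lemma card_dual [Fintype V] [Fintype (Dual (ZMod p) V)] :
    Fintype.card (Dual (ZMod p) V) = Fintype.card V := by
  rw [Module.card_eq_pow_finrank (K := ZMod p), Module.card_eq_pow_finrank (K := ZMod p) (V := V),
    Subspace.dual_finrank_eq]

lemma pairCount_le [Fintype V] (X : Finset V) (H : Submodule (ZMod p) V) :
    pairCount X H ≤ #X * Fintype.card H := by
  unfold pairCount
  refine Finset.sum_le_card_nsmul _ _ _ fun x _ => ?_
  rw [← Finset.card_filter, ← Finset.card_univ]
  refine Finset.card_le_card_of_injOn (fun y => if h : x - y ∈ H then ⟨x - y, h⟩ else 0)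
    (fun _ _ => Finset.mem_coe.2 (Finset.mem_univ _)) ?_
  intro y hy z hz hyz
  simp only [Finset.coe_filter, Set.mem_ofPred_eq] at hy hz
  simpa [hy.2, hz.2] using hyz

lemma card_inf_ker [Fintype V] (H : Submodule (ZMod p) V) (ξ : Dual (ZMod p) V)
    (h : ¬ H ≤ LinearMap.ker ξ) :
    p * Fintype.card (H ⊓ LinearMap.ker ξ : Submodule (ZMod p) V) = Fintype.card H := by
  have h1 : finrank (ZMod p) (H ⊓ LinearMap.ker ξ : Submodule (ZMod p) V) + 1 =
      finrank (ZMod p) H := by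
    have hne : ξ ∘ₗ H.subtype ≠ 0 := by
      intro h0
      apply h
      intro x hx
      exact LinearMap.congr_fun h0 ⟨x, hx⟩
    have h2 := Module.Dual.finrank_ker_add_one_of_ne_zero hne
    rw [LinearMap.ker_comp, ← Submodule.finrank_map_subtype_eq, Submodule.map_comap_subtype] at h2
    exact h2
  rw [Module.card_eq_pow_finrank (K := ZMod p), Module.card_eq_pow_finrank (K := ZMod p) (V := H),
    ZMod.card, ← h1]
  ring

lemma exists_maximal_pairCount [Fintype V] (X : Finset V) :
    ∃ H : Submodule (ZMod p) V, ∀ H' : Submodule (ZMod p) V,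
      pairCount X H' ^ 2 * Fintype.card H ≤ pairCount X H ^ 2 * Fintype.card H' := by
  obtain ⟨H, hH⟩ := Finite.exists_max
    (fun H : Submodule (ZMod p) V => ((pairCount X H : ℚ) ^ 2 / Fintype.card H))
  refine ⟨H, fun H' => ?_⟩
  have := hH H'
  rw [div_le_div_iff₀ (by exact_mod_cast Fintype.card_pos) (by exact_mod_cast Fintype.card_pos)]
    at this
  exact_mod_cast this

lemma sum_diffSum_pow_eq_zero [Finite V] [Fintype (Dual (ZMod p) V)] (X : Finset V)
    (H : Submodule (ZMod p) V) (m : ℕ) (v : V)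
    (h : ∀ x y : Fin m → V, (∀ i, x i ∈ X) → (∀ i, y i ∈ X) → ∑ i, (x i - y i) ≠ v) :
    ∑ ξ : Dual (ZMod p) V, diffSum X H ξ ^ m * ZMod.stdAddChar (-(ξ v)) = 0 := by
  have h1 : ∀ ξ : Dual (ZMod p) V, diffSum X H ξ ^ m * ZMod.stdAddChar (-(ξ v)) =
      ∑ q ∈ Fintype.piFinset (fun _ : Fin m => (X ×ˢ X).filter fun q => q.1 - q.2 ∈ H),
        ZMod.stdAddChar (ξ (∑ i, ((q i).1 - (q i).2) - v)) := by
    intro ξ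
    have : diffSum X H ξ = ∑ q ∈ (X ×ˢ X).filter (fun q => q.1 - q.2 ∈ H),
        ZMod.stdAddChar (ξ (q.1 - q.2)) := by
      rw [Finset.sum_filter, Finset.sum_product]
      rfl
    rw [this]
    have h2 := Finset.prod_univ_sum
      (fun _ : Fin m => (X ×ˢ X).filter (fun q => q.1 - q.2 ∈ H))
      (fun _ q => ZMod.stdAddChar (ξ (q.1 - q.2)))
    rw [Finset.prod_const, Finset.card_univ, Fintype.card_fin] at h2
    rw [h2, Finset.sum_mul]
    refine Finset.sum_congr rfl fun q _ => ?_
    rw [map_sub, sub_eq_add_neg, AddChar.map_add_eq_mul, map_sum, stdAddChar_sum]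
  rw [Finset.sum_congr rfl fun ξ _ => h1 ξ, Finset.sum_comm]
  refine Finset.sum_eq_zero fun q hq => ?_
  rw [sum_dual_stdAddChar, if_neg]
  rw [Fintype.mem_piFinset] at hq
  rw [sub_eq_zero]
  exact h (fun i => (q i).1) (fun i => (q i).2)
    (fun i => (Finset.mem_product.1 (Finset.mem_filter.1 (hq i)).1).1)
    (fun i => (Finset.mem_product.1 (Finset.mem_filter.1 (hq i)).1).2)

lemma pow_mul_pairCount_le [Fintype V] (X : Finset V)
    (hX : ∀ (c : ZMod p), ∀ v ∈ X, c • v ∈ X) (H : Submodule (ZMod p) V)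
    (hH : ∀ H' : Submodule (ZMod p) V,
      pairCount X H' ^ 2 * Fintype.card H ≤ pairCount X H ^ 2 * Fintype.card H')
    (hG : 0 < pairCount X H) (l : ℕ) (v : V) (hv : v ∈ H)
    (h : ∀ x y : Fin (2 * l + 1) → V, (∀ i, x i ∈ X) → (∀ i, y i ∈ X) →
      ∑ i, (x i - y i) ≠ v) :
    p ^ l * pairCount X H ≤ Fintype.card V * #X := by
  have : Finite (Dual (ZMod p) V) := Module.finite_of_finite (ZMod p)
  let _ : Fintype (Dual (ZMod p) V) := Fintype.ofFinite _
  choose r hr hr0 hrG using diffSum_real X hX H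
  have hp : 0 < p := (Fact.out : p.Prime).pos
  have hpR : (0 : ℝ) < p := by exact_mod_cast hp
  set G : ℝ := (pairCount X H : ℝ) with hGdef
  have hGpos : 0 < G := by rw [hGdef]; exact_mod_cast hG
  have hsum : ∑ ξ, r ξ = Fintype.card V * #X := by
    have := sum_diffSum X H
    simp only [hr, card_dual] at this
    exact_mod_cast this
  have hsmall : ∀ ξ : Dual (ZMod p) V, ¬ H ≤ LinearMap.ker ξ → r ξ ^ 2 ≤ G ^ 2 / p := by
    intro ξ hξ
    have h1 := hH (H ⊓ LinearMap.ker ξ)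
    rw [← card_inf_ker H ξ hξ, ← mul_assoc] at h1
    have h2 := Nat.le_of_mul_le_mul_right h1 Fintype.card_pos
    have h3 : (pairCount X (H ⊓ LinearMap.ker ξ) : ℝ) ^ 2 * p ≤ G ^ 2 := by
      rw [hGdef]; exact_mod_cast h2
    rw [le_div_iff₀ hpR]
    have h4 : r ξ ^ 2 ≤ (pairCount X (H ⊓ LinearMap.ker ξ) : ℝ) ^ 2 :=
      pow_le_pow_left₀ (hr0 ξ) (hrG ξ) 2
    nlinarith
  have hre : ∑ ξ : Dual (ZMod p) V,
      r ξ ^ (2 * l + 1) * (ZMod.stdAddChar (-(ξ v)) : ℂ).re = 0 := by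
    have h1 := congrArg Complex.re (sum_diffSum_pow_eq_zero X H (2 * l + 1) v h)
    simp only [hr, Complex.re_sum, Complex.zero_re] at h1
    rw [← h1]
    refine Finset.sum_congr rfl fun ξ _ => ?_
    rw [← Complex.ofReal_pow, Complex.re_ofReal_mul]
  have hann : ∀ ξ : Dual (ZMod p) V, H ≤ LinearMap.ker ξ →
      (ZMod.stdAddChar (-(ξ v)) : ℂ).re = 1 := by
    intro ξ hξ
    have : ξ v = 0 := hξ hv
    simp [this]
  have hr_zero : r 0 = G := by
    have := hr 0
    rw [diffSum_zero] at this
    rw [hGdef]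
    exact_mod_cast this.symm
  have hterm : ∀ ξ : Dual (ZMod p) V, (if ξ = 0 then G ^ (2 * l + 1) else 0) -
      r ξ * (G ^ 2 / p) ^ l ≤ r ξ ^ (2 * l + 1) * (ZMod.stdAddChar (-(ξ v)) : ℂ).re := by
    intro ξ
    have hb : 0 ≤ r ξ * (G ^ 2 / p) ^ l := mul_nonneg (hr0 ξ) (by positivity)
    by_cases hξ : H ≤ LinearMap.ker ξ
    · rw [hann ξ hξ, mul_one]
      split_ifs with h0
      · rw [h0, hr_zero] at hb ⊢
        linarith
      · have := pow_nonneg (hr0 ξ) (2 * l + 1)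
        linarith
    · have h0 : ξ ≠ 0 := by rintro rfl; exact hξ (by simp)
      rw [if_neg h0]
      have h1 : r ξ ^ (2 * l + 1) ≤ r ξ * (G ^ 2 / p) ^ l := by
        rw [pow_succ, pow_mul, mul_comm]
        exact mul_le_mul_of_nonneg_left (pow_le_pow_left₀ (by positivity) (hsmall ξ hξ) l) (hr0 ξ)
      have h2 : -1 ≤ (ZMod.stdAddChar (-(ξ v)) : ℂ).re := by
        have := Complex.abs_re_le_norm (ZMod.stdAddChar (-(ξ v)) : ℂ)
        rw [AddChar.norm_apply] at this
        exact (abs_le.1 this).1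
      have h3 := pow_nonneg (hr0 ξ) (2 * l + 1)
      nlinarith
  have hfin := Finset.sum_le_sum fun ξ (_ : ξ ∈ Finset.univ) => hterm ξ
  rw [hre, Finset.sum_sub_distrib, ← Finset.sum_mul, hsum, Finset.sum_ite_eq' Finset.univ] at hfin
  simp only [Finset.mem_univ, if_true, div_pow] at hfin
  have h5 : G ^ (2 * l + 1) * (p : ℝ) ^ l ≤ Fintype.card V * #X * (G ^ 2) ^ l := by
    have h6 : G ^ (2 * l + 1) ≤ Fintype.card V * #X * (G ^ 2) ^ l / (p : ℝ) ^ l := by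
      rw [mul_div_assoc]; linarith
    rwa [le_div_iff₀ (by positivity)] at h6
  have h7 : (p : ℝ) ^ l * G ≤ Fintype.card V * #X := by
    rw [pow_succ, pow_mul] at h5
    have h8 : 0 < (G ^ 2) ^ l := by positivity
    refine le_of_mul_le_mul_right ?_ h8
    linarith
  rw [hGdef] at h7
  exact_mod_cast h7

/-- A dense scaling-invariant set has a bounded sumset containing a subspace of small
codimension, with bounds independent of the field. -/
theorem exists_subspace_subset_sum [Fintype V] (X : Finset V) (h0 : (0 : V) ∈ X)
    (hX : ∀ (c : ZMod p), ∀ v ∈ X, c • v ∈ X) (s : ℕ) (hs : Fintype.card V ≤ p ^ s * #X) :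
    ∃ H : Submodule (ZMod p) V, finrank (ZMod p) V ≤ 2 * s + finrank (ZMod p) H ∧
      ∀ v ∈ H, ∃ x : Fin (8 * s + 6) → V, (∀ i, x i ∈ X) ∧ v = ∑ i, x i := by
  have hp : 1 < p := (Fact.out : p.Prime).one_lt
  obtain ⟨H, hH⟩ := exists_maximal_pairCount (p := p) X
  have hXpos : 0 < #X := Finset.card_pos.2 ⟨0, h0⟩
  have hVpos : 0 < Fintype.card V := Fintype.card_pos
  have hHpos : 0 < Fintype.card H := Fintype.card_pos
  have htop : pairCount X (⊤ : Submodule (ZMod p) V) = #X * #X := by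
    simp [pairCount]
  have h1 := hH ⊤
  rw [htop, Fintype.card_congr (Equiv.subtypeUnivEquiv (fun x => Submodule.mem_top))] at h1
  have hG : 0 < pairCount X H := by
    rcases Nat.eq_zero_or_pos (pairCount X H) with h | h
    · rw [h] at h1
      have : 0 < (#X * #X) ^ 2 * Fintype.card H := by positivity
      omega
    · exact h
  have h2 := pairCount_le X H
  have h3 : #X ^ 2 ≤ Fintype.card H * Fintype.card V := by
    have h4 : (#X * #X) ^ 2 * Fintype.card H ≤ (#X * Fintype.card H) ^ 2 * Fintype.card V :=
      h1.trans (Nat.mul_le_mul_right _ (Nat.pow_le_pow_left h2 2))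
    have h5 : #X ^ 2 * (#X ^ 2 * Fintype.card H) ≤
        Fintype.card H * Fintype.card V * (#X ^ 2 * Fintype.card H) := by
      calc _ = (#X * #X) ^ 2 * Fintype.card H := by ring
        _ ≤ _ := h4
        _ = _ := by ring
    exact Nat.le_of_mul_le_mul_right h5 (by positivity)
  have hs2 : Fintype.card V ^ 2 ≤ p ^ (2 * s) * #X ^ 2 := by
    calc _ ≤ (p ^ s * #X) ^ 2 := Nat.pow_le_pow_left hs 2
      _ = _ := by ring
  have hcodim : Fintype.card V ≤ p ^ (2 * s) * Fintype.card H := by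
    have : Fintype.card V * Fintype.card V ≤ p ^ (2 * s) * Fintype.card H * Fintype.card V := by
      calc _ = Fintype.card V ^ 2 := by ring
        _ ≤ _ := hs2
        _ ≤ p ^ (2 * s) * (Fintype.card H * Fintype.card V) := Nat.mul_le_mul_left _ h3
        _ = _ := by ring
    exact Nat.le_of_mul_le_mul_right this hVpos
  refine ⟨H, finrank_le_of_card_le H (2 * s) hcodim, fun v hv => ?_⟩
  by_contra hcon
  have hno : ∀ x y : Fin (2 * (2 * s + 1) + 1) → V, (∀ i, x i ∈ X) → (∀ i, y i ∈ X) →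
      ∑ i, (x i - y i) ≠ v := by
    intro x y hx hy hxy
    apply hcon
    have hn : 8 * s + 6 = (2 * (2 * s + 1) + 1) + (2 * (2 * s + 1) + 1) := by ring
    rw [hn]
    refine ⟨Fin.append x (fun i => (-1 : ZMod p) • y i), ?_, ?_⟩
    · intro i
      refine Fin.addCases (fun i => ?_) (fun i => ?_) i
      · rw [Fin.append_left]; exact hx i
      · rw [Fin.append_right]; exact hX _ _ (hy i)
    · rw [Fin.sum_univ_add]
      simp only [Fin.append_left, Fin.append_right, neg_smul, one_smul]
      rw [← hxy, Finset.sum_sub_distrib, Finset.sum_neg_distrib, sub_eq_add_neg]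
  have h6 := pow_mul_pairCount_le X hX H hH hG (2 * s + 1) v hv hno
  have h7 : (p ^ (2 * s + 1) * pairCount X H) ^ 2 ≤ (Fintype.card V * #X) ^ 2 :=
    Nat.pow_le_pow_left h6 2
  have h8 : p ^ 2 * (Fintype.card V ^ 2 * #X ^ 2) * Fintype.card V ≤
      (Fintype.card V ^ 2 * #X ^ 2) * Fintype.card V := by
    calc p ^ 2 * (Fintype.card V ^ 2 * #X ^ 2) * Fintype.card V
        = p ^ 2 * #X ^ 2 * (Fintype.card V ^ 2 * Fintype.card V) := by ring
      _ ≤ p ^ 2 * #X ^ 2 * ((p ^ (2 * s) * #X ^ 2) * (p ^ (2 * s) * Fintype.card H)) :=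
          Nat.mul_le_mul_left _ (Nat.mul_le_mul hs2 hcodim)
      _ = (p ^ (2 * s + 1)) ^ 2 * ((#X * #X) ^ 2 * Fintype.card H) := by ring
      _ ≤ (p ^ (2 * s + 1)) ^ 2 * (pairCount X H ^ 2 * Fintype.card V) :=
          Nat.mul_le_mul_left _ h1
      _ = (p ^ (2 * s + 1) * pairCount X H) ^ 2 * Fintype.card V := by ring
      _ ≤ (Fintype.card V * #X) ^ 2 * Fintype.card V := Nat.mul_le_mul_right _ h7
      _ = _ := by ring
  have h9 : 0 < Fintype.card V ^ 2 * #X ^ 2 := by positivity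
  have h10 := Nat.le_of_mul_le_mul_right h8 hVpos
  have h11 : 1 < p ^ 2 := Nat.one_lt_pow two_ne_zero hp
  nlinarith

end ConicSums

section BoundedRank

open Module Finset

variable {p : ℕ}

/-- A filtration `L 0 ⊆ L 1 ⊆ ⋯` of scaling-invariant sets with `L r + L s ⊆ L (r + s)`. -/
structure RankFiltration (p : ℕ) {B : Type*} [AddCommGroup B] [Module (ZMod p) B]
    (L : ℕ → B → Prop) : Prop where
  zero : ∀ r, L r 0
  mono : ∀ {r s b}, r ≤ s → L r b → L s b
  add : ∀ {r s a b}, L r a → L s b → L (r + s) (a + b)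
  smul : ∀ {r b} (c : ZMod p), L r b → L r (c • b)

namespace RankFiltration

variable {B : Type*} [AddCommGroup B] [Module (ZMod p) B] {L : ℕ → B → Prop}

lemma neg (h : RankFiltration p L) {r : ℕ} {b : B} (hb : L r b) : L r (-b) := by
  simpa using h.smul (-1) hb

lemma sub (h : RankFiltration p L) {r s : ℕ} {a b : B} (ha : L r a) (hb : L s b) :
    L (r + s) (a - b) := by
  rw [sub_eq_add_neg]; exact h.add ha (h.neg hb)

lemma sum (h : RankFiltration p L) {r : ℕ} : ∀ {m : ℕ} {b : Fin m → B}, (∀ i, L r (b i)) →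
    L (m * r) (∑ i, b i) := by
  intro m
  induction m with
  | zero => intro b _; simpa using h.zero _
  | succ m ih =>
    intro b hb
    rw [Fin.sum_univ_castSucc, Nat.succ_mul]
    exact h.add (ih fun i => hb _) (hb _)

/-- The filtration obtained by working modulo a subspace. -/
lemma quotient (h : RankFiltration p L) (Γ : Submodule (ZMod p) B) :
    RankFiltration p (fun r b => ∃ γ ∈ Γ, L r (b - γ)) where
  zero r := ⟨0, Γ.zero_mem, by simpa using h.zero r⟩
  mono hrs := fun ⟨γ, hγ, hb⟩ => ⟨γ, hγ, h.mono hrs hb⟩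
  add := fun ⟨γ, hγ, ha⟩ ⟨γ', hγ', hb⟩ => ⟨γ + γ', Γ.add_mem hγ hγ', by
    have := h.add ha hb
    rwa [sub_add_sub_comm] at this⟩
  smul c := fun ⟨γ, hγ, ha⟩ => ⟨c • γ, Γ.smul_mem c hγ, by
    have := h.smul c ha
    rwa [smul_sub] at this⟩

end RankFiltration

/-- The factor lost in the rank bound of `exists_subspace_approx`. -/
def rankLoss : ℕ → ℕ
  | 0 => 1
  | ρ + 1 => (8 * (ρ + 1) + 10) * rankLoss (2 * (ρ + 1) / 3)
decreasing_by omega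

lemma rankLoss_of_pos {ρ : ℕ} (h : 0 < ρ) :
    rankLoss ρ = (8 * ρ + 10) * rankLoss (2 * ρ / 3) := by
  obtain ⟨n, rfl⟩ := Nat.exists_eq_succ_of_ne_zero h.ne'
  rw [rankLoss]

variable [Fact p.Prime] {E B : Type*} [AddCommGroup E] [Module (ZMod p) E] [AddCommGroup B] [Module (ZMod p) B]

lemma finrank_avoiding_le {V : Type*} [AddCommGroup V] [Module (ZMod p) V] [Finite V]
    {L : ℕ → B → Prop} (hL : RankFiltration p L) (A : E →ₗ[ZMod p] V →ₗ[ZMod p] B) (r ρ : ℕ)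
    (h : ∀ x (Z : Submodule (ZMod p) V), (∀ z ∈ Z, L r (A x z) → z = 0) → finrank (ZMod p) Z ≤ ρ)
    (x₁ : E) (Y H : Submodule (ZMod p) V)
    (hY : ∀ y ∈ Y, L ((8 * ρ + 10) * r) (A x₁ y) → y = 0)
    (hH : ∀ v ∈ H, L ((8 * ρ + 6) * r) (A x₁ v))
    (x : E) (Z : Submodule (ZMod p) V) (hZH : Z ≤ H)
    (hZ : ∀ z ∈ Z, (∃ γ ∈ Y.map (A x₁), L ((8 * ρ + 10) * r) (A x z - γ)) → z = 0) :
    2 * finrank (ZMod p) Z + finrank (ZMod p) Y ≤ 2 * ρ := by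
  let _ : Fintype V := Fintype.ofFinite V
  let φ : Y × Z →ₗ[ZMod p] V := Y.subtype.coprod Z.subtype
  have hφ : ∀ q : Y × Z, φ q = q.1 + q.2 := fun q => by simp [φ]
  have hφi : Function.Injective φ := by
    rw [← LinearMap.ker_eq_bot, LinearMap.ker_eq_bot']
    intro q hq
    rw [hφ] at hq
    have h1 : (q.1 : V) = -q.2 := eq_neg_of_add_eq_zero_left hq
    have h2 : (q.1 : V) = 0 := by
      refine hY _ q.1.2 ?_
      refine hL.mono (Nat.mul_le_mul_right r (by omega)) (hH _ ?_)
      rw [h1]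
      exact H.neg_mem (hZH q.2.2)
    have h3 : (q.2 : V) = 0 := by rw [h2] at hq; simpa using hq
    exact Prod.ext (Subtype.ext h2) (Subtype.ext h3)
  let K : E → Finset (Y × Z) := fun e => Finset.univ.filter fun q => L r (A e (φ q))
  have hK : ∀ e, Fintype.card (Y × Z) ≤ p ^ ρ * #(K e) := by
    intro e
    refine card_le_of_avoiding (p := p) (K e) ?_ ?_ ρ ?_
    · simp [K, hL.zero]
    · intro c v hv
      simp only [K, Finset.mem_filter, Finset.mem_univ, true_and, map_smul] at hv ⊢
      exact hL.smul c hv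
    · intro S hS
      rw [(Submodule.equivMapOfInjective φ hφi S).finrank_eq]
      refine h e _ ?_
      rintro _ ⟨q, hq, rfl⟩ hz
      rw [hS q hq (by simpa [K] using hz), map_zero]
  have hinj : #(K x ×ˢ K (x + x₁)) ≤ #(Finset.univ : Finset Y) := by
    refine Finset.card_le_card_of_injOn (fun q => q.1.1 + q.2.1) (fun _ _ => Finset.mem_coe.2
      (Finset.mem_univ _)) ?_
    intro q hq q' hq' heq
    simp only [Finset.coe_product, Set.mem_prod, Finset.mem_coe, K, Finset.mem_filter,
      Finset.mem_univ, true_and] at hq hq'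
    obtain ⟨q0, q1⟩ := q
    obtain ⟨r0, r1⟩ := q'
    simp only at heq hq hq'
    have d0 : L (r + r) (A x (φ (q0 - r0))) := by
      have := hL.sub hq.1 hq'.1
      rwa [← map_sub, ← map_sub] at this
    have d1 : L (r + r) (A (x + x₁) (φ (q1 - r1))) := by
      have := hL.sub hq.2 hq'.2
      rwa [← map_sub, ← map_sub] at this
    set e0 := q0 - r0 with he0
    set e1 := q1 - r1 with he1
    have hy : (e0.1 : V) + e1.1 = 0 := by
      have : e0.1 + e1.1 = 0 := by
        rw [he0, he1, Prod.fst_sub, Prod.fst_sub, sub_add_sub_comm, heq, sub_self]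
      exact_mod_cast congrArg Subtype.val this
    have hz1 : L ((8 * ρ + 6) * r) (A x₁ e1.2) := hH _ (hZH e1.2.2)
    have key : L ((8 * ρ + 10) * r) (A x ((e0.2 : V) + e1.2) + A x₁ e1.1) := by
      have := hL.sub (hL.add d0 d1) hz1
      have h4 : A x (e0.1 : V) = - A x (e1.1 : V) := by
        rw [eq_neg_of_add_eq_zero_left hy, map_neg]
      have h5 : A x ((e0.2 : V) + e1.2) + A x₁ e1.1 =
          A x (φ e0) + A (x + x₁) (φ e1) - A x₁ e1.2 := by
        simp only [hφ, map_add, LinearMap.add_apply, h4]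
        abel
      rw [h5]
      exact hL.mono (le_of_eq (by ring)) this
    have hz : (e0.2 : V) + e1.2 = 0 := by
      refine hZ _ (Z.add_mem e0.2.2 e1.2.2) ⟨-(A x₁ e1.1), ?_, by rwa [sub_neg_eq_add]⟩
      exact Submodule.neg_mem _ (Submodule.mem_map_of_mem e1.1.2)
    have hy1 : (e1.1 : V) = 0 := by
      refine hY _ e1.1.2 ?_
      rwa [hz, map_zero, zero_add] at key
    have hy0 : (e0.1 : V) = 0 := by simpa [hy1] using hy
    have hz0 : (e0.2 : V) = 0 := by
      refine hZ _ e0.2.2 ⟨0, Submodule.zero_mem _, ?_⟩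
      rw [hφ, hy0, zero_add] at d0
      rw [sub_zero]
      exact hL.mono (by rw [← two_mul]; exact Nat.mul_le_mul_right r (by omega)) d0
    have hz1' : (e1.2 : V) = 0 := by simpa [hz0] using hz
    have f0 : e0 = 0 := Prod.ext (Subtype.ext hy0) (Subtype.ext hz0)
    have f1 : e1 = 0 := Prod.ext (Subtype.ext hy1) (Subtype.ext hz1')
    exact Prod.ext (sub_eq_zero.1 f0) (sub_eq_zero.1 f1)
  rw [Finset.card_product, Finset.card_univ] at hinj
  have hmul : Fintype.card (Y × Z) * Fintype.card (Y × Z) ≤ p ^ (2 * ρ) * Fintype.card Y := by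
    calc _ ≤ (p ^ ρ * #(K x)) * (p ^ ρ * #(K (x + x₁))) := Nat.mul_le_mul (hK _) (hK _)
      _ = p ^ (2 * ρ) * (#(K x) * #(K (x + x₁))) := by ring
      _ ≤ _ := Nat.mul_le_mul_left _ hinj
  rw [Fintype.card_prod, Module.card_eq_pow_finrank (K := ZMod p) (V := Y),
    Module.card_eq_pow_finrank (K := ZMod p) (V := Z), ZMod.card, ← pow_add, ← pow_add,
    ← pow_add] at hmul
  have := (Nat.pow_le_pow_iff_right (Fact.out : p.Prime).one_lt).1 hmul
  omega

/-- A linear family of linear maps, each of which has bounded rank relative to a filtration,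
takes values close to a fixed subspace of bounded dimension once restricted to a subspace of
bounded codimension. -/
theorem exists_subspace_approx [Module.Finite (ZMod p) B] (ρ : ℕ) :
    ∀ (V : Type*) [AddCommGroup V] [Module (ZMod p) V] [Finite V]
      (L : ℕ → B → Prop) (_ : RankFiltration p L) (A : E →ₗ[ZMod p] V →ₗ[ZMod p] B) (r : ℕ),
      (∀ x (Z : Submodule (ZMod p) V), (∀ z ∈ Z, L r (A x z) → z = 0) →
        finrank (ZMod p) Z ≤ ρ) →
      ∃ (V' : Submodule (ZMod p) V) (Γ : Submodule (ZMod p) B),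
        finrank (ZMod p) V ≤ finrank (ZMod p) V' + 6 * ρ ∧ finrank (ZMod p) Γ ≤ 3 * ρ ∧
        ∀ x, ∀ v ∈ V', ∃ γ ∈ Γ, L (rankLoss ρ * r) (A x v - γ) := by
  induction ρ using Nat.strong_induction_on with
  | _ ρ ih =>
  intro V _ _ _ L hL A r h
  let _ : Fintype V := Fintype.ofFinite V
  rcases Nat.eq_zero_or_pos ρ with rfl | hρ
  · refine ⟨⊤, ⊥, by simp, by simp, fun x v _ => ⟨0, Submodule.zero_mem _, ?_⟩⟩
    rw [sub_zero, rankLoss, one_mul]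
    by_contra hv
    have hv0 : v ≠ 0 := by rintro rfl; exact hv (by simpa using hL.zero r)
    have := h x (Submodule.span (ZMod p) {v}) ?_
    · rw [finrank_span_singleton hv0] at this; omega
    · intro z hz hLz
      obtain ⟨c, rfl⟩ := Submodule.mem_span_singleton.1 hz
      rcases eq_or_ne c 0 with rfl | hc
      · simp
      · exfalso
        apply hv
        have := hL.smul c⁻¹ hLz
        rwa [map_smul, smul_smul, inv_mul_cancel₀ hc, one_smul] at this
  · by_cases hcase : ∀ x (Z : Submodule (ZMod p) V),
        (∀ z ∈ Z, L ((8 * ρ + 10) * r) (A x z) → z = 0) → finrank (ZMod p) Z ≤ 2 * ρ / 3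
    · obtain ⟨V', Γ, h1, h2, h3⟩ := ih (2 * ρ / 3) (by omega) V L hL A _ hcase
      refine ⟨V', Γ, by omega, by omega, fun x v hv => ?_⟩
      rw [rankLoss_of_pos hρ, mul_right_comm, mul_comm]
      exact h3 x v hv
    · push Not at hcase
      obtain ⟨x₁, Y, hY, hYd⟩ := hcase
      have hYρ : finrank (ZMod p) Y ≤ ρ := h x₁ Y fun z hz hz' =>
        hY z hz (hL.mono (Nat.le_mul_of_pos_left _ (by omega)) hz')
      let K : Finset V := Finset.univ.filter fun v => L r (A x₁ v)
      have hK0 : (0 : V) ∈ K := by simp [K, hL.zero]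
      have hKs : ∀ (c : ZMod p), ∀ v ∈ K, c • v ∈ K := by
        intro c v hv
        simp only [K, Finset.mem_filter, Finset.mem_univ, true_and, map_smul] at hv ⊢
        exact hL.smul c hv
      have hKc := card_le_of_avoiding K hK0 hKs ρ fun Z hZ =>
        h x₁ Z fun z hz hz' => hZ z hz (by simpa [K] using hz')
      obtain ⟨H, hHd, hH⟩ := exists_subspace_subset_sum K hK0 hKs ρ hKc
      have hHL : ∀ v ∈ H, L ((8 * ρ + 6) * r) (A x₁ v) := by
        intro v hv
        obtain ⟨y, hy, rfl⟩ := hH v hv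
        rw [map_sum]
        exact hL.sum fun i => by simpa [K] using hy i
      have hsub : ∀ x (Z : Submodule (ZMod p) H),
          (∀ z ∈ Z, (∃ γ ∈ Y.map (A x₁), L ((8 * ρ + 10) * r) ((A.compl₂ H.subtype) x z - γ)) →
            z = 0) → finrank (ZMod p) Z ≤ 2 * ρ / 3 := by
        intro x Z hZ
        have := finrank_avoiding_le hL A r ρ h x₁ Y H hY hHL x (Z.map H.subtype)
          (Submodule.map_subtype_le _ _) ?_
        · rw [Submodule.finrank_map_subtype_eq] at this
          omega
        · rintro _ ⟨z, hz, rfl⟩ hγ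
          rw [hZ z hz hγ, map_zero]
      obtain ⟨V', Γ, h1, h2, h3⟩ := ih (2 * ρ / 3) (by omega) H _ (hL.quotient (Y.map (A x₁)))
        (A.compl₂ H.subtype) _ hsub
      refine ⟨V'.map H.subtype, Y.map (A x₁) ⊔ Γ, ?_, ?_, ?_⟩
      · rw [Submodule.finrank_map_subtype_eq]; omega
      · have h4 := Submodule.finrank_add_le_finrank_add_finrank (Y.map (A x₁)) Γ
        have h5 := Submodule.finrank_map_le (A x₁) Y
        omega
      · rintro x _ ⟨v, hv, rfl⟩
        obtain ⟨γ, hγ, γ', hγ', hγγ⟩ := h3 x v hv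
        refine ⟨γ' + γ, Submodule.add_mem_sup hγ' hγ, ?_⟩
        rw [rankLoss_of_pos hρ, mul_right_comm, mul_comm]
        convert hγγ using 1
        rw [add_comm, ← sub_sub]
        rfl

end BoundedRank

section Codimension

open Module Finset

variable {K V U : Type*} [Field K] [AddCommGroup V] [Module K V] [AddCommGroup U] [Module K U]

lemma finrank_le_inf [Module.Finite K V] {A B : Submodule K V} {a b : ℕ}
    (hA : finrank K V ≤ finrank K A + a)
    (hB : finrank K V ≤ finrank K B + b) :
    finrank K V ≤ finrank K (A ⊓ B : Submodule K V) + (a + b) := by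
  have h1 := Submodule.finrank_sup_add_finrank_inf_eq A B
  have h2 := Submodule.finrank_le (A ⊔ B)
  omega

lemma finrank_le_finset_inf [Module.Finite K V] {ι : Type*} (t : Finset ι)
    (H : ι → Submodule K V) (a : ℕ)
    (h : ∀ i ∈ t, finrank K V ≤ finrank K (H i) + a) :
    finrank K V ≤ finrank K (t.inf H : Submodule K V) + #t * a := by
  induction t using Finset.induction_on with
  | empty => rw [Finset.inf_empty, finrank_top]; omega
  | insert i t hi ih =>
    rw [Finset.inf_insert, Finset.card_insert_of_notMem hi, Nat.succ_mul, add_comm (_ * _)]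
    exact finrank_le_inf (h i (Finset.mem_insert_self _ _))
      (ih fun j hj => h j (Finset.mem_insert_of_mem hj))

lemma finrank_le_of_disjoint [Module.Finite K V] {A B : Submodule K V} {a : ℕ}
    (hA : finrank K V ≤ finrank K A + a) (h : ∀ z ∈ B, z ∈ A → z = 0) :
    finrank K B ≤ a := by
  have h1 : A ⊓ B = ⊥ := by
    rw [eq_bot_iff]
    intro z hz
    simpa using h z hz.2 hz.1
  have h2 := Submodule.finrank_sup_add_finrank_inf_eq A B
  have h3 := Submodule.finrank_le (A ⊔ B)
  rw [h1, finrank_bot] at h2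
  omega

lemma finrank_le_inf_ker_dual [Module.Finite K V] {g : ℕ} (γ : Fin g → Dual K V) :
    finrank K V ≤
      finrank K (Finset.univ.inf fun i => LinearMap.ker (γ i) : Submodule K V) + g := by
  have := finrank_le_finset_inf Finset.univ (fun i => LinearMap.ker (γ i)) 1 fun i _ => by
    have h1 := LinearMap.finrank_range_add_finrank_ker (γ i)
    have h2 := Submodule.finrank_le (LinearMap.range (γ i))
    rw [finrank_self] at h2
    omega
  simpa using this

lemma exists_forall_mem_eq_sum [Module.Finite K U] (Γ : Submodule K U) {g : ℕ}
    (hΓ : finrank K Γ ≤ g) :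
    ∃ β : Fin g → U, ∀ v ∈ Γ, ∃ c : Fin g → K, v = ∑ i, c i • β i := by
  let b := Module.finBasis K Γ
  refine ⟨fun i => if h : (i : ℕ) < finrank K Γ then b ⟨i, h⟩ else 0, fun v hv => ?_⟩
  refine (Submodule.mem_span_range_iff_exists_fun K).1 ?_ |>.imp fun c hc => hc.symm
  have h1 : v = ∑ i, b.repr ⟨v, hv⟩ i • (b i : U) := by
    have h2 := congrArg Γ.subtype (b.sum_repr ⟨v, hv⟩)
    rw [map_sum] at h2
    exact h2.symm
  rw [h1]
  refine Submodule.sum_mem _ fun i _ => Submodule.smul_mem _ _ (Submodule.subset_span ?_)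
  exact ⟨⟨i, i.2.trans_le hΓ⟩, by simp⟩

end Codimension

section LinearAlgebra

open Module Finset

variable {p : ℕ} [Fact p.Prime]
variable {V U : Type*} [AddCommGroup V] [Module (ZMod p) V] [AddCommGroup U] [Module (ZMod p) U]

lemma card_le_of_sum_ge {ι : Type*} [Fintype ι] (N : ι → ℕ) (M s : ℕ) (hM : 0 < M)
    (hN : ∀ x, N x ≤ M) (h : Fintype.card ι * M ≤ p ^ s * ∑ x, N x) :
    Fintype.card ι ≤ p ^ (s + 1) * #{x | M ≤ p ^ (s + 1) * N x} := by
  have hp : 2 ≤ p := (Fact.out : p.Prime).two_le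
  have h1 : ∀ x, p ^ (s + 1) * N x ≤ (if M ≤ p ^ (s + 1) * N x then p ^ (s + 1) * M else 0) + M := by
    intro x
    split_ifs with hx
    · exact (Nat.mul_le_mul_left _ (hN x)).trans (Nat.le_add_right _ _)
    · omega
  have h2 := Finset.sum_le_sum fun x (_ : x ∈ (Finset.univ : Finset ι)) => h1 x
  rw [← Finset.mul_sum, Finset.sum_add_distrib, ← Finset.sum_filter, Finset.sum_const,
    Finset.sum_const, Finset.card_univ, smul_eq_mul, smul_eq_mul] at h2
  have h3 : 2 * (Fintype.card ι * M) ≤ p ^ (s + 1) * ∑ x, N x := by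
    calc _ ≤ p * (p ^ s * ∑ x, N x) := Nat.mul_le_mul hp h
      _ = _ := by ring
  refine Nat.le_of_mul_le_mul_right ?_ hM
  nlinarith

lemma rankFiltration_finrank_ker [Module.Finite (ZMod p) V] :
    RankFiltration p (fun r (b : V →ₗ[ZMod p] U) =>
      finrank (ZMod p) V ≤ finrank (ZMod p) (LinearMap.ker b) + r) where
  zero r := by rw [LinearMap.ker_zero, finrank_top]; omega
  mono hrs h := by omega
  add ha hb := by
    refine (finrank_le_inf ha hb).trans (Nat.add_le_add_right (Submodule.finrank_mono ?_) _)
    rintro v ⟨h1, h2⟩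
    rw [LinearMap.mem_ker, LinearMap.add_apply, LinearMap.mem_ker.1 h1, LinearMap.mem_ker.1 h2,
      add_zero]
  smul c h := by
    refine h.trans (Nat.add_le_add_right (Submodule.finrank_mono ?_) _)
    intro v h1
    rw [LinearMap.mem_ker, LinearMap.smul_apply, LinearMap.mem_ker.1 h1, smul_zero]

lemma rankFiltration_eq_zero : RankFiltration p (fun _ (b : U) => b = 0) where
  zero _ := rfl
  mono _ h := h
  add ha hb := by simp [ha, hb]
  smul c h := by simp [h]

/-- A linear family of linear maps of bounded rank maps a subspace of bounded codimension into
a fixed subspace of bounded dimension. -/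
lemma exists_subspace_map_mem {E : Type*} [AddCommGroup E] [Module (ZMod p) E] [Finite V]
    [Module.Finite (ZMod p) U] (A : E →ₗ[ZMod p] V →ₗ[ZMod p] U) (ρ : ℕ)
    (h : ∀ x, finrank (ZMod p) V ≤ finrank (ZMod p) (LinearMap.ker (A x)) + ρ) :
    ∃ (V' : Submodule (ZMod p) V) (γ : Fin (3 * ρ) → U),
      finrank (ZMod p) V ≤ finrank (ZMod p) V' + 6 * ρ ∧
      ∀ x, ∀ v ∈ V', ∃ c : Fin (3 * ρ) → ZMod p, A x v = ∑ i, c i • γ i := by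
  have : Module.Finite (ZMod p) V := Module.Finite.of_finite
  obtain ⟨V', Γ, h1, h2, h3⟩ := exists_subspace_approx (B := U) ρ V (fun _ b => b = 0)
    rankFiltration_eq_zero A 0
    fun x Z hZ => finrank_le_of_disjoint (h x) fun z hz hz' => hZ z hz hz'
  obtain ⟨γ, hγ⟩ := exists_forall_mem_eq_sum Γ h2
  refine ⟨V', γ, h1, fun x v hv => hγ _ ?_⟩
  obtain ⟨b, hb, h4⟩ := h3 x v hv
  rwa [sub_eq_zero.1 h4]

/-- If a linear family of linear maps has many zeros, then a subspace of bounded codimension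
consists of maps of bounded rank. -/
lemma exists_subspace_finrank_ker_ge [Fintype V]
    (A : V →ₗ[ZMod p] V →ₗ[ZMod p] U) (s : ℕ)
    (h : Fintype.card V * Fintype.card V ≤ p ^ s * ∑ x, Fintype.card (LinearMap.ker (A x))) :
    ∃ H : Submodule (ZMod p) V, finrank (ZMod p) V ≤ finrank (ZMod p) H + 2 * (s + 1) ∧
      ∀ x ∈ H, finrank (ZMod p) V ≤
        finrank (ZMod p) (LinearMap.ker (A x)) + (8 * (s + 1) + 6) * (s + 1) := by
  have : Module.Finite (ZMod p) V := Module.Finite.of_finite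
  let X : Finset V := {x | Fintype.card V ≤ p ^ (s + 1) * Fintype.card (LinearMap.ker (A x))}
  have hp : 0 < p := (Fact.out : p.Prime).pos
  have hX0 : (0 : V) ∈ X := by
    simp only [X, Finset.mem_filter, Finset.mem_univ, true_and]
    have : Fintype.card V ≤ Fintype.card (LinearMap.ker (A 0)) :=
      Fintype.card_le_of_injective (fun v => ⟨v, by simp⟩) fun v w hvw => by simpa using hvw
    exact this.trans (Nat.le_mul_of_pos_left _ (by positivity))
  have hXs : ∀ (c : ZMod p), ∀ v ∈ X, c • v ∈ X := by
    intro c v hv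
    simp only [X, Finset.mem_filter, Finset.mem_univ, true_and] at hv ⊢
    refine hv.trans (Nat.mul_le_mul_left _ ?_)
    refine Fintype.card_le_of_injective
      (fun w => ⟨w.1, by simp [LinearMap.mem_ker.1 w.2]⟩) fun v w hvw => ?_
    exact Subtype.ext (by simpa using hvw)
  have hXc := card_le_of_sum_ge (p := p) (fun x => Fintype.card (LinearMap.ker (A x)))
    (Fintype.card V) s Fintype.card_pos
    (fun x => Fintype.card_le_of_injective _ Subtype.val_injective) h
  obtain ⟨H, hH, hsum⟩ := exists_subspace_subset_sum X hX0 hXs (s + 1) hXc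
  refine ⟨H, by omega, fun x hx => ?_⟩
  obtain ⟨y, hy, rfl⟩ := hsum x hx
  rw [map_sum]
  refine rankFiltration_finrank_ker.sum fun i => ?_
  have := hy i
  simp only [X, Finset.mem_filter, Finset.mem_univ, true_and] at this
  rw [add_comm]
  exact finrank_le_of_card_le _ _ this

/-- A trilinear form with many zeros vanishes on a subspace of bounded codimension. -/
theorem exists_subspace_trilinear_eq_zero [Fintype V]
    (T : V →ₗ[ZMod p] V →ₗ[ZMod p] V →ₗ[ZMod p] ZMod p) (s : ℕ)
    (h : Fintype.card V * Fintype.card V ≤ p ^ s * ∑ x, Fintype.card (LinearMap.ker (T x))) :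
    ∃ W : Submodule (ZMod p) V,
      finrank (ZMod p) V ≤ finrank (ZMod p) W +
        (2 * (s + 1) + 9 * ((8 * (s + 1) + 6) * (s + 1))) ∧
      ∀ x ∈ W, ∀ y ∈ W, ∀ z ∈ W, T x y z = 0 := by
  have : Module.Finite (ZMod p) V := Module.Finite.of_finite
  obtain ⟨H, hH, hrank⟩ := exists_subspace_finrank_ker_ge T s h
  obtain ⟨V', γ, h1, h2⟩ := exists_subspace_map_mem (T ∘ₗ H.subtype) _
    fun x => hrank x x.2
  refine ⟨H ⊓ (V' ⊓ Finset.univ.inf fun i => LinearMap.ker (γ i)), ?_, ?_⟩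
  · have := finrank_le_inf hH (finrank_le_inf h1 (finrank_le_inf_ker_dual γ))
    omega
  · rintro x ⟨hx, -⟩ y ⟨-, hy, -⟩ z ⟨-, -, hz⟩
    obtain ⟨c, hc⟩ := h2 ⟨x, hx⟩ y hy
    have hz' : ∀ i, γ i z = 0 := fun i => Submodule.mem_finsetInf.1 hz i (Finset.mem_univ i)
    change ((T ∘ₗ H.subtype) ⟨x, hx⟩) y z = 0
    rw [hc]
    simp [hz']

end LinearAlgebra

section Isotropic

open Module Finset

variable {K V : Type*} [Field K] [Finite K] [AddCommGroup V] [Module K V]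

lemma exists_ne_zero_forall_apply_self_eq_zero [Module.Finite K V] {ι : Type*} [Fintype ι]
    (β : ι → V →ₗ[K] V →ₗ[K] K)
    (h : 2 * Fintype.card ι < finrank K V) : ∃ v ≠ 0, ∀ i, β i v v = 0 := by
  let _ : Fintype K := Fintype.ofFinite K
  let b := Module.finBasis K V
  let f : ι → MvPolynomial (Fin (finrank K V)) K := fun i =>
    ∑ j, ∑ k, C (β i (b j) (b k)) * (X j * X k)
  have heval : ∀ i x, eval x (f i) = β i (∑ j, x j • b j) (∑ j, x j • b j) := by
    intro i x
    simp only [f, map_sum, map_mul, eval_C, eval_X, LinearMap.sum_apply, map_smul,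
      LinearMap.smul_apply, smul_eq_mul, Finset.mul_sum]
    rw [Finset.sum_comm]
    refine Finset.sum_congr rfl fun j _ => ?_
    refine Finset.sum_congr rfl fun k _ => ?_
    ring
  have hdeg : ∀ i, (f i).totalDegree ≤ 2 := by
    intro i
    refine MvPolynomial.totalDegree_finsetSum_le fun j _ =>
      MvPolynomial.totalDegree_finsetSum_le fun k _ => ?_
    refine (totalDegree_mul _ _).trans ?_
    refine (Nat.add_le_add_left (totalDegree_mul _ _) _).trans ?_
    simp [totalDegree_C, totalDegree_X]
  have hsum : ∑ i, (f i).totalDegree < Fintype.card (Fin (finrank K V)) := by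
    rw [Fintype.card_fin]
    refine lt_of_le_of_lt (Finset.sum_le_card_nsmul _ _ 2 fun i _ => hdeg i) ?_
    rw [Finset.card_univ, smul_eq_mul]; omega
  obtain ⟨p, _⟩ := CharP.exists K
  have hp : 1 < p := (CharP.char_is_prime K p).one_lt
  have hdvd := char_dvd_card_solutions_of_fintype_sum_lt (K := K) p hsum
  have h0 : ∀ i, eval 0 (f i) = 0 := by
    intro i; rw [heval]; simp
  have hcard : 1 < Fintype.card {x // ∀ i, eval x (f i) = 0} :=
    lt_of_lt_of_le hp (Nat.le_of_dvd (Fintype.card_pos_iff.2 ⟨⟨0, h0⟩⟩) hdvd)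
  obtain ⟨x, hx⟩ := Fintype.exists_ne_of_one_lt_card hcard ⟨0, h0⟩
  refine ⟨∑ j, x.1 j • b j, ?_, fun i => by rw [← heval]; exact x.2 i⟩
  intro hv
  apply hx
  ext j
  have := congrArg (fun v => b.repr v j) hv
  simpa [Finsupp.single_apply] using this

/-- A finite family of bilinear forms has a common totally isotropic subspace whose dimension is
proportional to that of the ambient space. -/
theorem exists_isotropic_subspace [Finite V] {ι : Type*} [Fintype ι]
    (β : ι → V →ₗ[K] V →ₗ[K] K) (V₁ : Submodule K V) (m : ℕ)
    (h : (2 * Fintype.card ι + 1) * m ≤ finrank K V₁) :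
    ∃ W ≤ V₁, finrank K W = m ∧ ∀ i, ∀ x ∈ W, ∀ y ∈ W, β i x y = 0 := by
  have : Module.Finite K V := Module.Finite.of_finite
  induction m with
  | zero => exact ⟨⊥, bot_le, by simp, by intro β x hx y _; simp [(Submodule.mem_bot _).1 hx]⟩
  | succ m ih =>
    obtain ⟨W, hW, hWd, hWβ⟩ := ih (le_trans (Nat.mul_le_mul_left _ (Nat.le_succ m)) h)
    have hker : ∀ f : V →ₗ[K] Dual K W, finrank K V ≤ finrank K (LinearMap.ker f) + m := by
      intro f
      have h1 := LinearMap.finrank_range_add_finrank_ker f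
      have h2 := Submodule.finrank_le (LinearMap.range f)
      rw [Subspace.dual_finrank_eq] at h2
      omega
    let N : ι → Submodule K V := fun i => LinearMap.ker ((β i).compl₂ W.subtype) ⊓
      LinearMap.ker ((β i).flip.compl₂ W.subtype)
    have hN := finrank_le_finset_inf Finset.univ N (m + m) fun i _ =>
      finrank_le_inf (hker _) (hker _)
    let L : Submodule K V := V₁ ⊓ Finset.univ.inf N
    have hL : ∀ v ∈ L, v ∈ V₁ ∧ ∀ i, (∀ w ∈ W, β i v w = 0) ∧ ∀ w ∈ W, β i w v = 0 := by
      intro v hv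
      refine ⟨hv.1, fun i => ?_⟩
      have hi : v ∈ N i := (Finset.inf_le (Finset.mem_univ i) : Finset.univ.inf N ≤ N i) hv.2
      exact ⟨fun w hw => LinearMap.congr_fun hi.1 ⟨w, hw⟩,
        fun w hw => LinearMap.congr_fun hi.2 ⟨w, hw⟩⟩
    have hLd : m + 2 * Fintype.card ι + 1 ≤ finrank K L := by
      have h1 := Submodule.finrank_sup_add_finrank_inf_eq V₁ (Finset.univ.inf N)
      have h2 := Submodule.finrank_le (V₁ ⊔ Finset.univ.inf N)
      rw [Finset.card_univ] at hN
      change _ ≤ finrank K (V₁ ⊓ Finset.univ.inf N : Submodule K V)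
      nlinarith
    obtain ⟨C, hC⟩ := Submodule.exists_isCompl (W.comap L.subtype)
    have hCd : 2 * Fintype.card ι < finrank K C := by
      have h1 := Submodule.finrank_add_eq_of_isCompl hC
      have h2 : finrank K (W.comap L.subtype) ≤ m := by
        rw [← Submodule.finrank_map_subtype_eq, Submodule.map_comap_subtype, ← hWd]
        exact Submodule.finrank_mono inf_le_right
      omega
    obtain ⟨v, hv0, hv⟩ := exists_ne_zero_forall_apply_self_eq_zero
      (fun i => (β i).compl₁₂ (L.subtype ∘ₗ C.subtype) (L.subtype ∘ₗ C.subtype)) hCd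
    have hvv : ∀ i, β i v.1.1 v.1.1 = 0 := hv
    have hvW : v.1.1 ∉ W := by
      intro hmem
      apply hv0
      have : v.1 ∈ W.comap L.subtype ⊓ C := ⟨hmem, v.2⟩
      rw [hC.inf_eq_bot] at this
      exact Subtype.ext ((Submodule.mem_bot _).1 this)
    obtain ⟨hv1, hv2⟩ := hL _ v.1.2
    refine ⟨W ⊔ Submodule.span K {v.1.1}, sup_le hW ?_, ?_, ?_⟩
    · rwa [Submodule.span_singleton_le_iff_mem]
    · rw [Submodule.finrank_sup_span_singleton hvW, hWd]
    · intro i x hx y hy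
      obtain ⟨w, hw, u, hu, rfl⟩ := Submodule.mem_sup.1 hx
      obtain ⟨w', hw', u', hu', rfl⟩ := Submodule.mem_sup.1 hy
      obtain ⟨c, rfl⟩ := Submodule.mem_span_singleton.1 hu
      obtain ⟨c', rfl⟩ := Submodule.mem_span_singleton.1 hu'
      simp [hWβ i w hw w' hw', (hv2 i).1 w' hw', (hv2 i).2 w hw, hvv i]

end Isotropic

section Restriction

open Module Finset

variable {K V W U U' : Type*} [Field K] [AddCommGroup V] [Module K V] [AddCommGroup W] [Module K W]
  [AddCommGroup U] [Module K U] [AddCommGroup U'] [Module K U']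

/-- Precomposition with `i` and postcomposition with `r`, as a linear map. -/
def sandwich (i : W →ₗ[K] V) (r : U →ₗ[K] U') : (V →ₗ[K] U) →ₗ[K] (W →ₗ[K] U') where
  toFun f := r ∘ₗ f ∘ₗ i
  map_add' f g := by ext; simp
  map_smul' c f := by ext; simp

@[simp] lemma sandwich_apply (i : W →ₗ[K] V) (r : U →ₗ[K] U') (f : V →ₗ[K] U) (w : W) :
    sandwich i r f w = r (f (i w)) := rfl

lemma finrank_le_comap_subtype [Module.Finite K V] {N : Submodule K V} {a : ℕ}
    (h : finrank K V ≤ finrank K N + a) (W : Submodule K V) :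
    finrank K W ≤ finrank K (N.comap W.subtype) + a := by
  have h1 := Submodule.finrank_sup_add_finrank_inf_eq W N
  have h2 := Submodule.finrank_le (W ⊔ N)
  rw [← Submodule.finrank_map_subtype_eq, Submodule.map_comap_subtype]
  omega

end Restriction

section Quadrilinear

open Module Finset

variable {p : ℕ} [Fact p.Prime] {V : Type*} [AddCommGroup V] [Module (ZMod p) V]

lemma exists_subspace_approx_family {E B : Type*} [AddCommGroup E] [Module (ZMod p) E]
    [AddCommGroup B] [Module (ZMod p) B] [Module.Finite (ZMod p) B] [Finite V]
    {L : ℕ → B → Prop} (hL : RankFiltration p L) (A : E →ₗ[ZMod p] V →ₗ[ZMod p] B) (ρ r : ℕ)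
    (h : ∀ x, ∃ N : Submodule (ZMod p) V, finrank (ZMod p) V ≤ finrank (ZMod p) N + ρ ∧
      ∀ v ∈ N, L r (A x v)) :
    ∃ (V' : Submodule (ZMod p) V) (γ : Fin (3 * ρ) → B),
      finrank (ZMod p) V ≤ finrank (ZMod p) V' + 6 * ρ ∧
      ∀ x, ∀ v ∈ V', ∃ c : Fin (3 * ρ) → ZMod p,
        L (rankLoss ρ * r) (A x v - ∑ i, c i • γ i) := by
  have : Module.Finite (ZMod p) V := Module.Finite.of_finite
  obtain ⟨V', Γ, h1, h2, h3⟩ := exists_subspace_approx ρ V L hL A r fun x Z hZ => by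
    obtain ⟨N, hN, hNL⟩ := h x
    exact finrank_le_of_disjoint hN fun z hz hz' => hZ z hz (hNL z hz')
  obtain ⟨γ, hγ⟩ := exists_forall_mem_eq_sum Γ h2
  refine ⟨V', γ, h1, fun x v hv => ?_⟩
  obtain ⟨b, hb, h4⟩ := h3 x v hv
  obtain ⟨c, rfl⟩ := hγ b hb
  exact ⟨c, h4⟩

/-- The bound on the rank of slices `T x` in terms of the rank of slices `T x y`. -/
def sliceRank (R : ℕ) : ℕ := 9 * R + 9 * R * (9 * R)

/-- A symmetric trilinear form all of whose slices have rank at most `R` depends only on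
boundedly many linear forms in its first argument. -/
lemma finrank_le_ker_trilinear [Finite V]
    (S : V →ₗ[ZMod p] V →ₗ[ZMod p] V →ₗ[ZMod p] ZMod p)
    (h₁ : ∀ x y z, S x y z = S y x z) (h₂ : ∀ x y z, S x y z = S x z y) (R : ℕ)
    (h : ∀ x, finrank (ZMod p) V ≤ finrank (ZMod p) (LinearMap.ker (S x)) + R) :
    finrank (ZMod p) V ≤ finrank (ZMod p) (LinearMap.ker S) + sliceRank R := by
  have : Module.Finite (ZMod p) V := Module.Finite.of_finite
  obtain ⟨V', γ, hV', hγ⟩ := exists_subspace_map_mem S R h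
  let M : Submodule (ZMod p) V := V' ⊓ Finset.univ.inf fun i => LinearMap.ker (γ i)
  have hM : finrank (ZMod p) V ≤ finrank (ZMod p) M + 9 * R := by
    have := finrank_le_inf hV' (finrank_le_inf_ker_dual γ)
    change _ ≤ finrank (ZMod p) (V' ⊓ Finset.univ.inf fun i => LinearMap.ker (γ i) :
      Submodule (ZMod p) V) + _
    omega
  have hSM : ∀ x, ∀ y ∈ M, ∀ z ∈ M, S x y z = 0 := by
    rintro x y ⟨hy, -⟩ z ⟨-, hz⟩
    obtain ⟨c, hc⟩ := hγ x y hy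
    have hz' : ∀ i, γ i z = 0 := fun i => Submodule.mem_finsetInf.1 hz i (Finset.mem_univ i)
    rw [hc]
    simp [hz']
  obtain ⟨C, hC⟩ := Submodule.exists_isCompl M
  have hCd : finrank (ZMod p) C ≤ 9 * R := by
    have := Submodule.finrank_add_eq_of_isCompl hC
    omega
  obtain ⟨β, hβ⟩ := exists_forall_mem_eq_sum C hCd
  let φ : Fin (9 * R * (9 * R)) → Dual (ZMod p) V := fun k =>
    (S.flip (β (finProdFinEquiv.symm k).1)).flip (β (finProdFinEquiv.symm k).2)
  have hΦ := finrank_le_inf_ker_dual φ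
  have hle : M ⊓ (Finset.univ.inf fun k => LinearMap.ker (φ k)) ≤ LinearMap.ker S := by
    rintro x ⟨hx, hx'⟩
    rw [LinearMap.mem_ker]
    have hxβ : ∀ i j, S x (β i) (β j) = 0 := fun i j => by
      have h0 := LinearMap.mem_ker.1
        (Submodule.mem_finsetInf.1 hx' (finProdFinEquiv (i, j)) (Finset.mem_univ _))
      simpa only [φ, Equiv.symm_apply_apply, LinearMap.flip_apply] using h0
    have hxC : ∀ y ∈ C, ∀ z ∈ C, S x y z = 0 := by
      intro y hy z hz
      obtain ⟨c, rfl⟩ := hβ y hy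
      obtain ⟨c', rfl⟩ := hβ z hz
      simp [hxβ]
    ext y z
    have hy : y ∈ M ⊔ C := by rw [hC.sup_eq_top]; trivial
    have hz : z ∈ M ⊔ C := by rw [hC.sup_eq_top]; trivial
    obtain ⟨a, ha, b, hb, rfl⟩ := Submodule.mem_sup.1 hy
    obtain ⟨a', ha', b', hb', rfl⟩ := Submodule.mem_sup.1 hz
    have e1 : S x a a' = 0 := hSM x a ha a' ha'
    have e2 : S x a b' = 0 := by rw [h₂, h₁]; exact hSM b' x hx a ha
    have e3 : S x b a' = 0 := by rw [h₁]; exact hSM b x hx a' ha'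
    simp [e1, e2, e3, hxC b hb b' hb']
  have h5 := finrank_le_inf hM hΦ
  have h6 := Submodule.finrank_mono hle
  unfold sliceRank
  omega

lemma exists_subspace_eq_zero_of_slices [Finite V]
    (T : V →ₗ[ZMod p] V →ₗ[ZMod p] V →ₗ[ZMod p] V →ₗ[ZMod p] ZMod p)
    (h₁ : ∀ x y z w, T x y z w = T x z y w) (h₂ : ∀ x y z w, T x y z w = T x y w z) (R : ℕ)
    (h : ∀ x y, finrank (ZMod p) V ≤ finrank (ZMod p) (LinearMap.ker (T x y)) + R) (k : ℕ)
    (hk : 6 * sliceRank R + (2 * (3 * sliceRank R) + 1) * k ≤ finrank (ZMod p) V) :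
    ∃ W : Submodule (ZMod p) V, finrank (ZMod p) W = k ∧
      ∀ x ∈ W, ∀ y ∈ W, ∀ z ∈ W, ∀ w ∈ W, T x y z w = 0 := by
  have : Module.Finite (ZMod p) V := Module.Finite.of_finite
  have hT : ∀ x, finrank (ZMod p) V ≤ finrank (ZMod p) (LinearMap.ker (T x)) + sliceRank R :=
    fun x => finrank_le_ker_trilinear (T x) (h₁ x) (h₂ x) R (h x)
  generalize sliceRank R = ρ at hT hk
  obtain ⟨V', γ, hV', hγ⟩ := exists_subspace_approx_family
    (rankFiltration_eq_zero (p := p) (U := V →ₗ[ZMod p] V →ₗ[ZMod p] ZMod p)) T ρ 0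
    fun x => ⟨LinearMap.ker (T x), hT x, fun v hv => LinearMap.mem_ker.1 hv⟩
  obtain ⟨W, hW, hWd, hWγ⟩ := exists_isotropic_subspace γ V' k (by
    rw [Fintype.card_fin]; omega)
  refine ⟨W, hWd, fun x hx y hy z hz w hw => ?_⟩
  obtain ⟨c, hc⟩ := hγ x y (hW hy)
  rw [sub_eq_zero.1 hc]
  simp only [LinearMap.sum_apply, LinearMap.smul_apply]
  exact Finset.sum_eq_zero fun i _ => by rw [hWγ i z hz w hw, smul_zero]

/-- The codimension on which slices `T x` of a quadrilinear form take low rank values. -/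
def quadCodim (s : ℕ) : ℕ := (8 * (s + 1) + 6) * (2 * (s + 2))

/-- The rank of the values `T x y` on that subspace. -/
def quadRank (s : ℕ) : ℕ := (8 * (s + 1) + 6) * ((8 * (s + 2) + 6) * (s + 2))

lemma exists_subspace_slices [Fintype V]
    (T : V →ₗ[ZMod p] V →ₗ[ZMod p] V →ₗ[ZMod p] V →ₗ[ZMod p] ZMod p) (s : ℕ)
    (h : Fintype.card V * (Fintype.card V * Fintype.card V) ≤
      p ^ s * ∑ x, ∑ y, Fintype.card (LinearMap.ker (T x y))) :
    ∃ H : Submodule (ZMod p) V, finrank (ZMod p) V ≤ finrank (ZMod p) H + 2 * (s + 1) ∧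
      ∀ x ∈ H, ∃ N : Submodule (ZMod p) V,
        finrank (ZMod p) V ≤ finrank (ZMod p) N + quadCodim s ∧
        ∀ y ∈ N, finrank (ZMod p) V ≤ finrank (ZMod p) (LinearMap.ker (T x y)) + quadRank s := by
  have : Module.Finite (ZMod p) V := Module.Finite.of_finite
  have hp : 0 < p := (Fact.out : p.Prime).pos
  let N : V → ℕ := fun x => ∑ y, Fintype.card (LinearMap.ker (T x y))
  have hN : ∀ x, N x ≤ Fintype.card V * Fintype.card V := fun x =>
    (Finset.sum_le_card_nsmul _ _ _ fun y _ =>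
      Fintype.card_le_of_injective _ Subtype.val_injective).trans_eq (by
        rw [Finset.card_univ, smul_eq_mul])
  have hNs : ∀ (c : ZMod p) x, N x ≤ N (c • x) := by
    intro c x
    refine Finset.sum_le_sum fun y _ => ?_
    refine Fintype.card_le_of_injective
      (fun w => ⟨w.1, by simp [LinearMap.mem_ker.1 w.2]⟩) fun v w hvw => ?_
    exact Subtype.ext (by simpa using hvw)
  let X : Finset V := {x | Fintype.card V * Fintype.card V ≤ p ^ (s + 1) * N x}
  have hXs : ∀ (c : ZMod p), ∀ v ∈ X, c • v ∈ X := by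
    intro c v hv
    simp only [X, Finset.mem_filter, Finset.mem_univ, true_and] at hv ⊢
    exact hv.trans (Nat.mul_le_mul_left _ (hNs c v))
  have hXc : Fintype.card V ≤ p ^ (s + 1) * #X := card_le_of_sum_ge (p := p) N
    (Fintype.card V * Fintype.card V) s (Nat.mul_pos Fintype.card_pos Fintype.card_pos) hN h
  have hX0 : (0 : V) ∈ X := by
    have hpos : 0 < #X := Nat.pos_of_mul_pos_left (Fintype.card_pos.trans_le hXc)
    obtain ⟨v, hv⟩ := Finset.card_pos.1 hpos
    simpa using hXs 0 v hv
  obtain ⟨H, hH, hsum⟩ := exists_subspace_subset_sum X hX0 hXs (s + 1) hXc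
  have hX : ∀ x ∈ X, ∃ N : Submodule (ZMod p) V,
      finrank (ZMod p) V ≤ finrank (ZMod p) N + 2 * (s + 2) ∧ ∀ y ∈ N, finrank (ZMod p) V ≤
        finrank (ZMod p) (LinearMap.ker (T x y)) + (8 * (s + 2) + 6) * (s + 2) := by
    intro x hx
    simp only [X, Finset.mem_filter, Finset.mem_univ, true_and] at hx
    exact exists_subspace_finrank_ker_ge (T x) (s + 1) hx
  choose! D hD hDr using hX
  refine ⟨H, by omega, fun x hx => ?_⟩
  obtain ⟨y, hy, rfl⟩ := hsum x hx
  refine ⟨Finset.univ.inf fun i => D (y i), ?_, fun v hv => ?_⟩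
  · have := finrank_le_finset_inf Finset.univ (fun i => D (y i)) (2 * (s + 2))
      fun i _ => hD _ (hy i)
    rwa [Finset.card_univ, Fintype.card_fin] at this
  · rw [map_sum, LinearMap.sum_apply]
    exact rankFiltration_finrank_ker.sum fun i =>
      hDr _ (hy i) v (Submodule.mem_finsetInf.1 hv i (Finset.mem_univ i))

/-- The bound on the ranks of all slices `T x y` after passing to a subspace. -/
def uniformRank (s : ℕ) : ℕ := rankLoss (quadCodim s) * quadRank s

lemma exists_subspace_uniform_rank [Fintype V]
    (T : V →ₗ[ZMod p] V →ₗ[ZMod p] V →ₗ[ZMod p] V →ₗ[ZMod p] ZMod p) (s : ℕ)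
    (h : Fintype.card V * (Fintype.card V * Fintype.card V) ≤
      p ^ s * ∑ x, ∑ y, Fintype.card (LinearMap.ker (T x y))) (d : ℕ)
    (hd : 2 * (s + 1) + 6 * quadCodim s + (2 * (3 * quadCodim s) + 1) * d ≤ finrank (ZMod p) V) :
    ∃ W : Submodule (ZMod p) V, finrank (ZMod p) W = d ∧ ∀ x ∈ W, ∀ y ∈ W,
      ∃ N : Submodule (ZMod p) V, finrank (ZMod p) V ≤ finrank (ZMod p) N + uniformRank s ∧
        ∀ z ∈ N, z ∈ W → ∀ w ∈ W, T x y z w = 0 := by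
  have : Module.Finite (ZMod p) V := Module.Finite.of_finite
  obtain ⟨H, hH, hN⟩ := exists_subspace_slices T s h
  obtain ⟨V', γ, hV', hγ⟩ := exists_subspace_approx_family
    (rankFiltration_finrank_ker (p := p) (V := V) (U := V →ₗ[ZMod p] ZMod p))
    (T ∘ₗ H.subtype) (quadCodim s) (quadRank s) fun x => hN x x.2
  have hHV := finrank_le_inf hH hV'
  obtain ⟨W, hW, hWd, hWγ⟩ := exists_isotropic_subspace γ (H ⊓ V') d (by
    rw [Fintype.card_fin]; omega)
  refine ⟨W, hWd, fun x hx y hy => ?_⟩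
  obtain ⟨c, hc⟩ := hγ ⟨x, (hW hx).1⟩ y (hW hy).2
  refine ⟨_, hc, fun z hz hzW w hw => ?_⟩
  have h1 := LinearMap.congr_fun (LinearMap.mem_ker.1 hz) w
  have h2 : (∑ i, c i • γ i) z w = 0 := by
    simp only [LinearMap.sum_apply, LinearMap.smul_apply]
    exact Finset.sum_eq_zero fun i _ => by rw [hWγ i z hzW w hw, smul_zero]
  rw [LinearMap.sub_apply, LinearMap.sub_apply, h2, sub_zero] at h1
  exact h1

/-- A symmetric quadrilinear form with many zeros vanishes on a subspace of proportional
dimension. -/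
theorem exists_subspace_quadrilinear_eq_zero [Fintype V]
    (T : V →ₗ[ZMod p] V →ₗ[ZMod p] V →ₗ[ZMod p] V →ₗ[ZMod p] ZMod p)
    (h₁ : ∀ x y z w, T x y z w = T x z y w) (h₂ : ∀ x y z w, T x y z w = T x y w z) (s : ℕ)
    (h : Fintype.card V * (Fintype.card V * Fintype.card V) ≤
      p ^ s * ∑ x, ∑ y, Fintype.card (LinearMap.ker (T x y))) (k : ℕ)
    (hk : 2 * (s + 1) + 6 * quadCodim s + (2 * (3 * quadCodim s) + 1) *
      (6 * sliceRank (uniformRank s) + (2 * (3 * sliceRank (uniformRank s)) + 1) * k) ≤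
        finrank (ZMod p) V) :
    ∃ W : Submodule (ZMod p) V, finrank (ZMod p) W = k ∧
      ∀ x ∈ W, ∀ y ∈ W, ∀ z ∈ W, ∀ w ∈ W, T x y z w = 0 := by
  have : Module.Finite (ZMod p) V := Module.Finite.of_finite
  obtain ⟨W, hWd, hW⟩ := exists_subspace_uniform_rank T s h _ hk
  let T' : W →ₗ[ZMod p] W →ₗ[ZMod p] W →ₗ[ZMod p] W →ₗ[ZMod p] ZMod p :=
    sandwich W.subtype (sandwich W.subtype (sandwich W.subtype LinearMap.id)) ∘ₗ T ∘ₗ W.subtype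
  have hT' : ∀ x y z w, T' x y z w = T x y z w := fun _ _ _ _ => rfl
  obtain ⟨W', hWd', hW'⟩ := exists_subspace_eq_zero_of_slices T'
    (fun x y z w => by rw [hT', hT', h₁]) (fun x y z w => by rw [hT', hT', h₂]) (uniformRank s)
    (fun x y => by
      obtain ⟨N, hN, hN0⟩ := hW x x.2 y y.2
      refine (finrank_le_comap_subtype hN W).trans
        (Nat.add_le_add_right (Submodule.finrank_mono ?_) _)
      intro z hz
      rw [LinearMap.mem_ker]
      ext w
      exact hN0 z hz z.2 w w.2) k hWd.ge
  refine ⟨W'.map W.subtype, by rw [Submodule.finrank_map_subtype_eq, hWd'], ?_⟩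
  rintro _ ⟨x, hx, rfl⟩ _ ⟨y, hy, rfl⟩ _ ⟨z, hz, rfl⟩ _ ⟨w, hw, rfl⟩
  exact hW' x hx y hy z hz w hw

end Quadrilinear

section FiniteDifference

open Finset fwdDiff

variable {M M' R : Type*} [AddCommGroup M] [AddCommGroup M'] [CommRing R]

/-- `DegLT d g` says that all `d`-fold finite differences of `g` vanish. -/
def DegLT : ℕ → (M → R) → Prop
  | 0, g => g = 0
  | d + 1, g => ∀ h, DegLT d (fwdDiff h g)

namespace DegLT

lemma zero (d : ℕ) : DegLT d (0 : M → R) := by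
  induction d with
  | zero => exact rfl
  | succ d ih =>
    intro h
    have : fwdDiff h (0 : M → R) = 0 := by ext; simp [fwdDiff]
    rwa [this]

lemma add {d : ℕ} {f g : M → R} (hf : DegLT d f) (hg : DegLT d g) : DegLT d (f + g) := by
  induction d generalizing f g with
  | zero => rw [show f = 0 from hf, show g = 0 from hg, add_zero]; exact zero 0
  | succ d ih => intro h; rw [fwdDiff_add]; exact ih (hf h) (hg h)

lemma succ {d : ℕ} {f : M → R} (hf : DegLT d f) : DegLT (d + 1) f := by
  induction d generalizing f with
  | zero => rw [show f = 0 from hf]; exact zero 1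
  | succ d ih => exact fun h => ih (hf h)

lemma mono {d e : ℕ} (hde : d ≤ e) {f : M → R} (hf : DegLT d f) : DegLT e f := by
  induction hde with
  | refl => exact hf
  | step _ ih => exact ih.succ

lemma sum {ι : Type*} (t : Finset ι) {d : ℕ} {f : ι → M → R} (hf : ∀ i ∈ t, DegLT d (f i)) :
    DegLT d (∑ i ∈ t, f i) := by
  induction t using Finset.induction_on with
  | empty => exact zero d
  | insert i t hi ih =>
    rw [Finset.sum_insert hi]
    exact (hf i (Finset.mem_insert_self _ _)).add
      (ih fun j hj => hf j (Finset.mem_insert_of_mem hj))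

lemma comp {d : ℕ} {f : M → R} (hf : DegLT d f) (φ : M' →+ M) (x : M) :
    DegLT d fun y => f (x + φ y) := by
  induction d generalizing f with
  | zero => rw [show f = 0 from hf]; exact zero 0
  | succ d ih =>
    intro h
    have := ih (hf (φ h))
    convert this using 1
    ext y
    simp [fwdDiff, add_assoc]

lemma mul {d a b : ℕ} (hab : a + b ≤ d + 1) {f g : M → R} (hf : DegLT a f) (hg : DegLT b g) :
    DegLT d (f * g) := by
  induction d generalizing a b f g with
  | zero =>
    rcases Nat.eq_zero_or_pos a with rfl | ha
    · rw [show f = 0 from hf, zero_mul]; exact zero 0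
    · obtain rfl : b = 0 := by omega
      rw [show g = 0 from hg, mul_zero]; exact zero 0
  | succ d ih =>
    rcases a with _ | a
    · rw [show f = 0 from hf, zero_mul]; exact zero _
    rcases b with _ | b
    · rw [show g = 0 from hg, mul_zero]; exact zero _
    intro h
    have h1 : DegLT d (fwdDiff h f * fun x => g (h + x)) :=
      ih (by omega) (hf h) (hg.comp (AddMonoidHom.id M) h)
    have h2 : DegLT d (f * fwdDiff h g) := ih (by omega) hf (hg h)
    convert h1.add h2 using 1
    ext x
    simp only [fwdDiff, Pi.mul_apply, Pi.add_apply, add_comm h x]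
    ring

lemma const (c : R) : DegLT 1 fun _ : M => c := by
  intro h
  exact fwdDiff_const h c

lemma pow {f : M → R} (hf : DegLT 2 f) (n : ℕ) : DegLT (n + 1) (f ^ n) := by
  induction n with
  | zero => rw [pow_zero]; exact const 1
  | succ n ih => rw [pow_succ]; exact mul (by omega) ih hf

lemma prod {ι : Type*} (t : Finset ι) (a : ι → ℕ) {f : ι → M → R}
    (hf : ∀ i ∈ t, DegLT (a i + 1) (f i)) : DegLT (∑ i ∈ t, a i + 1) (∏ i ∈ t, f i) := by
  induction t using Finset.induction_on with
  | empty => exact const 1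
  | insert i t hi ih =>
    rw [Finset.prod_insert hi, Finset.sum_insert hi]
    exact mul (by omega) (hf i (Finset.mem_insert_self _ _))
      (ih fun j hj => hf j (Finset.mem_insert_of_mem hj))

lemma eval {n d : ℕ} (f : MvPolynomial (Fin n) R) (hf : f.totalDegree ≤ d) :
    DegLT (d + 1) fun x => MvPolynomial.eval x f := by
  have h1 : (fun x => MvPolynomial.eval x f) = ∑ m ∈ f.support,
      ((fun _ => f.coeff m) * ∏ i ∈ m.support, (fun x : Fin n → R => x i) ^ m i) := by
    ext x
    simp [MvPolynomial.eval_eq]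
  rw [h1]
  refine sum _ fun m hm => ?_
  refine mul (a := 1) (b := d + 1) (by omega) (const _) ?_
  refine mono ?_ (prod m.support m fun i _ => pow (fun h => ?_) (m i))
  · exact Nat.add_le_add_right ((MvPolynomial.le_totalDegree hm).trans hf) 1
  · convert const (h i) using 1
    ext x
    simp [fwdDiff]

lemma eq_apply_zero {f : M → R} (hf : DegLT 1 f) (x : M) : f x = f 0 := by
  have := congrFun (show fwdDiff x f = 0 from hf x) 0
  rw [fwdDiff, zero_add] at this
  exact sub_eq_zero.1 this

end DegLT

lemma fwdDiff_add_step (h k : M) (f : M → R) :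
    fwdDiff (h + k) f = fwdDiff h f + fwdDiff k f + fwdDiff k (fwdDiff h f) := by
  ext x
  simp only [fwdDiff, Pi.add_apply, add_assoc, add_comm h k]
  ring

lemma fwdDiff_comm (h k : M) (f : M → R) :
    fwdDiff h (fwdDiff k f) = fwdDiff k (fwdDiff h f) := by
  ext x
  simp only [fwdDiff, add_assoc, add_comm h k]
  ring

end FiniteDifference

section TopForm

variable {p : ℕ} [Fact p.Prime] {V : Type*} [AddCommGroup V] [Module (ZMod p) V]

/-- An additive function between vector spaces over `ZMod p` is linear. -/
def linearMapOfAdd {U : Type*} [AddCommMonoid U] [Module (ZMod p) U] (φ : V → U)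
    (h : ∀ x y, φ (x + y) = φ x + φ y) : V →ₗ[ZMod p] U :=
  letI : AddCommGroup U := Module.addCommMonoidToAddCommGroup (ZMod p)
  (AddMonoidHom.mk' φ h).toZModLinearMap p

/-- The linear part of a polynomial of degree at most one. -/
def linearForm (f : V → ZMod p) (hf : DegLT 2 f) : V →ₗ[ZMod p] ZMod p :=
  linearMapOfAdd (fun h => fwdDiff h f 0) fun h k => by
    have := congrFun (show fwdDiff k (fwdDiff h f) = 0 from hf h k) 0
    simp [fwdDiff_add_step, this]

lemma linearForm_apply (f : V → ZMod p) (hf : DegLT 2 f) (h : V) :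
    linearForm f hf h = fwdDiff h f 0 := rfl

/-- The bilinear form of a polynomial of degree at most two. -/
def bilinearForm (f : V → ZMod p) (hf : DegLT 3 f) : V →ₗ[ZMod p] V →ₗ[ZMod p] ZMod p :=
  linearMapOfAdd (fun h => linearForm (fwdDiff h f) (hf h)) fun h k => by
    ext x
    have := congrFun (show fwdDiff x (fwdDiff k (fwdDiff h f)) = 0 from hf h k x) 0
    simp [linearForm_apply, fwdDiff_add_step h k, fwdDiff_add, this]

lemma bilinearForm_apply (f : V → ZMod p) (hf : DegLT 3 f) (h : V) :
    bilinearForm f hf h = linearForm (fwdDiff h f) (hf h) := rfl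

/-- The trilinear form of a polynomial of degree at most three. -/
def trilinearForm (f : V → ZMod p) (hf : DegLT 4 f) :
    V →ₗ[ZMod p] V →ₗ[ZMod p] V →ₗ[ZMod p] ZMod p :=
  linearMapOfAdd (fun h => bilinearForm (fwdDiff h f) (hf h)) fun h k => by
    ext x y
    have := congrFun (show fwdDiff y (fwdDiff x (fwdDiff k (fwdDiff h f))) = 0
      from hf h k x y) 0
    simp [bilinearForm_apply, linearForm_apply, fwdDiff_add_step h k, fwdDiff_add,
      this]

lemma trilinearForm_apply (f : V → ZMod p) (hf : DegLT 4 f) (h : V) :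
    trilinearForm f hf h = bilinearForm (fwdDiff h f) (hf h) := rfl

/-- The quadrilinear form of a polynomial of degree at most four. -/
def quadrilinearForm (f : V → ZMod p) (hf : DegLT 5 f) :
    V →ₗ[ZMod p] V →ₗ[ZMod p] V →ₗ[ZMod p] V →ₗ[ZMod p] ZMod p :=
  linearMapOfAdd (fun h => trilinearForm (fwdDiff h f) (hf h)) fun h k => by
    ext x y z
    have := congrFun (show fwdDiff z (fwdDiff y (fwdDiff x (fwdDiff k (fwdDiff h f)))) = 0
      from hf h k x y z) 0
    simp [trilinearForm_apply, bilinearForm_apply, linearForm_apply, fwdDiff_add_step h k,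
      fwdDiff_add, this]

lemma quadrilinearForm_apply (f : V → ZMod p) (hf : DegLT 5 f) (h : V) :
    quadrilinearForm f hf h = trilinearForm (fwdDiff h f) (hf h) := rfl

lemma degLT_one_restrict (f : V → ZMod p) (hf : DegLT 2 f) (W : Submodule (ZMod p) V)
    (hW : ∀ x ∈ W, linearForm f hf x = 0) (u : V) :
    DegLT 1 fun w : W => f (u + w) := by
  intro a
  ext w
  have := (hf a).eq_apply_zero (u + w)
  rw [← linearForm_apply f hf, hW a a.2] at this
  simpa [fwdDiff, add_assoc] using this

lemma degLT_two_restrict (f : V → ZMod p) (hf : DegLT 3 f) (W : Submodule (ZMod p) V)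
    (hW : ∀ x ∈ W, ∀ y ∈ W, bilinearForm f hf x y = 0) (u : V) :
    DegLT 2 fun w : W => f (u + w) := by
  intro a
  convert degLT_one_restrict (fwdDiff (a : V) f) (hf a) W (fun y hy => hW a a.2 y hy) u using 1
  ext w
  simp [fwdDiff, add_assoc]

lemma degLT_three_restrict (f : V → ZMod p) (hf : DegLT 4 f) (W : Submodule (ZMod p) V)
    (hW : ∀ x ∈ W, ∀ y ∈ W, ∀ z ∈ W, trilinearForm f hf x y z = 0) (u : V) :
    DegLT 3 fun w : W => f (u + w) := by
  intro a
  convert degLT_two_restrict (fwdDiff (a : V) f) (hf a) W (fun y hy => hW a a.2 y hy) u using 1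
  ext w
  simp [fwdDiff, add_assoc]

lemma degLT_four_restrict (f : V → ZMod p) (hf : DegLT 5 f) (W : Submodule (ZMod p) V)
    (hW : ∀ x ∈ W, ∀ y ∈ W, ∀ z ∈ W, ∀ w ∈ W, quadrilinearForm f hf x y z w = 0) (u : V) :
    DegLT 4 fun w : W => f (u + w) := by
  intro a
  convert degLT_three_restrict (fwdDiff (a : V) f) (hf a) W (fun y hy => hW a a.2 y hy) u using 1
  ext w
  simp [fwdDiff, add_assoc]

end TopForm

section CharacterSum

open Module Finset

variable {p : ℕ} [Fact p.Prime]

/-- The character sum of a function with values in `ZMod p`. -/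
noncomputable def charSum {ι : Type*} [Fintype ι] (f : ι → ZMod p) : ℂ := ∑ x, ZMod.stdAddChar (f x)

lemma norm_charSum_sq_le {V : Type*} [AddCommGroup V] [Fintype V] (f : V → ZMod p) :
    ‖charSum f‖ ^ 2 ≤ ∑ h, ‖charSum (fwdDiff h f)‖ := by
  have h1 : ((‖charSum f‖ ^ 2 : ℝ) : ℂ) = ∑ h, charSum (fwdDiff h f) := by
    push_cast
    rw [← Complex.conj_mul']
    simp only [charSum, map_sum, Finset.sum_mul_sum, fwdDiff]
    rw [Finset.sum_comm (s := Finset.univ (α := V))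
      (f := fun h x => (ZMod.stdAddChar (f (x + h) - f x) : ℂ))]
    refine Finset.sum_congr rfl fun x _ => ?_
    rw [← Equiv.sum_comp (Equiv.addLeft x)]
    refine Finset.sum_congr rfl fun h _ => ?_
    rw [← AddChar.map_neg_eq_conj, ← AddChar.map_add_eq_mul, Equiv.coe_addLeft, neg_add_eq_sub]
  have h2 : ‖charSum f‖ ^ 2 = ‖((‖charSum f‖ ^ 2 : ℝ) : ℂ)‖ := by
    rw [Complex.norm_real, Real.norm_of_nonneg (by positivity)]
  rw [h2, h1]
  exact norm_sum_le _ _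

lemma norm_charSum_pow_le {V : Type*} [AddCommGroup V] [Fintype V] (f : V → ZMod p) (n : ℕ) :
    ‖charSum f‖ ^ (2 * (n + 1)) ≤
      (Fintype.card V : ℝ) ^ n * ∑ h, ‖charSum (fwdDiff h f)‖ ^ (n + 1) := by
  have hV : (0 : ℝ) < Fintype.card V := by exact_mod_cast Fintype.card_pos
  have h1 := pow_sum_div_card_le_sum_pow (s := Finset.univ)
    (f := fun h => ‖charSum (fwdDiff h f)‖) (fun _ _ => norm_nonneg _) n
  rw [div_le_iff₀' (by rw [Finset.card_univ]; positivity), Finset.card_univ] at h1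
  rw [pow_mul]
  exact (pow_le_pow_left₀ (by positivity) (norm_charSum_sq_le f) _).trans h1

lemma norm_charSum_le_card {ι : Type*} [Fintype ι] (f : ι → ZMod p) :
    ‖charSum f‖ ≤ Fintype.card ι := by
  refine (norm_sum_le _ _).trans ?_
  simp

/-- `f` has bias at least `p ^ (-N)`. -/
def Biased {ι : Type*} [Fintype ι] (N : ℕ) (f : ι → ZMod p) : Prop :=
  (Fintype.card ι : ℝ) ≤ p ^ N * ‖charSum f‖

lemma Biased.pow_le {V : Type*} [Fintype V] [Nonempty V] {N : ℕ} {f : V → ZMod p} (hf : Biased N f) {m j : ℕ} {c : ℝ}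
    (h : ‖charSum f‖ ^ (m + j) ≤ (Fintype.card V : ℝ) ^ j * c) :
    (Fintype.card V : ℝ) ^ m ≤ p ^ ((m + j) * N) * c := by
  have hV : (0 : ℝ) < Fintype.card V := by exact_mod_cast Fintype.card_pos
  have h1 := pow_le_pow_left₀ hV.le hf (m + j)
  rw [mul_pow, ← pow_mul, mul_comm N] at h1
  have h2 := h1.trans (mul_le_mul_of_nonneg_left h (by positivity))
  rw [pow_add] at h2
  refine le_of_mul_le_mul_right ?_ (pow_pos hV j)
  linarith

variable {V : Type*} [AddCommGroup V] [Module (ZMod p) V] [Fintype V]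

lemma charSum_eq_zero_of_degLT_two (f : V → ZMod p) (hf : DegLT 2 f)
    (h : linearForm f hf ≠ 0) : charSum f = 0 := by
  obtain ⟨v, hv⟩ : ∃ v, linearForm f hf v ≠ 0 := by
    by_contra! h0
    exact h (LinearMap.ext h0)
  have h1 : charSum f = ZMod.stdAddChar (linearForm f hf v) * charSum f := by
    conv_lhs => rw [charSum, ← Equiv.sum_comp (Equiv.addRight v)]
    rw [charSum, Finset.mul_sum]
    refine Finset.sum_congr rfl fun x _ => ?_
    rw [← AddChar.map_add_eq_mul, linearForm_apply, ← (hf v).eq_apply_zero x, fwdDiff,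
      Equiv.coe_addRight, sub_add_cancel]
  have h2 : (ZMod.stdAddChar (linearForm f hf v) : ℂ) ≠ 1 := fun h3 =>
    hv (ZMod.injective_stdAddChar (h3.trans (AddChar.map_zero_eq_one _).symm))
  have h3 : (1 - (ZMod.stdAddChar (linearForm f hf v) : ℂ)) * charSum f = 0 := by
    rw [sub_mul, one_mul, ← h1, sub_self]
  exact (mul_eq_zero.1 h3).resolve_left (sub_ne_zero.2 h2.symm)

lemma norm_charSum_pow_two_le (f : V → ZMod p) (hf : DegLT 3 f) :
    ‖charSum f‖ ^ 2 ≤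
      (Fintype.card V : ℝ) * Fintype.card (LinearMap.ker (bilinearForm f hf)) := by
  refine (norm_charSum_sq_le f).trans ?_
  have h1 : ∀ h, ‖charSum (fwdDiff h f)‖ ≤
      if h ∈ LinearMap.ker (bilinearForm f hf) then (Fintype.card V : ℝ) else 0 := by
    intro h
    split_ifs with hh
    · exact norm_charSum_le_card _
    · rw [charSum_eq_zero_of_degLT_two _ (hf h) hh, norm_zero]
  refine (Finset.sum_le_sum fun h _ => h1 h).trans_eq ?_
  rw [← Finset.sum_filter, Finset.sum_const, nsmul_eq_mul, mul_comm, Fintype.card_subtype]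

lemma norm_charSum_pow_four_le (f : V → ZMod p) (hf : DegLT 4 f) :
    ‖charSum f‖ ^ 4 ≤ (Fintype.card V : ℝ) ^ 2 *
      ∑ x, (Fintype.card (LinearMap.ker (trilinearForm f hf x)) : ℝ) := by
  refine (norm_charSum_pow_le f 1).trans ?_
  rw [pow_one, sq (Fintype.card V : ℝ), mul_assoc]
  refine mul_le_mul_of_nonneg_left ?_ (by positivity)
  rw [Finset.mul_sum]
  refine Finset.sum_le_sum fun h _ => ?_
  exact norm_charSum_pow_two_le (fwdDiff h f) (hf h)

lemma norm_charSum_pow_eight_le (f : V → ZMod p) (hf : DegLT 5 f) :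
    ‖charSum f‖ ^ 8 ≤ (Fintype.card V : ℝ) ^ 5 *
      ∑ x, ∑ y, (Fintype.card (LinearMap.ker (quadrilinearForm f hf x y)) : ℝ) := by
  refine (norm_charSum_pow_le f 3).trans ?_
  rw [show (5 : ℕ) = 3 + 2 from rfl, pow_add (Fintype.card V : ℝ) 3 2, mul_assoc]
  refine mul_le_mul_of_nonneg_left ?_ (by positivity)
  rw [Finset.mul_sum]
  refine Finset.sum_le_sum fun h _ => ?_
  exact norm_charSum_pow_four_le (fwdDiff h f) (hf h)

lemma Biased.exists_restrict {N : ℕ} {f : V → ZMod p} (hf : Biased N f)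
    (W : Submodule (ZMod p) V) : ∃ u : V, Biased N fun w : W => f (u + w) := by
  by_contra! h
  have h1 : ∑ u, charSum (fun w : W => f (u + w)) = Fintype.card W * charSum f := by
    simp only [charSum]
    rw [Finset.sum_comm, ← nsmul_eq_mul, ← Finset.card_univ, ← Finset.sum_const]
    exact Finset.sum_congr rfl fun w _ =>
      Equiv.sum_comp (Equiv.addRight (w : V)) fun x => (ZMod.stdAddChar (f x) : ℂ)
  have h2 : ∑ u : V, (p ^ N * ‖charSum (fun w : W => f (u + w))‖ : ℝ) <
      ∑ _u : V, (Fintype.card W : ℝ) :=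
    Finset.sum_lt_sum_of_nonempty Finset.univ_nonempty fun u _ => not_le.1 (h u)
  rw [← Finset.mul_sum, Finset.sum_const, Finset.card_univ, nsmul_eq_mul] at h2
  have h3 := norm_sum_le Finset.univ fun u : V => charSum (fun w : W => f (u + w))
  rw [h1, norm_mul, Complex.norm_natCast] at h3
  have h4 : (0 : ℝ) < p ^ N := by
    have := (Fact.out : p.Prime).pos
    positivity
  have h5 := mul_le_mul_of_nonneg_left h3 h4.le
  have h6 := mul_le_mul_of_nonneg_left hf (Nat.cast_nonneg (α := ℝ) (Fintype.card W))
  linarith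

end CharacterSum

section Descent

open Module Finset

variable {p : ℕ} [Fact p.Prime] {V : Type*} [AddCommGroup V] [Module (ZMod p) V]

lemma quadrilinearForm_comm_middle (f : V → ZMod p) (hf : DegLT 5 f) (x y z w : V) :
    quadrilinearForm f hf x y z w = quadrilinearForm f hf x z y w := by
  simp only [quadrilinearForm_apply, trilinearForm_apply, bilinearForm_apply, linearForm_apply]
  rw [fwdDiff_comm z y]

lemma quadrilinearForm_comm_right (f : V → ZMod p) (hf : DegLT 5 f) (x y z w : V) :
    quadrilinearForm f hf x y z w = quadrilinearForm f hf x y w z := by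
  simp only [quadrilinearForm_apply, trilinearForm_apply, bilinearForm_apply, linearForm_apply]
  rw [fwdDiff_comm w z]

/-- `f` is constant on a translate of a subspace of dimension at least `k`. -/
def ConstantOnCoset (k : ℕ) (f : V → ZMod p) : Prop :=
  ∃ (u : V) (W : Submodule (ZMod p) V), k ≤ finrank (ZMod p) W ∧ ∀ w ∈ W, f (u + w) = f u

lemma ConstantOnCoset.of_restrict {k : ℕ} {f : V → ZMod p} {u : V} {W : Submodule (ZMod p) V}
    (h : ConstantOnCoset k fun w : W => f (u + w)) : ConstantOnCoset k f := by
  obtain ⟨u', W', hW', hf⟩ := h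
  refine ⟨u + u', W'.map W.subtype, by rwa [Submodule.finrank_map_subtype_eq], ?_⟩
  rintro _ ⟨w, hw, rfl⟩
  simpa [add_assoc] using hf w hw

/-- The dimension that guarantees a constant coset for a cubic of bias `p ^ (-N)`. -/
def cubicDim (N k : ℕ) : ℕ :=
  2 * (4 * N + 1) + 9 * ((8 * (4 * N + 1) + 6) * (4 * N + 1)) + (2 * N + k)

/-- The dimension that guarantees a constant coset for a quartic of bias `p ^ (-N)`. -/
def quarticDim (N k : ℕ) : ℕ :=
  2 * (8 * N + 1) + 6 * quadCodim (8 * N) + (2 * (3 * quadCodim (8 * N)) + 1) *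
    (6 * sliceRank (uniformRank (8 * N)) +
      (2 * (3 * sliceRank (uniformRank (8 * N))) + 1) * cubicDim N k)

variable [Fintype V] {N k : ℕ} {f : V → ZMod p}

lemma constantOnCoset_of_degLT_two (hf : DegLT 2 f) (hN : Biased N f)
    (hk : k ≤ finrank (ZMod p) V) : ConstantOnCoset k f := by
  have h0 : linearForm f hf = 0 := by
    by_contra h
    have hV : (0 : ℝ) < Fintype.card V := by exact_mod_cast Fintype.card_pos
    rw [Biased, charSum_eq_zero_of_degLT_two f hf h, norm_zero, mul_zero] at hN
    exact hN.not_gt hV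
  refine ⟨0, ⊤, by rwa [finrank_top], fun w _ => ?_⟩
  have h1 : fwdDiff w f 0 = 0 := LinearMap.congr_fun h0 w
  simpa [fwdDiff, sub_eq_zero] using h1

lemma constantOnCoset_of_degLT_three (hf : DegLT 3 f) (hN : Biased N f)
    (hk : 2 * N + k ≤ finrank (ZMod p) V) : ConstantOnCoset k f := by
  have h1 := hN.pow_le (m := 1) (j := 1)
    (by rw [pow_one]; exact norm_charSum_pow_two_le f hf)
  rw [pow_one] at h1
  have h2 := finrank_le_of_card_le (LinearMap.ker (bilinearForm f hf)) ((1 + 1) * N)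
    (by exact_mod_cast h1)
  obtain ⟨u, hu⟩ := hN.exists_restrict (LinearMap.ker (bilinearForm f hf))
  refine ConstantOnCoset.of_restrict (u := u) (constantOnCoset_of_degLT_two
    (degLT_two_restrict f hf _ (fun x hx y _ => ?_) u) hu (by omega))
  rw [LinearMap.mem_ker.1 hx, LinearMap.zero_apply]

lemma constantOnCoset_of_degLT_four (hf : DegLT 4 f) (hN : Biased N f)
    (hk : cubicDim N k ≤ finrank (ZMod p) V) : ConstantOnCoset k f := by
  have h1 := hN.pow_le (m := 2) (j := 2) (norm_charSum_pow_four_le f hf)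
  rw [sq] at h1
  obtain ⟨W, hW, hT⟩ := exists_subspace_trilinear_eq_zero (trilinearForm f hf) (4 * N)
    (by exact_mod_cast h1)
  obtain ⟨u, hu⟩ := hN.exists_restrict W
  refine ConstantOnCoset.of_restrict (u := u) (constantOnCoset_of_degLT_three
    (degLT_three_restrict f hf W hT u) hu ?_)
  unfold cubicDim at hk
  omega

theorem constantOnCoset_of_degLT_five (hf : DegLT 5 f) (hN : Biased N f)
    (hk : quarticDim N k ≤ finrank (ZMod p) V) : ConstantOnCoset k f := by
  have h1 := hN.pow_le (m := 3) (j := 5) (norm_charSum_pow_eight_le f hf)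
  rw [pow_three] at h1
  obtain ⟨W, hW, hT⟩ := exists_subspace_quadrilinear_eq_zero (quadrilinearForm f hf)
    (quadrilinearForm_comm_middle f hf) (quadrilinearForm_comm_right f hf) (8 * N)
    (by exact_mod_cast h1) (cubicDim N k) hk
  obtain ⟨u, hu⟩ := hN.exists_restrict W
  exact ConstantOnCoset.of_restrict (u := u) (constantOnCoset_of_degLT_four
    (degLT_four_restrict f hf W hT u) hu hW.ge)

end Descent

section Growth

lemma rankLoss_le_exp (ρ : ℕ) : (rankLoss ρ : ℝ) ≤ Real.exp (100 * √ρ) := by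
  induction ρ using Nat.strong_induction_on with
  | _ ρ ih =>
    rcases Nat.eq_zero_or_pos ρ with rfl | hρ
    · simp [rankLoss]
    have h1 : (1 : ℝ) ≤ ρ := by exact_mod_cast hρ
    have h2 : √((2 * ρ / 3 : ℕ) : ℝ) ≤ 41 / 50 * √ρ := by
      rw [Real.sqrt_le_left (by positivity), mul_pow, Real.sq_sqrt (by positivity)]
      have h3 : ((2 * ρ / 3 : ℕ) : ℝ) ≤ ((2 * ρ : ℕ) : ℝ) / (3 : ℕ) := Nat.cast_div_le
      push_cast at h3
      linarith
    have h4 : (8 * ρ + 10 : ℝ) ≤ Real.exp (18 * √ρ) := by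
      have h5 := Real.quadratic_le_exp_of_nonneg (x := 18 * √ρ) (by positivity)
      rw [mul_pow, Real.sq_sqrt (by positivity)] at h5
      have h6 : 0 ≤ √(ρ : ℝ) := by positivity
      linarith
    rw [rankLoss_of_pos hρ]
    push_cast
    calc (8 * ρ + 10 : ℝ) * rankLoss (2 * ρ / 3)
        ≤ Real.exp (18 * √ρ) * Real.exp (100 * (41 / 50 * √ρ)) := by
          refine mul_le_mul h4 ((ih _ (by omega)).trans (Real.exp_le_exp.2 ?_))
            (by positivity) (by positivity)
          linarith
      _ = Real.exp (100 * √ρ) := by rw [← Real.exp_add]; ring_nf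

/-- `g` grows at most exponentially. -/
def ExpBounded (g : ℕ → ℕ) : Prop := ∃ a, ∀ N, g N ≤ 2 ^ (a * (N + 1))

namespace ExpBounded

lemma const (c : ℕ) : ExpBounded fun _ => c :=
  ⟨c, fun N => Nat.lt_two_pow_self.le.trans
    (Nat.pow_le_pow_right two_pos (Nat.le_mul_of_pos_right _ N.succ_pos))⟩

lemma id : ExpBounded fun N => N :=
  ⟨1, fun N => by
    rw [one_mul]
    exact Nat.lt_two_pow_self.le.trans (Nat.pow_le_pow_right two_pos N.le_succ)⟩

lemma mul {f g : ℕ → ℕ} (hf : ExpBounded f) (hg : ExpBounded g) :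
    ExpBounded fun N => f N * g N := by
  obtain ⟨a, ha⟩ := hf
  obtain ⟨b, hb⟩ := hg
  refine ⟨a + b, fun N => ?_⟩
  rw [add_mul, pow_add]
  exact Nat.mul_le_mul (ha N) (hb N)

lemma add {f g : ℕ → ℕ} (hf : ExpBounded f) (hg : ExpBounded g) :
    ExpBounded fun N => f N + g N := by
  obtain ⟨a, ha⟩ := hf
  obtain ⟨b, hb⟩ := hg
  refine ⟨a + b + 1, fun N => ?_⟩
  have h1 : 2 ^ (a * (N + 1)) ≤ 2 ^ ((a + b) * (N + 1)) :=
    Nat.pow_le_pow_right two_pos (Nat.mul_le_mul_right _ (by omega))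
  have h2 : 2 ^ (b * (N + 1)) ≤ 2 ^ ((a + b) * (N + 1)) :=
    Nat.pow_le_pow_right two_pos (Nat.mul_le_mul_right _ (by omega))
  have h3 : 2 ^ ((a + b) * (N + 1)) * 2 ≤ 2 ^ ((a + b + 1) * (N + 1)) := by
    rw [← pow_succ]
    exact Nat.pow_le_pow_right two_pos (by rw [add_mul _ 1]; omega)
  have h4 := ha N
  have h5 := hb N
  dsimp only
  omega

end ExpBounded

lemma quadCodim_le (N : ℕ) : quadCodim (8 * N) ≤ 1600 * (N + 1) ^ 2 := by
  unfold quadCodim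
  nlinarith

lemma expBounded_rankLoss : ExpBounded fun N => rankLoss (quadCodim (8 * N)) := by
  refine ⟨8000, fun N => ?_⟩
  have h1 : √(quadCodim (8 * N) : ℝ) ≤ 40 * (N + 1) := by
    rw [Real.sqrt_le_left (by positivity)]
    calc (quadCodim (8 * N) : ℝ) ≤ ((1600 * (N + 1) ^ 2 : ℕ) : ℝ) := by
          exact_mod_cast quadCodim_le N
      _ = (40 * (N + 1)) ^ 2 := by push_cast; ring
  have h2 : (rankLoss (quadCodim (8 * N)) : ℝ) ≤ 2 ^ (8000 * (N + 1)) := by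
    calc (rankLoss (quadCodim (8 * N)) : ℝ) ≤ Real.exp (100 * √(quadCodim (8 * N) : ℝ)) :=
          rankLoss_le_exp _
      _ ≤ Real.exp ((4000 * (N + 1) : ℕ) * 1) := by
          refine Real.exp_le_exp.2 ?_
          push_cast
          linarith
      _ = Real.exp 1 ^ (4000 * (N + 1)) := by rw [Real.exp_nat_mul]
      _ ≤ (2 ^ 2) ^ (4000 * (N + 1)) := by
          refine pow_le_pow_left₀ (Real.exp_pos 1).le ?_ _
          have := Real.exp_one_lt_d9
          norm_num
          linarith
      _ = _ := by
          rw [← pow_mul, ← mul_assoc, show 2 * 4000 = 8000 from rfl]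
  exact_mod_cast h2

lemma expBounded_quarticDim : ExpBounded fun N => quarticDim N 1 := by
  have hc := ExpBounded.const
  have hN := ExpBounded.id
  have h8 : ExpBounded fun N => 8 * N := (hc 8).mul hN
  have h4 : ExpBounded fun N => 4 * N := (hc 4).mul hN
  have hq : ExpBounded fun N => quadCodim (8 * N) :=
    (((hc 8).mul (h8.add (hc 1))).add (hc 6)).mul ((hc 2).mul (h8.add (hc 2)))
  have hr : ExpBounded fun N => quadRank (8 * N) :=
    (((hc 8).mul (h8.add (hc 1))).add (hc 6)).mul
      ((((hc 8).mul (h8.add (hc 2))).add (hc 6)).mul (h8.add (hc 2)))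
  have hu : ExpBounded fun N => uniformRank (8 * N) := expBounded_rankLoss.mul hr
  have h9 := (hc 9).mul hu
  have hs : ExpBounded fun N => sliceRank (uniformRank (8 * N)) := h9.add (h9.mul h9)
  have h41 := h4.add (hc 1)
  have h3 : ExpBounded fun N => cubicDim N 1 :=
    (((hc 2).mul h41).add ((hc 9).mul ((((hc 8).mul h41).add (hc 6)).mul h41))).add
      (((hc 2).mul hN).add (hc 1))
  exact (((hc 2).mul (h8.add (hc 1))).add ((hc 6).mul hq)).add
    ((((hc 2).mul ((hc 3).mul hq)).add (hc 1)).mul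
      (((hc 6).mul hs).add ((((hc 2).mul ((hc 3).mul hs)).add (hc 1)).mul h3)))

lemma quarticDim_le (N : ℕ) {k : ℕ} (hk : 0 < k) : quarticDim N k ≤ k * quarticDim N 1 := by
  have h : ∀ a : ℕ, a ≤ k * a := fun a => Nat.le_mul_of_pos_left a hk
  have h1 : cubicDim N k ≤ k * cubicDim N 1 := by
    unfold cubicDim
    generalize 2 * (4 * N + 1) + 9 * ((8 * (4 * N + 1) + 6) * (4 * N + 1)) = a
    have h2 := h a
    have h3 := h (2 * N)
    rw [mul_add, mul_add, mul_one]
    omega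
  unfold quarticDim
  generalize 2 * (3 * quadCodim (8 * N)) + 1 = b
  generalize sliceRank (uniformRank (8 * N)) = r
  generalize 2 * (8 * N + 1) + 6 * quadCodim (8 * N) = a
  calc a + b * (6 * r + (2 * (3 * r) + 1) * cubicDim N k)
      ≤ k * a + b * (k * (6 * r) + (2 * (3 * r) + 1) * (k * cubicDim N 1)) :=
        Nat.add_le_add (h a) (Nat.mul_le_mul_left _
          (Nat.add_le_add (h _) (Nat.mul_le_mul_left _ h1)))
    _ = _ := by ring

end Growth

section Uniformity

open Finset

variable {p : ℕ} [Fact p.Prime]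

lemma card_filter_mem_sub {ι : Type*} [Fintype ι] (g : ι → ZMod p) (A : Finset (ZMod p)) :
    (p * #{x | g x ∈ A} - Fintype.card ι * #A : ℂ) =
      ∑ a ∈ Finset.univ.erase (0 : ZMod p), ∑ b ∈ A,
        ZMod.stdAddChar (-(a * b)) * charSum fun x => a * g x := by
  have h1 : ∑ a : ZMod p, ∑ b ∈ A, (ZMod.stdAddChar (-(a * b)) * charSum fun x => a * g x : ℂ) =
      p * #{x | g x ∈ A} := by
    have h2 : ∀ a : ZMod p, ∑ b ∈ A,
        (ZMod.stdAddChar (-(a * b)) * charSum fun x => a * g x : ℂ) =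
        ∑ x, ∑ b ∈ A, ZMod.stdAddChar (a * (g x - b)) := by
      intro a
      simp only [charSum]
      rw [Finset.sum_comm]
      refine Finset.sum_congr rfl fun b _ => ?_
      rw [Finset.mul_sum]
      refine Finset.sum_congr rfl fun x _ => ?_
      rw [← AddChar.map_add_eq_mul]
      ring_nf
    rw [Finset.sum_congr rfl fun a _ => h2 a, Finset.sum_comm, Finset.card_filter, Nat.cast_sum,
      Finset.mul_sum]
    refine Finset.sum_congr rfl fun x _ => ?_
    rw [Finset.sum_comm, Finset.sum_congr rfl fun b _ =>
      AddChar.sum_mulShift (g x - b) (ZMod.isPrimitive_stdAddChar p)]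
    simp [sub_eq_zero, ZMod.card]
  rw [← h1, ← Finset.add_sum_erase _ _ (Finset.mem_univ (0 : ZMod p))]
  simp [charSum, mul_comm]

lemma exists_biased {ι : Type*} [Fintype ι] [Nonempty ι] (g : ι → ZMod p) {δ : ℝ} {N : ℕ}
    (hδ : 0 < δ) (hN : p / δ ≤ p ^ N) (A : Finset (ZMod p))
    (h : δ < |(#{x | g x ∈ A} : ℝ) / Fintype.card ι - #A / p|) :
    ∃ a : ZMod p, a ≠ 0 ∧ Biased N fun x => a * g x := by
  by_contra! h0
  have hp : (0 : ℝ) < p := by exact_mod_cast (Fact.out : p.Prime).pos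
  have hι : (0 : ℝ) < Fintype.card ι := by exact_mod_cast Fintype.card_pos
  have h1 : ∀ a : ZMod p, a ≠ 0 → ‖charSum fun x => a * g x‖ ≤ δ / p * Fintype.card ι := by
    intro a ha
    have h2 := not_le.1 (h0 a ha)
    have h3 := (mul_le_mul_of_nonneg_right hN (norm_nonneg (charSum fun x => a * g x))).trans h2.le
    rw [div_mul_eq_mul_div, div_le_iff₀ hδ] at h3
    rw [div_mul_eq_mul_div, le_div_iff₀ hp]
    linarith
  have hA : (#A : ℝ) ≤ p := by
    have := Finset.card_le_univ A
    rw [ZMod.card] at this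
    exact_mod_cast this
  have h4 : ‖(p * #{x | g x ∈ A} - Fintype.card ι * #A : ℂ)‖ ≤ p * (p * (δ / p * Fintype.card ι)) := by
    rw [card_filter_mem_sub]
    refine (norm_sum_le_of_le _ fun a ha => ?_ : _ ≤ ∑ a ∈ Finset.univ.erase (0 : ZMod p),
      p * (δ / p * Fintype.card ι)).trans ?_
    · refine (norm_sum_le_of_le _ fun b _ => ?_ : _ ≤ ∑ b ∈ A, δ / p * Fintype.card ι).trans ?_
      · rw [norm_mul, AddChar.norm_apply, one_mul]
        exact h1 a (Finset.ne_of_mem_erase ha)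
      · rw [Finset.sum_const, nsmul_eq_mul]
        gcongr
    · rw [Finset.sum_const, nsmul_eq_mul]
      gcongr
      have := Finset.card_le_univ (Finset.univ.erase (0 : ZMod p))
      rwa [ZMod.card] at this
  have h5 : (p * #{x | g x ∈ A} - Fintype.card ι * #A : ℂ) =
      ((p * #{x | g x ∈ A} - Fintype.card ι * #A : ℝ) : ℂ) := by push_cast; rfl
  rw [h5, Complex.norm_real, Real.norm_eq_abs] at h4
  have h6 : (#{x | g x ∈ A} : ℝ) / Fintype.card ι - #A / p =
      (p * #{x | g x ∈ A} - Fintype.card ι * #A : ℝ) / (p * Fintype.card ι) := by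
    field_simp
  rw [h6, abs_div, abs_of_pos (mul_pos hp hι), lt_div_iff₀ (by positivity)] at h
  have h7 : (p : ℝ) * (p * (δ / p * Fintype.card ι)) = δ * (p * Fintype.card ι) := by
    field_simp
  linarith

end Uniformity

section Extractor

variable {p : ℕ} [Fact p.Prime] {n : ℕ}

lemma cosetFinset_eq_map {F : Type} [Field F] [Fintype F] (u₀ : Fin n → F)
    (U : Submodule F (Fin n → F)) :
    cosetFinset u₀ U = Finset.univ.map
      ((Function.Embedding.subtype (· ∈ U)).trans (addLeftEmbedding u₀)) := by
  ext x
  simp [cosetFinset, eq_comm]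

lemma closeToUniform_cosetFinset_iff {F : Type} [Field F] [Fintype F] (f : (Fin n → F) → F)
    (u₀ : Fin n → F) (U : Submodule F (Fin n → F)) (δ : ℝ) :
    CloseToUniform f (cosetFinset u₀ U) δ ↔
      CloseToUniform (fun u : U => f (u₀ + u)) Finset.univ δ := by
  simp only [CloseToUniform, cosetFinset_eq_map, Finset.filter_map, Finset.card_map]
  rfl

lemma AffineDisperser.pos {F : Type} [Field F] {f : (Fin n → F) → F} {k : ℕ}
    (h : AffineDisperser f k) : 0 < k := by
  refine Nat.pos_of_ne_zero fun hk => ?_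
  obtain ⟨u, hu, v, hv, huv⟩ := h 0 ⊥ (by rw [finrank_bot, hk])
  rw [(Submodule.mem_bot F).1 hu, (Submodule.mem_bot F).1 hv] at huv
  exact huv rfl

lemma AffineDisperser.not_constantOnCoset {f : (Fin n → ZMod p) → ZMod p} {k : ℕ}
    (h : AffineDisperser f k) : ¬ ConstantOnCoset k f := by
  rintro ⟨u, W, hW, hf⟩
  obtain ⟨v, hv⟩ := exists_linearIndependent_of_le_finrank hW
  have hv' : LinearIndependent (ZMod p) fun i => (v i : Fin n → ZMod p) :=
    hv.map' W.subtype W.ker_subtype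
  obtain ⟨a, ha, b, hb, hab⟩ := h u (Submodule.span (ZMod p) (Set.range fun i => (v i : Fin n → ZMod p)))
    (by rw [finrank_span_eq_card hv', Fintype.card_fin])
  have hle : Submodule.span (ZMod p) (Set.range fun i => (v i : Fin n → ZMod p)) ≤ W := by
    rw [Submodule.span_le]
    rintro _ ⟨i, rfl⟩
    exact (v i).2
  exact hab ((hf a (hle ha)).trans (hf b (hle hb)).symm)

lemma exists_pow_ge {p : ℕ} (hp : 2 ≤ p) {δ : ℝ} (hδ : δ ∈ Set.Ioo (0 : ℝ) 1) :
    ∃ N : ℕ, p / δ ≤ p ^ N ∧ (2 : ℝ) ^ (N + 1) ≤ 8 * δ⁻¹ := by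
  have h1 : (1 : ℝ) ≤ δ⁻¹ := (one_le_inv₀ hδ.1).2 hδ.2.le
  obtain ⟨m, h2, h3⟩ := exists_nat_pow_near h1 (one_lt_two : (1 : ℝ) < 2)
  have hp' : (2 : ℝ) ≤ p := by exact_mod_cast hp
  refine ⟨m + 2, ?_, ?_⟩
  · rw [pow_succ', div_eq_mul_inv]
    refine mul_le_mul_of_nonneg_left ?_ (by positivity)
    exact h3.le.trans (pow_le_pow_left₀ two_pos.le hp' _)
  · calc (2 : ℝ) ^ (m + 2 + 1) = 8 * 2 ^ m := by ring
      _ ≤ 8 * δ⁻¹ := by linarith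

lemma closeToUniform_of_disperser (f : MvPolynomial (Fin n) (ZMod p)) (hf : f.totalDegree ≤ 4)
    {k N : ℕ} (h : AffineDisperser (fun x => eval x f) k) {δ : ℝ} (hδ : 0 < δ)
    (hN : p / δ ≤ p ^ N) (u₀ : Fin n → ZMod p) (U : Submodule (ZMod p) (Fin n → ZMod p))
    (hU : quarticDim N k ≤ Module.finrank (ZMod p) U) :
    CloseToUniform (fun x => eval x f) (cosetFinset u₀ U) δ := by
  rw [closeToUniform_cosetFinset_iff]
  intro A
  by_contra! hA
  rw [ZMod.card, Finset.card_univ] at hA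
  obtain ⟨a, ha, hb⟩ := exists_biased _ hδ hN A hA
  have hdeg : DegLT 5 fun u : U => a * eval (u₀ + (u : Fin n → ZMod p)) f :=
    DegLT.mul (a := 1) (b := 5) (by omega) (DegLT.const a)
      ((DegLT.eval f hf).comp U.subtype.toAddMonoidHom u₀)
  obtain ⟨u, W, hW, hc⟩ := constantOnCoset_of_degLT_five hdeg hb hU
  refine h.not_constantOnCoset
    ⟨u₀ + u, W.map U.subtype, by rwa [Submodule.finrank_map_subtype_eq], ?_⟩
  rintro _ ⟨w, hw, rfl⟩
  have := mul_left_cancel₀ ha (hc w hw)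
  simpa [add_assoc] using this

end Extractor

theorem stmt_16 : ∃ C c : ℝ, 0 < C ∧ 0 < c ∧
    ∀ (p : ℕ) [Fact p.Prime], ∀ (δ : ℝ), δ ∈ Set.Ioo (0 : ℝ) 1 →
    ∀ (n k : ℕ) (f : MvPolynomial (Fin n) (ZMod p)),
      f.totalDegree ≤ 4 →
      AffineDisperser (fun x => eval x f) k →
      AffineExtractor (fun x => eval x f) ⌈(k : ℝ) * C * δ ^ (-c)⌉₊ δ := by
  obtain ⟨a, ha⟩ := expBounded_quarticDim
  refine ⟨8 ^ (a + 1), (a + 1 : ℕ), by positivity, by positivity, ?_⟩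
  intro p _ δ hδ n k f hf hk u₀ U hU
  obtain ⟨N, hN, hN'⟩ := exists_pow_ge (Fact.out : p.Prime).two_le hδ
  refine closeToUniform_of_disperser f hf hk hδ.1 hN u₀ U ?_
  rw [hU]
  refine (quarticDim_le N hk.pos).trans ?_
  have h1 : (quarticDim N 1 : ℝ) ≤ 8 ^ (a + 1) * δ ^ (-((a + 1 : ℕ) : ℝ)) := by
    calc (quarticDim N 1 : ℝ) ≤ 2 ^ (a * (N + 1)) := by exact_mod_cast ha N
      _ ≤ 2 ^ ((a + 1) * (N + 1)) :=
        pow_le_pow_right₀ one_le_two (Nat.mul_le_mul_right _ a.le_succ)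
      _ = (2 ^ (N + 1)) ^ (a + 1) := by rw [← pow_mul, mul_comm]
      _ ≤ (8 * δ⁻¹) ^ (a + 1) := pow_le_pow_left₀ (by positivity) hN' _
      _ = _ := by rw [mul_pow, inv_pow, Real.rpow_neg hδ.1.le, Real.rpow_natCast]
  have h2 : ((k * quarticDim N 1 : ℕ) : ℝ) ≤ k * 8 ^ (a + 1) * δ ^ (-((a + 1 : ℕ) : ℝ)) := by
    rw [mul_assoc, Nat.cast_mul]
    exact mul_le_mul_of_nonneg_left h1 (Nat.cast_nonneg _)
  exact_mod_cast h2.trans (Nat.le_ceil _)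
end

section
/- There exists a universal constant α > 0 such that the following holds for all n, every integer d ≥ 1, and every ε ≥ 0. Let f : F_2^n → F_2 be an affine extractor for dimension ⌊α · n^{1/(d-1)!}⌋ with bias ε. Then for every polynomial g : F_2^n → F_2 of total degree at most d, the correlation |2^{-n} · Σ_{x ∈ F_2^n} (-1)^{f(x)} · (-1)^{g(x)}| is at most 2ε. -/
open MvPolynomial
open scoped Classical

section FiniteDifferences

variable {V : Type} [AddCommGroup V]

/-- The finite difference of `g` in direction `h`. -/
def finDiff (h : V) (g : V → ZMod 2) : V → ZMod 2 := fun x => g (x + h) + g x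

/-- The iterated finite difference of `g` along a list of directions. -/
def listDiff : List V → (V → ZMod 2) → V → ZMod 2
  | [], g => g
  | h :: L, g => listDiff L (finDiff h g)

lemma finDiff_comm (a b : V) (g : V → ZMod 2) :
    finDiff a (finDiff b g) = finDiff b (finDiff a g) := by
  funext x
  simp only [finDiff, add_right_comm x a b]
  ring

lemma finDiff_add (h : V) (g g' : V → ZMod 2) :
    finDiff h (g + g') = finDiff h g + finDiff h g' := by
  funext x
  simp only [finDiff, Pi.add_apply]
  ring

lemma finDiff_zero (h : V) : finDiff h 0 = 0 := by
  funext x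
  simp [finDiff]

lemma listDiff_zero (L : List V) : listDiff L 0 = 0 := by
  induction L with
  | nil => rfl
  | cons h L ih => rw [listDiff, finDiff_zero, ih]

lemma listDiff_add (L : List V) (g g' : V → ZMod 2) :
    listDiff L (g + g') = listDiff L g + listDiff L g' := by
  induction L generalizing g g' with
  | nil => rfl
  | cons h L ih => rw [listDiff, finDiff_add, ih]; rfl

lemma listDiff_perm {L M : List V} (h : L.Perm M) (g : V → ZMod 2) :
    listDiff L g = listDiff M g := by
  induction h generalizing g with
  | nil => rfl
  | cons a _ ih => exact ih _
  | swap a b L => simp only [listDiff, finDiff_comm]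
  | trans _ _ ih₁ ih₂ => rw [ih₁, ih₂]

lemma finDiff_add_direction (a b : V) (g : V → ZMod 2) :
    finDiff (a + b) g = finDiff a g + finDiff b g + finDiff a (finDiff b g) := by
  funext x
  simp only [finDiff, Pi.add_apply, add_assoc]
  generalize g (x + (a + b)) = p, g (x + a) = q, g (x + b) = r, g x = s
  revert p q r s
  decide

/-- `g` is annihilated by every `d`-fold finite difference, that is, `g` has degree `< d`. -/
def DegreeLT (d : ℕ) (g : V → ZMod 2) : Prop :=
  ∀ L : List V, L.length = d → listDiff L g = 0

lemma degreeLT_succ {d : ℕ} {g : V → ZMod 2} :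
    DegreeLT (d + 1) g ↔ ∀ h, DegreeLT d (finDiff h g) := by
  constructor
  · intro H h L hL
    exact H (h :: L) (by simp [hL])
  · rintro H (_ | ⟨h, L⟩) hL
    · simp at hL
    · exact H h L (by simpa using hL)

lemma degreeLT_zero {g : V → ZMod 2} : DegreeLT 0 g ↔ g = 0 := by
  constructor
  · intro H
    exact H [] rfl
  · rintro rfl L _
    exact listDiff_zero L

lemma DegreeLT.add {d : ℕ} {g g' : V → ZMod 2} (hg : DegreeLT d g) (hg' : DegreeLT d g') :
    DegreeLT d (g + g') := by
  intro L hL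
  rw [listDiff_add, hg L hL, hg' L hL, add_zero]

lemma DegreeLT.zero (d : ℕ) : DegreeLT d (0 : V → ZMod 2) := fun L _ => listDiff_zero L

lemma DegreeLT.succ {d : ℕ} {g : V → ZMod 2} (hg : DegreeLT d g) : DegreeLT (d + 1) g := by
  induction d generalizing g with
  | zero => rw [degreeLT_zero.1 hg]; exact DegreeLT.zero _
  | succ d ih => exact degreeLT_succ.2 fun h => ih (degreeLT_succ.1 hg h)

lemma DegreeLT.mono {d e : ℕ} (hde : d ≤ e) {g : V → ZMod 2} (hg : DegreeLT d g) :
    DegreeLT e g := by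
  induction hde with
  | refl => exact hg
  | step _ ih => exact ih.succ

lemma DegreeLT.const_mul {d : ℕ} {g : V → ZMod 2} (c : ZMod 2) (hg : DegreeLT d g) :
    DegreeLT d (fun x => c * g x) := by
  have hc : c = 0 ∨ c = 1 := by revert c; decide
  rcases hc with rfl | rfl
  · simpa using! DegreeLT.zero (V := V) d
  · simpa using hg

lemma DegreeLT.shift {d : ℕ} {g : V → ZMod 2} (hg : DegreeLT (d + 1) g) (h : V) :
    DegreeLT (d + 1) (fun x => g (x + h)) := by
  have e : (fun x => g (x + h)) = finDiff h g + g := by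
    funext x
    simp only [finDiff, Pi.add_apply]
    rw [add_assoc, CharTwo.add_self_eq_zero, add_zero]
  rw [e]
  exact (degreeLT_succ.1 hg h).succ.add hg

lemma DegreeLT.sum {ι : Type*} {d : ℕ} (s : Finset ι) {g : ι → V → ZMod 2}
    (hg : ∀ i ∈ s, DegreeLT d (g i)) : DegreeLT d (∑ i ∈ s, g i) :=
  Finset.sum_induction g (DegreeLT d) (fun _ _ => DegreeLT.add) (DegreeLT.zero d) hg

lemma listDiff_cons_add {d : ℕ} {g : V → ZMod 2} (hg : DegreeLT (d + 2) g) (a b : V)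
    {L : List V} (hL : L.length = d) :
    listDiff ((a + b) :: L) g = listDiff (a :: L) g + listDiff (b :: L) g := by
  simp only [listDiff, finDiff_add_direction, listDiff_add]
  have h := hg (b :: a :: L) (by simp [hL])
  simp only [listDiff] at h
  rw [h, add_zero]

lemma listDiff_const {d : ℕ} {g : V → ZMod 2} (hg : DegreeLT (d + 1) g)
    {L : List V} (hL : L.length = d) (x : V) :
    listDiff L g x = listDiff L g 0 := by
  have key : ∀ (L : List V) (g : V → ZMod 2) (x : V),
      listDiff (x :: L) g 0 = listDiff L g x + listDiff L g 0 := by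
    intro L
    induction L with
    | nil => intro g x; simp [listDiff, finDiff]
    | cons h L ih =>
      intro g x
      rw [listDiff_perm (List.Perm.swap h x L)]
      exact ih (finDiff h g) x
  have h := key L g x
  rw [hg (x :: L) (by simp [hL])] at h
  exact CharTwo.add_eq_zero.1 h.symm

end FiniteDifferences

section Polynomials

variable {n : ℕ}

lemma DegreeLT.coord_mul {d : ℕ} {g : (Fin n → ZMod 2) → ZMod 2} (hg : DegreeLT d g)
    (i : Fin n) : DegreeLT (d + 1) (fun x => x i * g x) := by
  induction d generalizing g with
  | zero =>
    rw [degreeLT_zero.1 hg]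
    simpa using! DegreeLT.zero (V := Fin n → ZMod 2) 1
  | succ d ih =>
    rw [degreeLT_succ]
    intro h
    have e : finDiff h (fun x => x i * g x) =
        (fun x => x i * finDiff h g x) + fun x => h i * g (x + h) := by
      funext x
      simp only [finDiff, Pi.add_apply]
      ring
    rw [e]
    exact (ih (degreeLT_succ.1 hg h)).add ((hg.shift h).const_mul (h i))

lemma degreeLT_prod_coords (s : Multiset (Fin n)) :
    DegreeLT (Multiset.card s + 1) (fun x : Fin n → ZMod 2 => (s.map x).prod) := by
  induction s using Multiset.induction with
  | empty =>
    rw [degreeLT_succ]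
    intro h
    refine degreeLT_zero.2 ?_
    funext x
    simp [finDiff, CharTwo.add_self_eq_zero]
  | cons i s ih => simpa using ih.coord_mul i

lemma degreeLT_eval (g : MvPolynomial (Fin n) (ZMod 2)) :
    DegreeLT (g.totalDegree + 1) (fun x => eval x g) := by
  have e : (fun x => eval x g) =
      ∑ m ∈ g.support, fun x => g.coeff m * ((Finsupp.toMultiset m).map x).prod := by
    funext x
    rw [eval_eq, Finset.sum_apply]
    refine Finset.sum_congr rfl fun m _ => ?_
    rw [Finsupp.toMultiset_map, Finsupp.prod_toMultiset, Finsupp.prod_mapDomain_index]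
    · rfl
    · simp
    · simp [pow_add]
  rw [e]
  refine DegreeLT.sum _ fun m hm => ((degreeLT_prod_coords _).const_mul _).mono ?_
  rw [totalDegree_eq]
  exact Nat.succ_le_succ (Finset.le_sup (f := fun m => Multiset.card (Finsupp.toMultiset m)) hm)

end Polynomials

section Subspaces

variable {V : Type} [AddCommGroup V] [Module (ZMod 2) V]

lemma finDiff_self_self (a : V) (g : V → ZMod 2) : finDiff a (finDiff a g) = 0 := by
  have ha : a + a = 0 := by
    rw [← two_smul (ZMod 2) a, show (2 : ZMod 2) = 0 from rfl, zero_smul]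
  funext x
  simp only [finDiff, add_assoc, ha, add_zero, Pi.zero_apply]
  generalize g (x + a) = p, g x = q
  revert p q
  decide

lemma listDiff_restrict (W : Submodule (ZMod 2) V) (v : V) (L : List W) (g : V → ZMod 2) (w : W) :
    listDiff L (fun w : W => g (v + w)) w = listDiff (L.map W.subtype) g (v + w) := by
  induction L generalizing g with
  | nil => rfl
  | cons h L ih =>
    have e : finDiff h (fun w : W => g (v + w)) = fun w : W => finDiff (h : V) g (v + w) := by
      funext x
      simp [finDiff, add_assoc]
    simp only [listDiff, List.map_cons, e]
    exact ih _

lemma listDiff_span_eq_zero {d : ℕ} {g : V → ZMod 2} (hg : DegreeLT (d + 1) g) {S : Set V}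
    (hS : ∀ L : List V, L.length = d → (∀ v ∈ L, v ∈ S) → listDiff L g = 0)
    (L M : List V) (hLM : (L ++ M).length = d) (hL : ∀ v ∈ L, v ∈ Submodule.span (ZMod 2) S)
    (hM : ∀ v ∈ M, v ∈ S) : listDiff (L ++ M) g = 0 := by
  induction L generalizing M with
  | nil => exact hS M hLM hM
  | cons a L ih =>
    cases d with
    | zero => simp at hLM
    | succ d =>
    have hlen : (L ++ M).length = d := by simpa using hLM
    obtain ⟨ha, hL'⟩ := List.forall_mem_cons.1 hL
    clear hL hLM
    change listDiff (a :: (L ++ M)) g = 0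
    induction ha using Submodule.span_induction with
    | mem x hx =>
      rw [← listDiff_perm List.perm_middle]
      refine ih (x :: M) ?_ hL' ?_
      · simp at hlen ⊢; omega
      · simpa [hx] using hM
    | zero =>
      have h := listDiff_cons_add hg 0 0 hlen
      rw [add_zero] at h
      simpa using h
    | add x y _ _ hx hy => rw [listDiff_cons_add hg x y hlen, hx, hy, add_zero]
    | smul c x _ hx =>
      have hc : c = 0 ∨ c = 1 := by revert c; decide
      rcases hc with rfl | rfl
      · have h := listDiff_cons_add hg 0 0 hlen
        rw [add_zero] at h
        rw [zero_smul]
        simpa using h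
      · rwa [one_smul]

/-- One direction can be added to a subspace on which all `d`-fold differences vanish. -/
lemma exists_extend [FiniteDimensional (ZMod 2) V] {d j : ℕ} {g : V → ZMod 2}
    (hg : DegreeLT (d + 2) g) (hj : j ^ d + j < Module.finrank (ZMod 2) V) (b : Fin j → V)
    (hb : LinearIndependent (ZMod 2) b)
    (hz : ∀ L : List V, L.length = d + 1 → (∀ v ∈ L, v ∈ Set.range b) → listDiff L g = 0) :
    ∃ b' : Fin (j + 1) → V, LinearIndependent (ZMod 2) b' ∧
      ∀ L : List V, L.length = d + 1 → (∀ v ∈ L, v ∈ Set.range b') → listDiff L g = 0 := by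
  have hadd : ∀ (M : Fin d → Fin j) (x y : V),
      listDiff ((x + y) :: List.ofFn (b ∘ M)) g 0 =
        listDiff (x :: List.ofFn (b ∘ M)) g 0 + listDiff (y :: List.ofFn (b ∘ M)) g 0 := by
    intro M x y
    rw [listDiff_cons_add hg x y (by simp), Pi.add_apply]
  let T : V →ₗ[ZMod 2] ((Fin d → Fin j) → ZMod 2) :=
    (AddMonoidHom.mk' (fun x M => listDiff (x :: List.ofFn (b ∘ M)) g 0)
      (fun x y => funext fun M => hadd M x y)).toZModLinearMap 2
  have hT : ∀ x M, T x M = listDiff (x :: List.ofFn (b ∘ M)) g 0 := fun _ _ => rfl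
  obtain ⟨x, hx, hxb⟩ : ∃ x ∈ LinearMap.ker T, x ∉ Submodule.span (ZMod 2) (Set.range b) := by
    by_contra! h
    have h₁ := Submodule.finrank_mono (show LinearMap.ker T ≤ _ from h)
    have h₂ := LinearMap.finrank_range_add_finrank_ker T
    have h₃ := Submodule.finrank_le (LinearMap.range T)
    rw [finrank_span_eq_card hb, Fintype.card_fin] at h₁
    rw [Module.finrank_pi, Fintype.card_fun, Fintype.card_fin, Fintype.card_fin] at h₃
    omega
  refine ⟨Fin.cons x b, linearIndependent_finCons.2 ⟨hb, hxb⟩, ?_⟩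
  intro L hL hmem
  rw [Fin.range_cons] at hmem
  by_cases hxL : x ∈ L
  · obtain ⟨M, hM⟩ : ∃ M, L.Perm (x :: M) := ⟨_, List.perm_cons_erase hxL⟩
    have hMlen : M.length = d := by simpa [hL] using hM.length_eq.symm
    rw [listDiff_perm hM]
    by_cases hxM : x ∈ M
    · rw [listDiff_perm ((List.perm_cons_erase hxM).cons x), listDiff, listDiff,
        finDiff_self_self, listDiff_zero]
    · have hMb : ∀ i : Fin d, ∃ k, b k = M.get (i.cast hMlen.symm) := by
        intro i
        have hi : M.get (i.cast hMlen.symm) ∈ M := List.get_mem _ _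
        rcases hmem _ (hM.mem_iff.2 (List.mem_cons_of_mem _ hi)) with h | h
        · exact absurd (h ▸ hi) hxM
        · exact h
      choose N hN using hMb
      have hMN : M = List.ofFn (b ∘ N) := by
        subst hMlen
        conv_lhs => rw [← List.ofFn_get M]
        exact congrArg _ (funext fun i => (hN i).symm)
      funext y
      rw [listDiff_const hg (by simp [hMlen]), hMN, ← hT, LinearMap.mem_ker.1 hx]
      rfl
  · refine hz L hL fun v hv => ?_
    rcases hmem v hv with h | h
    · exact absurd (h ▸ hv) hxL
    · exact h

/-- A function of degree at most `d + 1` on a space of large dimension has degree at most `d` on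
all cosets of some subspace of dimension `m`. -/
lemma exists_subspace_degreeLT [FiniteDimensional (ZMod 2) V] {d m : ℕ} {g : V → ZMod 2}
    (hg : DegreeLT (d + 2) g) (hm : ∀ j < m, j ^ d + j < Module.finrank (ZMod 2) V) :
    ∃ W : Submodule (ZMod 2) V, Module.finrank (ZMod 2) W = m ∧
      ∀ v : V, DegreeLT (d + 1) (fun w : W => g (v + w)) := by
  have key : ∀ i ≤ m, ∃ b : Fin i → V, LinearIndependent (ZMod 2) b ∧
      ∀ L : List V, L.length = d + 1 → (∀ v ∈ L, v ∈ Set.range b) → listDiff L g = 0 := by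
    intro i
    induction i with
    | zero =>
      refine fun _ => ⟨Fin.elim0, linearIndependent_empty_type, fun L hL h => ?_⟩
      cases L with
      | nil => simp at hL
      | cons a L => simpa using h a
    | succ i ih =>
      intro hi
      obtain ⟨b, hb, hz⟩ := ih (by omega)
      exact exists_extend hg (hm i hi) b hb hz
  obtain ⟨b, hb, hz⟩ := key m le_rfl
  refine ⟨Submodule.span (ZMod 2) (Set.range b), by simpa using finrank_span_eq_card hb, ?_⟩
  intro v L hL
  funext w
  have h := listDiff_span_eq_zero hg hz (L.map (Submodule.subtype _)) [] (by simpa using hL)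
    (by simp +contextual) (by simp)
  rw [listDiff_restrict, ← List.append_nil (L.map _), h]
  rfl

/-- The sign `(-1) ^ a`. -/
noncomputable def sgn (a : ZMod 2) : ℝ := if a = 0 then 1 else -1

lemma abs_sgn (a : ZMod 2) : |sgn a| = 1 := by
  unfold sgn
  split_ifs <;> simp

/-- A uniform bound on the cosets of a subspace gives a bound on the whole space. -/
lemma abs_sum_le_of_cosets [Fintype V] (W : Submodule (ZMod 2) V) (F : V → ℝ) (δ : ℝ)
    (h : ∀ v : V, |∑ w : W, F (v + w)| ≤ δ * Fintype.card W) :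
    |∑ v, F v| ≤ δ * Fintype.card V := by
  have hW : (0 : ℝ) < Fintype.card W := by exact_mod_cast Fintype.card_pos
  have e : (Fintype.card W : ℝ) * ∑ v, F v = ∑ v, ∑ w : W, F (v + w) := by
    rw [Finset.sum_comm]
    have : ∀ w : W, ∑ v, F (v + w) = ∑ v, F v := fun w =>
      Equiv.sum_comp (Equiv.addRight (w : V)) F
    simp [this]
  have h₁ : |∑ v, ∑ w : W, F (v + w)| ≤ ∑ _v : V, δ * Fintype.card W :=
    (Finset.abs_sum_le_sum_abs _ _).trans (Finset.sum_le_sum fun v _ => h v)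
  rw [← e, abs_mul, abs_of_pos hW, Finset.sum_const, Finset.card_univ, nsmul_eq_mul] at h₁
  refine le_of_mul_le_mul_left (h₁.trans_eq ?_) hW
  ring

end Subspaces

/-- The sum of `f` over every coset of every `k`-dimensional subspace is at most `δ` times the
size of the coset. -/
def CosetBound {V : Type} [AddCommGroup V] [Module (ZMod 2) V] [Fintype V]
    (f : V → ℝ) (k : ℕ) (δ : ℝ) : Prop :=
  ∀ (v : V) (U : Submodule (ZMod 2) V), Module.finrank (ZMod 2) U = k →
    |∑ u : U, f (v + u)| ≤ δ * Fintype.card U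

section Correlation

variable {V : Type} [AddCommGroup V] [Module (ZMod 2) V] [Fintype V]

lemma CosetBound.restrict {f : V → ℝ} {k : ℕ} {δ : ℝ} (hf : CosetBound f k δ)
    (W : Submodule (ZMod 2) V) (v : V) : CosetBound (fun w : W => f (v + w)) k δ := by
  intro w U hU
  let e : U ≃ U.map W.subtype := (W.equivSubtypeMap U).toEquiv
  have h := hf (v + w) (U.map W.subtype) (by
    rw [← hU]; exact (W.equivSubtypeMap U).finrank_eq.symm)
  rw [← Equiv.sum_comp e, ← Fintype.card_congr e] at h
  simpa [e, add_assoc] using h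

lemma CosetBound.abs_sum_le {f : V → ℝ} {k : ℕ} {δ : ℝ} (hf : CosetBound f k δ)
    (hk : k ≤ Module.finrank (ZMod 2) V) : |∑ v, f v| ≤ δ * Fintype.card V := by
  obtain ⟨b, hb⟩ := exists_linearIndependent_of_le_finrank hk
  refine abs_sum_le_of_cosets (Submodule.span (ZMod 2) (Set.range b)) f δ fun v => hf v _ ?_
  simpa using finrank_span_eq_card hb

lemma abs_sum_mul_sgn_le_of_degreeLT_one {f : V → ℝ} {k : ℕ} {δ : ℝ} (hf : CosetBound f k δ)
    (hk : k ≤ Module.finrank (ZMod 2) V) {g : V → ZMod 2} (hg : DegreeLT 1 g) :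
    |∑ v, f v * sgn (g v)| ≤ δ * Fintype.card V := by
  have h : ∀ v, g v = g 0 := fun v => listDiff_const (L := []) hg rfl v
  simp only [h]
  rw [← Finset.sum_mul, abs_mul, abs_sgn, mul_one]
  exact hf.abs_sum_le hk

/-- The degree reduction step: a correlation bound for degree `d` in dimension `m` gives one for
degree `d + 1`. -/
lemma abs_sum_mul_sgn_le_of_reduction {d k m : ℕ} {δ : ℝ}
    (H : ∀ (W : Submodule (ZMod 2) V), Module.finrank (ZMod 2) W = m →
      ∀ f : W → ℝ, CosetBound f k δ → ∀ g : W → ZMod 2, DegreeLT (d + 1) g →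
        |∑ w, f w * sgn (g w)| ≤ δ * Fintype.card W)
    (hm : ∀ j < m, j ^ d + j < Module.finrank (ZMod 2) V)
    {f : V → ℝ} (hf : CosetBound f k δ) {g : V → ZMod 2} (hg : DegreeLT (d + 2) g) :
    |∑ v, f v * sgn (g v)| ≤ δ * Fintype.card V := by
  obtain ⟨W, hW, hWg⟩ := exists_subspace_degreeLT hg hm
  exact abs_sum_le_of_cosets W _ δ fun v => H W hW _ (hf.restrict W v) _ (hWg v)

end Correlation

lemma pow_add_self_lt {e j m : ℕ} (he : 2 ≤ e) (hj : j < m) : j ^ e + j < m ^ e := by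
  refine lt_of_lt_of_le ?_ (Nat.pow_le_pow_left hj e)
  obtain ⟨e, rfl⟩ := Nat.exists_eq_add_of_le' he
  calc j ^ (e + 2) + j = j ^ (e + 1) * j + j := by ring
    _ ≤ (j + 1) ^ (e + 1) * j + j := by gcongr; omega
    _ < (j + 1) ^ (e + 1) * j + (j + 1) ^ (e + 1) := by
        have h₃ : j + 1 ≤ (j + 1) ^ (e + 1) := Nat.le_self_pow (Nat.succ_ne_zero e) _
        omega
    _ = (j + 1) ^ (e + 2) := by ring

/-- A function with small sums over all cosets of dimension `k` has small correlation with every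
function of degree at most `d + 1`, in dimension at least `(4 * k) ^ d!`. -/
lemma abs_sum_mul_sgn_le {k : ℕ} {δ : ℝ} (d : ℕ) {V : Type} [AddCommGroup V]
    [Module (ZMod 2) V] [Fintype V] (hV : (4 * k) ^ d.factorial ≤ Module.finrank (ZMod 2) V)
    {f : V → ℝ} (hf : CosetBound f k δ) {g : V → ZMod 2} (hg : DegreeLT (d + 2) g) :
    |∑ v, f v * sgn (g v)| ≤ δ * Fintype.card V := by
  have linear : ∀ {V : Type} [AddCommGroup V] [Module (ZMod 2) V] [Fintype V],
      2 * k ≤ Module.finrank (ZMod 2) V → ∀ {f : V → ℝ}, CosetBound f k δ →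
      ∀ {g : V → ZMod 2}, DegreeLT 2 g → |∑ v, f v * sgn (g v)| ≤ δ * Fintype.card V := by
    intro V _ _ _ hV f hf g hg
    refine abs_sum_mul_sgn_le_of_reduction (d := 0) (m := k) (fun W hW f hf g hg =>
      abs_sum_mul_sgn_le_of_degreeLT_one hf hW.ge hg) (fun j hj => ?_) hf hg
    rw [pow_zero]
    omega
  induction d generalizing V with
  | zero => exact linear (by simp at hV; omega) hf hg
  | succ d ih =>
    rcases Nat.eq_zero_or_pos d with rfl | hd
    · refine abs_sum_mul_sgn_le_of_reduction (m := 2 * k)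
        (fun W hW f hf g hg => linear hW.ge hf hg) (fun j hj => ?_) hf hg
      simp at hV ⊢
      omega
    · refine abs_sum_mul_sgn_le_of_reduction (m := (4 * k) ^ d.factorial)
        (fun W hW f hf g hg => ih hW.ge hf hg) (fun j hj => ?_) hf hg
      refine (pow_add_self_lt (by omega) hj).trans_le ?_
      rwa [← pow_mul, mul_comm d.factorial, ← Nat.factorial_succ]

lemma AffineExtractor.cosetBound {n k : ℕ} {ε : ℝ} {f : (Fin n → ZMod 2) → ZMod 2}
    (hf : AffineExtractor f k ε) : CosetBound (fun x => sgn (f x)) k (2 * ε) := by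
  intro v U hU
  have hS : cosetFinset v U = Finset.univ.image (fun u : U => v + (u : Fin n → ZMod 2)) := by
    ext x
    simp [cosetFinset, eq_comm]
  have hinj : Function.Injective (fun u : U => v + (u : Fin n → ZMod 2)) := fun a b h =>
    Subtype.ext (add_left_cancel h)
  have h : |(((cosetFinset v U).filter fun x => f x ∈ ({0} : Finset (ZMod 2))).card : ℝ) /
      ((cosetFinset v U).card : ℝ) - (({0} : Finset (ZMod 2)).card : ℝ) /
        (Fintype.card (ZMod 2) : ℝ)| ≤ ε := by
    convert hf v U hU {0}
  have hcard : (cosetFinset v U).card = Fintype.card U := by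
    rw [hS, Finset.card_image_of_injective _ hinj, Finset.card_univ]
  have hpos : (0 : ℝ) < Fintype.card U := by exact_mod_cast Fintype.card_pos
  have hsum : ∑ u : U, sgn (f (v + u)) =
      2 * (((cosetFinset v U).filter fun x => f x ∈ ({0} : Finset (ZMod 2))).card : ℝ) -
        Fintype.card U := by
    have e : ∀ a, sgn a = 2 * (if a ∈ ({0} : Finset (ZMod 2)) then 1 else 0) - 1 := by
      intro a
      simp only [sgn, Finset.mem_singleton]
      split_ifs <;> norm_num
    rw [← hcard, Finset.card_filter, Finset.card_eq_sum_ones, hS, Finset.sum_image hinj.injOn,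
      Finset.sum_image hinj.injOn]
    push_cast
    rw [Finset.mul_sum, ← Finset.sum_sub_distrib]
    exact Finset.sum_congr rfl fun u _ => e _
  rw [hcard, ZMod.card, Finset.card_singleton] at h
  rw [hsum]
  generalize (((cosetFinset v U).filter fun x => f x ∈ ({0} : Finset (ZMod 2))).card : ℝ) = c at *
  have e : 2 * c - (Fintype.card U : ℝ) =
      2 * Fintype.card U * (c / Fintype.card U - ((1 : ℕ) : ℝ) / ((2 : ℕ) : ℝ)) := by
    push_cast
    field_simp
  rw [e, abs_mul, abs_of_pos (by positivity)]
  nlinarith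

theorem stmt_17 : ∃ α : ℝ, 0 < α ∧
    ∀ (n d : ℕ), 1 ≤ d →
    ∀ (ε : ℝ), 0 ≤ ε →
    ∀ f : (Fin n → ZMod 2) → ZMod 2,
      AffineExtractor f ⌊α * (n : ℝ) ^ ((1 : ℝ) / (Nat.factorial (d - 1) : ℝ))⌋₊ ε →
      ∀ g : MvPolynomial (Fin n) (ZMod 2), g.totalDegree ≤ d →
        |(2 : ℝ) ^ (-(n : ℝ)) * ∑ x : Fin n → ZMod 2,
            (if f x = 0 then (1 : ℝ) else -1) * (if eval x g = 0 then (1 : ℝ) else -1)| ≤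
          2 * ε := by
  refine ⟨1 / 4, by norm_num, ?_⟩
  intro n d hd ε hε f hf g hg
  suffices h : |∑ x : Fin n → ZMod 2, sgn (f x) * sgn (eval x g)| ≤
      2 * ε * Fintype.card (Fin n → ZMod 2) by
    rw [Fintype.card_fun, ZMod.card, Fintype.card_fin] at h
    push_cast at h
    rw [abs_mul, abs_of_pos (by positivity), Real.rpow_neg zero_le_two, Real.rpow_natCast,
      inv_mul_le_iff₀ (by positivity), mul_comm _ (2 * ε)]
    exact h
  have hb := hf.cosetBound
  obtain ⟨d, rfl⟩ := Nat.exists_eq_add_of_le' hd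
  rw [Nat.add_sub_cancel] at hb
  set k := ⌊1 / 4 * (n : ℝ) ^ ((1 : ℝ) / (Nat.factorial d : ℝ))⌋₊
  refine abs_sum_mul_sgn_le d ?_ hb ((degreeLT_eval g).mono (by omega))
  rw [Module.finrank_fin_fun]
  have h₁ : (k : ℝ) ≤ 1 / 4 * (n : ℝ) ^ ((1 : ℝ) / (Nat.factorial d : ℝ)) :=
    Nat.floor_le (by positivity)
  have h₂ : (4 * k : ℝ) ≤ (n : ℝ) ^ ((1 : ℝ) / (Nat.factorial d : ℝ)) := by linarith
  have h₃ := pow_le_pow_left₀ (by positivity) h₂ d.factorial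
  rw [one_div, Real.rpow_inv_natCast_pow (by positivity) (Nat.factorial_ne_zero d)] at h₃
  exact_mod_cast h₃
end
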